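/- Let n ≥ 2, and let m, δ > 0. Let u be a harmonic function on the open unit ball B = B(0,1) ⊂ ℝⁿ with sup_B |∇u| = 1, and let E ⊆ B(0,1/2) be a set with H^{n-2+δ}_∞(E) > m. Then there exist constants C, α > 0 depending only on m, δ and n such that sup_{B(0,1/2)} |∇u| ≤ C · (sup_E |∇u|)^α. -/

import Mathlib

open MeasureTheory Metric Set ENNReal Matrix RealInnerProductSpace

/-- `sup` of `|∇u|` over a set. -/
noncomputable def supGrad {n : ℕ} (u : EuclideanSpace ℝ (Fin n) → ℝ)
    (s : Set (EuclideanSpace ℝ (Fin n))) : ℝ :=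
  sSup ((fun x => ‖fderiv ℝ u x‖) '' s)

/-- `u` is harmonic on `U`: smooth on `U` and its Laplacian vanishes on `U`. -/
def IsHarmonicOn {n : ℕ} (u : EuclideanSpace ℝ (Fin n) → ℝ)
    (U : Set (EuclideanSpace ℝ (Fin n))) : Prop :=
  ContDiffOn ℝ (⊤ : ℕ∞) u U ∧
    ∀ x ∈ U, ∑ i : Fin n,
      fderiv ℝ (fun y => fderiv ℝ u y (EuclideanSpace.single i 1)) x (EuclideanSpace.single i 1) = 0

/-- normalized doubling index of the gradient on `B(x,r)`:
`N(x,r) = log ( sup_{B(x,2r)} |∇u| / sup_{B(x,r)} |∇u| )`. -/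
noncomputable def doublingIndex {n : ℕ} (u : EuclideanSpace ℝ (Fin n) → ℝ)
    (x : EuclideanSpace ℝ (Fin n)) (r : ℝ) : ℝ :=
  Real.log (supGrad u (ball x (2 * r)) / supGrad u (ball x r))

/-- the closed axis-parallel cube with center `c` and side length `ℓ` -/
def cube {n : ℕ} (c : EuclideanSpace ℝ (Fin n)) (ℓ : ℝ) : Set (EuclideanSpace ℝ (Fin n)) :=
  {x | ∀ i, |x i - c i| ≤ ℓ / 2}

/-- maximal normalized doubling index of the cube of center `c` and side `ℓ`:
`N(Q) = sup_{x ∈ Q, 0 < r ≤ ℓ(Q)} log ( sup_{B(x,10nr)} |∇u| / sup_{B(x,r)} |∇u| )`. -/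
noncomputable def cubeDoublingIndex {n : ℕ} (u : EuclideanSpace ℝ (Fin n) → ℝ)
    (c : EuclideanSpace ℝ (Fin n)) (ℓ : ℝ) : ℝ :=
  sSup {t | ∃ x ∈ cube c ℓ, ∃ r : ℝ, 0 < r ∧ r ≤ ℓ ∧
    t = Real.log (supGrad u (ball x (10 * n * r)) / supGrad u (ball x r))}

/-- `s`-dimensional Hausdorff content -/
noncomputable def hausdorffContent {n : ℕ} (s : ℝ) (E : Set (EuclideanSpace ℝ (Fin n))) : ℝ≥0∞ :=
  ⨅ (U : ℕ → Set (EuclideanSpace ℝ (Fin n))) (_ : E ⊆ ⋃ i, U i), ∑' i, EMetric.diam (U i) ^ s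

/-- Riesz `s`-energy of a measure: `I_s(μ) = ∬ |x-y|^{-s} dμ(x) dμ(y)`. -/
noncomputable def rieszEnergy {n : ℕ} (s : ℝ) (μ : Measure (EuclideanSpace ℝ (Fin n))) : ℝ≥0∞ :=
  ∫⁻ x, ∫⁻ y, edist x y ^ (-s) ∂μ ∂μ

/-- Riesz `s`-capacity of a set: the sup of `I_s(μ)⁻¹` over probability measures compactly
supported in `E`. -/
noncomputable def rieszCapacity {n : ℕ} (s : ℝ) (E : Set (EuclideanSpace ℝ (Fin n))) : ℝ≥0∞ :=
  ⨆ (μ : Measure (EuclideanSpace ℝ (Fin n)))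
    (_ : μ E = 1 ∧ ∃ K, IsCompact K ∧ K ⊆ E ∧ μ Kᶜ = 0), (rieszEnergy s μ)⁻¹

/-- a function `Fin n → ℝ` regarded as a point of `EuclideanSpace ℝ (Fin n)` -/
noncomputable def vec {n : ℕ} (f : Fin n → ℝ) : EuclideanSpace ℝ (Fin n) :=
  (EuclideanSpace.equiv (Fin n) ℝ).symm f

/-- center of the subcube indexed by `k` when the cube of center `c` and side `ℓ` is divided
into `M^n` congruent subcubes -/
noncomputable def subCenter {n : ℕ} (c : EuclideanSpace ℝ (Fin n)) (ℓ : ℝ) (M : ℕ)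
    (k : Fin n → Fin M) : EuclideanSpace ℝ (Fin n) :=
  vec (fun i => c i + (((k i : ℝ) + 1 / 2) / M - 1 / 2) * ℓ)

/-- the last coordinate index of `Fin n` -/
def lastIdx (n : ℕ) (hn : 0 < n) : Fin n := ⟨n - 1, Nat.sub_lt hn Nat.one_pos⟩

/-- the hyperplane `{xₙ = 0}` -/
def lastHyperplane (n : ℕ) (hn : 0 < n) : Set (EuclideanSpace ℝ (Fin n)) :=
  {x | x (lastIdx n hn) = 0}

namespace PoS

open MvPolynomial in
/-- weighted l1 norm of coefficients -/
noncomputable def wn {ι : Type*} (w : ℕ → ℝ) (q : MvPolynomial ι ℝ) : ℝ :=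
  ∑ γ ∈ q.support, |MvPolynomial.coeff γ q| * w γ.degree

noncomputable def pn {ι : Type*} (r : ℝ) (q : MvPolynomial ι ℝ) : ℝ := wn (fun j => r ^ j) q

section wn
variable {ι κ : Type*}
open MvPolynomial

lemma wn_eq_of_subset (w : ℕ → ℝ) (q : MvPolynomial ι ℝ) {s : Finset (ι →₀ ℕ)}
    (hs : q.support ⊆ s) : wn w q = ∑ γ ∈ s, |coeff γ q| * w γ.degree := by
  unfold wn
  apply Finset.sum_subset hs
  intro γ _ h
  rw [notMem_support_iff.mp h]; simp

lemma wn_nonneg {w : ℕ → ℝ} (hw : ∀ j, 0 ≤ w j) (q : MvPolynomial ι ℝ) : 0 ≤ wn w q :=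
  Finset.sum_nonneg fun _ _ => mul_nonneg (abs_nonneg _) (hw _)

lemma wn_zero (w : ℕ → ℝ) : wn w (0 : MvPolynomial ι ℝ) = 0 := by simp [wn]

lemma wn_add_le {w : ℕ → ℝ} (hw : ∀ j, 0 ≤ w j) (p q : MvPolynomial ι ℝ) :
    wn w (p + q) ≤ wn w p + wn w q := by
  classical
  rw [wn_eq_of_subset w (p+q) (support_add (p := p) (q := q)),
    wn_eq_of_subset w p (Finset.subset_union_left (s₂ := q.support)),
    wn_eq_of_subset w q (Finset.subset_union_right (s₁ := p.support)), ← Finset.sum_add_distrib]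
  apply Finset.sum_le_sum
  intro γ _
  rw [coeff_add, ← add_mul]
  exact mul_le_mul_of_nonneg_right (abs_add_le _ _) (hw _)

lemma wn_sum_le {w : ℕ → ℝ} (hw : ∀ j, 0 ≤ w j) {α : Type*} (s : Finset α)
    (f : α → MvPolynomial ι ℝ) : wn w (∑ a ∈ s, f a) ≤ ∑ a ∈ s, wn w (f a) := by
  classical
  induction s using Finset.induction_on with
  | empty => simp [wn_zero]
  | insert a s ha ih =>
    rw [Finset.sum_insert ha, Finset.sum_insert ha]
    exact (wn_add_le hw _ _).trans (by linarith)

lemma wn_C_mul (w : ℕ → ℝ) (a : ℝ) (q : MvPolynomial ι ℝ) : wn w (C a * q) = |a| * wn w q := by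
  rw [wn_eq_of_subset w (C a * q) (s := q.support)]
  · unfold wn
    rw [Finset.mul_sum]
    apply Finset.sum_congr rfl
    intro γ _
    rw [coeff_C_mul, abs_mul, mul_assoc]
  · intro γ
    simp only [mem_support_iff, coeff_C_mul]
    exact right_ne_zero_of_mul

lemma wn_neg (w : ℕ → ℝ) (q : MvPolynomial ι ℝ) : wn w (-q) = wn w q := by
  have := wn_C_mul w (-1) q
  simpa using this

lemma wn_mono {w w' : ℕ → ℝ} (h : ∀ j, w j ≤ w' j) (q : MvPolynomial ι ℝ) : wn w q ≤ wn w' q :=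
  Finset.sum_le_sum fun _ _ => mul_le_mul_of_nonneg_left (h _) (abs_nonneg _)

lemma wn_lin (a b : ℝ) (w w' : ℕ → ℝ) (q : MvPolynomial ι ℝ) :
    wn (fun j => a * w j + b * w' j) q = a * wn w q + b * wn w' q := by
  unfold wn
  rw [Finset.mul_sum, Finset.mul_sum, ← Finset.sum_add_distrib]
  apply Finset.sum_congr rfl
  intros; ring

lemma coeff_le_wn {w : ℕ → ℝ} (hw : ∀ j, 0 ≤ w j) (q : MvPolynomial ι ℝ) (γ : ι →₀ ℕ) :
    |coeff γ q| * w γ.degree ≤ wn w q := by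
  classical
  by_cases h : γ ∈ q.support
  · exact Finset.single_le_sum (f := fun γ => |coeff γ q| * w γ.degree)
      (fun _ _ => mul_nonneg (abs_nonneg _) (hw _)) h
  · rw [notMem_support_iff.mp h]; simpa using wn_nonneg hw q

lemma pn_nonneg {r : ℝ} (hr : 0 ≤ r) (q : MvPolynomial ι ℝ) : 0 ≤ pn r q :=
  wn_nonneg (fun _ => pow_nonneg hr _) q

lemma pn_mono {r r' : ℝ} (hr : 0 ≤ r) (h : r ≤ r') (q : MvPolynomial ι ℝ) : pn r q ≤ pn r' q :=
  wn_mono (fun _ => pow_le_pow_left₀ hr h _) q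

lemma wn_monomial (w : ℕ → ℝ) (γ : ι →₀ ℕ) (a : ℝ) : wn w (monomial γ a) = |a| * w γ.degree := by
  classical
  rw [wn_eq_of_subset w _ (support_monomial_subset)]
  simp

lemma pn_C (r a : ℝ) : pn r (C a : MvPolynomial ι ℝ) = |a| := by
  rw [pn, C_apply, wn_monomial]; simp

lemma pn_X (r : ℝ) (i : ι) : pn r (X i : MvPolynomial ι ℝ) = r := by
  rw [pn, X, wn_monomial]; simp

lemma pn_mul_le {r : ℝ} (hr : 0 ≤ r) (p q : MvPolynomial ι ℝ) :
    pn r (p * q) ≤ pn r p * pn r q := by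
  classical
  have hw : ∀ j : ℕ, 0 ≤ r ^ j := fun _ => pow_nonneg hr _
  have : p * q = ∑ a ∈ p.support, ∑ b ∈ q.support,
      monomial (a + b) (coeff a p * coeff b q) := by
    conv_lhs => rw [p.as_sum, q.as_sum, Finset.sum_mul_sum]
    simp only [monomial_mul]
  rw [this]
  refine (wn_sum_le hw _ _).trans ?_
  rw [pn, pn, wn, wn, Finset.sum_mul_sum]
  apply Finset.sum_le_sum
  intro a _
  refine (wn_sum_le hw _ _).trans ?_
  apply Finset.sum_le_sum
  intro b _
  rw [wn_monomial, abs_mul, map_add, pow_add]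
  apply le_of_eq; ring

lemma pn_one (r : ℝ) : pn r (1 : MvPolynomial ι ℝ) = 1 := by
  rw [← C_1, pn_C]; simp

lemma pn_pow_le {r : ℝ} (hr : 0 ≤ r) (p : MvPolynomial ι ℝ) (k : ℕ) :
    pn r (p ^ k) ≤ pn r p ^ k := by
  induction k with
  | zero => simp [pn_one]
  | succ k ih =>
    rw [pow_succ, pow_succ]
    exact (pn_mul_le hr _ _).trans (mul_le_mul_of_nonneg_right ih (pn_nonneg hr _))

lemma pn_prod_le {r : ℝ} (hr : 0 ≤ r) {α : Type*} (s : Finset α)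
    (f : α → MvPolynomial ι ℝ) : pn r (∏ a ∈ s, f a) ≤ ∏ a ∈ s, pn r (f a) := by
  classical
  induction s using Finset.induction_on with
  | empty => simp [pn_one]
  | insert a s ha ih =>
    rw [Finset.prod_insert ha, Finset.prod_insert ha]
    exact (pn_mul_le hr _ _).trans (mul_le_mul_of_nonneg_left ih (pn_nonneg hr _))

lemma pn_prodpow_le {r ρ : ℝ} (hr : 0 ≤ r) [Fintype κ] (L : κ → MvPolynomial ι ℝ)
    (hL : ∀ i, pn r (L i) ≤ ρ) (γ : κ →₀ ℕ) : pn r (∏ i, L i ^ γ i) ≤ ρ ^ γ.degree := by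
  refine (pn_prod_le hr _ _).trans ?_
  rw [Finsupp.degree_eq_sum, ← Finset.prod_pow_eq_pow_sum]
  apply Finset.prod_le_prod
  · intro i _; exact pn_nonneg hr _
  · intro i _
    exact (pn_pow_le hr _ _).trans (pow_le_pow_left₀ (pn_nonneg hr _) (hL i) _)

lemma aeval_eq_sum [Fintype κ] (L : κ → MvPolynomial ι ℝ) (q : MvPolynomial κ ℝ) :
    aeval L q = ∑ γ ∈ q.support, C (coeff γ q) * ∏ i, L i ^ γ i := by
  rw [aeval_def, eval₂_eq']; rfl

lemma pn_aeval_le {r ρ : ℝ} (hr : 0 ≤ r) [Fintype κ] (L : κ → MvPolynomial ι ℝ)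
    (hL : ∀ i, pn r (L i) ≤ ρ) (q : MvPolynomial κ ℝ) : pn r (aeval L q) ≤ pn ρ q := by
  rw [aeval_eq_sum]
  refine (wn_sum_le (fun _ => pow_nonneg hr _) _ _).trans ?_
  unfold pn
  conv_rhs => unfold wn
  apply Finset.sum_le_sum
  intro γ _
  rw [wn_C_mul]
  exact mul_le_mul_of_nonneg_left (pn_prodpow_le hr L hL γ) (abs_nonneg _)

lemma pn_linform_le {r : ℝ} (hr : 0 ≤ r) [Fintype κ] (c : κ → ℝ) (M : κ → MvPolynomial ι ℝ)
    {b ρ : ℝ} (hρ : 0 ≤ ρ)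
    (hc : ∀ i, |c i| ≤ b) (hM : ∀ i, pn r (M i) ≤ ρ) :
    pn r (∑ k, C (c k) * M k) ≤ Fintype.card κ * (b * ρ) := by
  refine (wn_sum_le (fun _ => pow_nonneg hr _) _ _).trans ?_
  have : ∀ k ∈ (Finset.univ : Finset κ), wn (fun j => r ^ j) (C (c k) * M k) ≤ b * ρ := by
    intro k _
    rw [wn_C_mul]
    exact mul_le_mul (hc k) (hM k) (pn_nonneg hr _) ((abs_nonneg _).trans (hc k))
  refine (Finset.sum_le_sum this).trans ?_
  simp

/-- translation -/
noncomputable def sh {n : ℕ} (z : Fin n → ℝ) : MvPolynomial (Fin n) ℝ →ₐ[ℝ] MvPolynomial (Fin n) ℝ :=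
  aeval (fun i => X i + C (z i))

lemma sh_sh {n : ℕ} (z z' : Fin n → ℝ) (q : MvPolynomial (Fin n) ℝ) :
    sh z (sh z' q) = sh (z + z') q := by
  have : (sh z).comp (sh z') = sh (z + z') := by
    apply MvPolynomial.algHom_ext
    intro i
    simp [sh, add_assoc]
  rw [← this]; rfl

lemma sh_zero {n : ℕ} (q : MvPolynomial (Fin n) ℝ) : sh 0 q = q := by
  simp [sh]

lemma eval_sh {n : ℕ} (z x : Fin n → ℝ) (q : MvPolynomial (Fin n) ℝ) :
    eval x (sh z q) = eval (x + z) q := by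
  have : (eval x).comp (sh z : MvPolynomial (Fin n) ℝ →+* _) = eval (x + z) := by
    apply MvPolynomial.ringHom_ext
    · intro a; simp [sh]
    · intro i; simp [sh]
  rw [← this]; rfl

lemma coeff_zero_sh {n : ℕ} (z : Fin n → ℝ) (q : MvPolynomial (Fin n) ℝ) :
    coeff 0 (sh z q) = eval z q := by
  have := eval_sh z 0 q
  rw [zero_add] at this
  rw [← this, ← constantCoeff_eq, ← eval_zero]

lemma pn_sh_le {n : ℕ} {r h : ℝ} (hr : 0 ≤ r) (z : Fin n → ℝ) (hz : ∀ i, |z i| ≤ h)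
    (q : MvPolynomial (Fin n) ℝ) : pn r (sh z q) ≤ pn (r + h) q := by
  apply pn_aeval_le hr
  intro i
  refine (wn_add_le (fun _ => pow_nonneg hr _) _ _).trans ?_
  have h1 := pn_X r i
  have h2 := pn_C (ι := Fin n) r (z i)
  unfold pn at h1 h2
  rw [h1, h2]
  linarith [hz i]

end wn
end PoS

namespace PoS

section W
open MvPolynomial

lemma chain_rule {ι κ : Type*} [Fintype κ] (L : κ → MvPolynomial ι ℝ) (k : ι)
    (P : MvPolynomial κ ℝ) :
    pderiv k (aeval L P) = ∑ i, aeval L (pderiv i P) * pderiv k (L i) := by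
  classical
  induction P using MvPolynomial.induction_on with
  | C a => simp
  | add p q hp hq => simp only [map_add, hp, hq, add_mul, Finset.sum_add_distrib]
  | mul_X p j hp =>
    simp only [map_mul, Derivation.leibniz, hp, aeval_X, pderiv_X, smul_eq_mul, map_add,
      add_mul, Finset.sum_add_distrib, Finset.mul_sum]
    congr 1
    · rw [Finset.sum_eq_single j]
      · simp
      · intro b _ hb; simp [hb.symm]
      · simp
    · exact Finset.sum_congr rfl fun i _ => by ring

/-- harmonic polynomial -/
def HarmP {n : ℕ} (P : MvPolynomial (Fin n) ℝ) : Prop := ∑ i, pderiv i (pderiv i P) = 0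

noncomputable def WW {n : ℕ} (P : MvPolynomial (Fin n) ℝ) (z : Fin n → ℝ) (w : ℕ → ℝ) : ℝ :=
  ∑ i, wn w (sh z (pderiv i P))

noncomputable def SS {n : ℕ} (P : MvPolynomial (Fin n) ℝ) (z : Fin n → ℝ) (r : ℝ) : ℝ :=
  ∑ i, pn r (sh z (pderiv i P))

noncomputable def gr {n : ℕ} (P : MvPolynomial (Fin n) ℝ) (z : Fin n → ℝ) : ℝ :=
  ∑ i, |eval z (pderiv i P)|

variable {n : ℕ} {P : MvPolynomial (Fin n) ℝ} {z x y : Fin n → ℝ}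

lemma SS_eq (r : ℝ) : SS P z r = WW P z (fun j => r ^ j) := rfl

lemma WW_mono {w w' : ℕ → ℝ} (h : ∀ j, w j ≤ w' j) : WW P z w ≤ WW P z w' :=
  Finset.sum_le_sum fun _ _ => wn_mono h _

lemma WW_lin (a b : ℝ) (w w' : ℕ → ℝ) :
    WW P z (fun j => a * w j + b * w' j) = a * WW P z w + b * WW P z w' := by
  unfold WW
  simp only [wn_lin, Finset.mul_sum, Finset.sum_add_distrib]

lemma SS_nonneg {r : ℝ} (hr : 0 ≤ r) : 0 ≤ SS P z r :=
  Finset.sum_nonneg fun _ _ => pn_nonneg hr _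

lemma SS_mono {r r' : ℝ} (hr : 0 ≤ r) (h : r ≤ r') : SS P z r ≤ SS P z r' :=
  Finset.sum_le_sum fun _ _ => pn_mono hr h _

lemma SS_shift {r h : ℝ} (hr : 0 ≤ r) (hxy : ∀ i, |y i - x i| ≤ h) :
    SS P y r ≤ SS P x (r + h) := by
  apply Finset.sum_le_sum
  intro i _
  have : sh y (pderiv i P) = sh (y - x) (sh x (pderiv i P)) := by
    rw [sh_sh]; simp
  rw [this]
  exact pn_sh_le hr _ hxy _

lemma gr_nonneg : 0 ≤ gr P z := Finset.sum_nonneg fun _ _ => abs_nonneg _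

lemma gr_le_SS {r : ℝ} (hr : 0 ≤ r) : gr P z ≤ SS P z r := by
  apply Finset.sum_le_sum
  intro i _
  have := coeff_le_wn (w := fun j => r ^ j) (fun _ => pow_nonneg hr _) (sh z (pderiv i P)) 0
  rw [coeff_zero_sh] at this
  simpa [pn] using this

/-- slope bound -/
def SL (P : MvPolynomial (Fin n) ℝ) (z : Fin n → ℝ) (r N : ℝ) : Prop :=
  WW P z (fun j => j * r ^ j) ≤ N * SS P z r

lemma SL.mono_N {r N N' : ℝ} (hr : 0 ≤ r) (h : SL P z r N) (hN : N ≤ N') : SL P z r N' :=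
  le_trans h (mul_le_mul_of_nonneg_right hN (SS_nonneg hr))

lemma SL.mono {r ρ N : ℝ} (hρ : 0 < ρ) (hr : ρ ≤ r) (h : SL P z r N) : SL P z ρ N := by
  have hr0 : 0 < r := hρ.trans_le hr
  set θ := ρ / r with hθ
  have hθ0 : 0 < θ := by positivity
  have hθ1 : θ ≤ 1 := by rw [hθ, div_le_one hr0]; exact hr
  have key : ∀ j : ℕ, 1 * ((j : ℝ) * ρ ^ j) + (-N) * ρ ^ j ≤
      θ ^ N * (j * r ^ j) + (-(θ ^ N * N)) * r ^ j := by
    intro j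
    have e : ρ ^ j = r ^ j * θ ^ (j : ℝ) := by
      rw [Real.rpow_natCast, ← mul_pow, hθ]; congr 1; field_simp
    have h1 : ((j : ℝ) - N) * θ ^ (j : ℝ) ≤ (j - N) * θ ^ N := by
      rcases le_total N j with h | h
      · exact mul_le_mul_of_nonneg_left (Real.rpow_le_rpow_of_exponent_ge hθ0 hθ1 h) (by linarith)
      · exact mul_le_mul_of_nonpos_left (Real.rpow_le_rpow_of_exponent_ge hθ0 hθ1 h) (by linarith)
    have h2 : 0 ≤ r ^ j := by positivity
    rw [e]
    nlinarith [mul_le_mul_of_nonneg_left h1 h2]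
  have := WW_mono (P := P) (z := z) key
  rw [WW_lin, WW_lin, ← SS_eq, ← SS_eq] at this
  unfold SL at h ⊢
  have h3 : 0 < θ ^ N := by positivity
  nlinarith [mul_le_mul_of_nonneg_left h h3.le]

lemma SL.growth {ρ l N : ℝ} (hρ : 0 < ρ) (hl : 1 ≤ l) (h : SL P z (l * ρ) N) :
    SS P z (l * ρ) ≤ l ^ N * SS P z ρ := by
  have hl0 : 0 < l := by linarith
  have key : ∀ j : ℕ, (1 + N * Real.log l) * (l * ρ) ^ j + (- Real.log l) * (j * (l * ρ) ^ j) ≤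
      l ^ N * ρ ^ j + 0 * ρ ^ j := by
    intro j
    have e : l ^ N = l ^ j * l ^ (N - j) := by
      rw [← Real.rpow_natCast, ← Real.rpow_add hl0]; congr 1; ring
    have h1 : 1 + (N - j) * Real.log l ≤ l ^ (N - j) := by
      rw [Real.rpow_def_of_pos hl0]
      have := Real.add_one_le_exp (Real.log l * (N - j)); linarith
    have h2 : 0 ≤ l ^ j * ρ ^ j := by positivity
    rw [e, mul_pow]
    nlinarith [mul_le_mul_of_nonneg_left h1 h2]
  have := WW_mono (P := P) (z := z) key
  rw [WW_lin, WW_lin, ← SS_eq, ← SS_eq] at this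
  unfold SL at h
  have h3 : 0 ≤ Real.log l := Real.log_nonneg hl
  nlinarith [mul_le_mul_of_nonneg_left h h3]

lemma SL.not_growth {ρ l M : ℝ} (hρ : 0 < ρ) (hl : 1 ≤ l) (h : ¬ SL P z ρ M) :
    l ^ M * SS P z ρ ≤ SS P z (l * ρ) := by
  have hl0 : 0 < l := by linarith
  have key : ∀ j : ℕ, (l ^ M * (1 - M * Real.log l)) * ρ ^ j + (l ^ M * Real.log l) * (j * ρ ^ j) ≤
      1 * (l * ρ) ^ j + 0 * (l * ρ) ^ j := by
    intro j
    have e : l ^ j = l ^ M * l ^ (j - M) := by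
      rw [← Real.rpow_natCast, ← Real.rpow_add hl0]; congr 1; ring
    have h1 : 1 + (j - M) * Real.log l ≤ l ^ (j - M) := by
      rw [Real.rpow_def_of_pos hl0]
      have := Real.add_one_le_exp (Real.log l * (j - M)); linarith
    have h2 : 0 ≤ l ^ M * ρ ^ j := by positivity
    rw [mul_pow, e]
    nlinarith [mul_le_mul_of_nonneg_left h1 h2]
  have := WW_mono (P := P) (z := z) key
  rw [WW_lin, WW_lin, ← SS_eq, ← SS_eq] at this
  unfold SL at h
  push Not at h
  have h3 : 0 ≤ Real.log l := Real.log_nonneg hl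
  have h4 : 0 < l ^ M := by positivity
  nlinarith [mul_le_mul_of_nonneg_left h.le (mul_nonneg h4.le h3)]

lemma SL_of_growth {ρ M : ℝ} (hρ : 0 < ρ)
    (h : SS P z (Real.exp 1 * ρ) < Real.exp M * SS P z ρ) : SL P z ρ M := by
  by_contra hc
  have := SL.not_growth hρ (Real.one_le_exp zero_le_one) hc
  rw [Real.exp_one_rpow] at this
  linarith

lemma SL.base {ρ : ℝ} (hρ : 0 < ρ) (h : SL P z ρ (1/2)) : SS P z ρ / 2 ≤ gr P z := by
  have key : ∀ j : ℕ, 1 * ρ ^ j + (-1) * (j * ρ ^ j) ≤ (if j = 0 then (1:ℝ) else 0) := by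
    intro j
    rcases Nat.eq_zero_or_pos j with rfl | hj
    · simp
    · rw [if_neg hj.ne']
      have h1 : (1:ℝ) ≤ j := by exact_mod_cast hj
      have h2 : 0 < ρ ^ j := by positivity
      nlinarith
  have h1 := WW_mono (P := P) (z := z) key
  rw [WW_lin, ← SS_eq] at h1
  have h2 : WW P z (fun j : ℕ => (if j = 0 then (1:ℝ) else 0)) ≤ gr P z := by
    apply Finset.sum_le_sum
    intro i _
    rw [← coeff_zero_sh, wn]
    have : ∀ γ ∈ (sh z (pderiv i P)).support, γ ≠ 0 → |coeff γ (sh z (pderiv i P))| * (if γ.degree = 0 then (1:ℝ) else 0) = 0 := by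
      intro γ _ h0
      rw [if_neg]; simp
      rwa [Finsupp.degree_eq_zero_iff]
    by_cases h0 : (0 : Fin n →₀ ℕ) ∈ (sh z (pderiv i P)).support
    · rw [Finset.sum_eq_single_of_mem 0 h0 this]; simp
    · rw [Finset.sum_eq_zero]
      · positivity
      · intro γ hγ; exact this γ hγ (by rintro rfl; exact h0 hγ)
  unfold SL at h
  linarith

/-- scaling of variables -/
lemma coeff_scale (t : ℝ) (q : MvPolynomial (Fin n) ℝ) (γ : Fin n →₀ ℕ) :
    coeff γ (aeval (fun i => C t * X i : Fin n → MvPolynomial (Fin n) ℝ) q) = t ^ γ.degree * coeff γ q := by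
  classical
  rw [aeval_eq_sum, coeff_sum]
  have : ∀ β : Fin n →₀ ℕ, (C (coeff β q) * ∏ i, (C t * X i : MvPolynomial (Fin n) ℝ) ^ β i) =
      monomial β (t ^ β.degree * coeff β q) := by
    intro β
    simp only [mul_pow, Finset.prod_mul_distrib]
    rw [Finset.prod_pow_eq_pow_sum, ← Finsupp.degree_eq_sum, ← map_pow, monomial_eq,
      Finsupp.prod_fintype _ _ (by simp), ← mul_assoc, ← map_mul, mul_comm (coeff β q)]
  simp only [this, coeff_monomial]
  rw [Finset.sum_ite_eq' q.support γ]
  split_ifs with h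
  · rfl
  · rw [notMem_support_iff.mp h, mul_zero]

lemma wn_scale {t : ℝ} (ht : 0 < t) (w : ℕ → ℝ) (q : MvPolynomial (Fin n) ℝ) :
    wn w (aeval (fun i => C t * X i : Fin n → MvPolynomial (Fin n) ℝ) q) = wn (fun j => t ^ j * w j) q := by
  rw [wn_eq_of_subset w _ (s := q.support)]
  · unfold wn
    apply Finset.sum_congr rfl
    intro γ _
    rw [coeff_scale, abs_mul, abs_of_pos (pow_pos ht _)]; ring
  · intro γ
    simp only [mem_support_iff, coeff_scale]
    exact right_ne_zero_of_mul

noncomputable def rsc (x : Fin n → ℝ) (t : ℝ) : MvPolynomial (Fin n) ℝ →ₐ[ℝ] MvPolynomial (Fin n) ℝ :=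
  aeval (fun i => C t * X i + C (x i))

lemma pderiv_rsc (x : Fin n → ℝ) (t : ℝ) (i : Fin n) (P : MvPolynomial (Fin n) ℝ) :
    pderiv i (rsc x t P) = C t * rsc x t (pderiv i P) := by
  classical
  unfold rsc
  rw [chain_rule, Finset.sum_eq_single i]
  · simp [mul_comm]
  · intro b _ hb; simp [hb]
  · simp

lemma HarmP.rsc (x : Fin n → ℝ) (t : ℝ) (h : HarmP P) : HarmP (rsc x t P) := by
  unfold HarmP at *
  simp only [pderiv_rsc, Derivation.leibniz, pderiv_C, mul_zero, add_zero, smul_eq_mul]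
  rw [← Finset.mul_sum, ← Finset.mul_sum, ← map_sum, h]; simp

lemma sh_rsc (x : Fin n → ℝ) (t : ℝ) (z : Fin n → ℝ) (q : MvPolynomial (Fin n) ℝ) :
    sh z (rsc x t q) = aeval (fun i => C t * X i : Fin n → MvPolynomial (Fin n) ℝ) (sh (x + t • z) q) := by
  have : (sh z).comp (rsc x t) =
      (aeval (fun i => C t * X i : Fin n → MvPolynomial (Fin n) ℝ)).comp (sh (x + t • z)) := by
    apply MvPolynomial.algHom_ext
    intro i
    simp [sh, rsc, MvPolynomial.algebraMap_eq]; ring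
  exact DFunLike.congr_fun this q

lemma SS_rsc {t : ℝ} (ht : 0 < t) (x z : Fin n → ℝ) (r : ℝ) :
    SS (rsc x t P) z r = t * SS P (x + t • z) (t * r) := by
  unfold SS
  rw [Finset.mul_sum]
  apply Finset.sum_congr rfl
  intro i _
  rw [pderiv_rsc, map_mul]
  have : sh z (C t) = C t := by simp [sh, MvPolynomial.algebraMap_eq]
  rw [this, pn, wn_C_mul, abs_of_pos ht, sh_rsc, wn_scale ht]
  simp only [← mul_pow]; rfl

end W
end PoS

namespace PoS
section alg
open MvPolynomial
variable {ι κ : Type*}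

lemma degree_le_td {q : MvPolynomial ι ℝ} {γ : ι →₀ ℕ} (h : γ ∈ q.support) :
    γ.degree ≤ q.totalDegree := by
  have := le_totalDegree h
  rwa [Finsupp.degree_apply]

lemma td_le {q : MvPolynomial ι ℝ} {d : ℕ} (h : ∀ γ ∈ q.support, γ.degree ≤ d) :
    q.totalDegree ≤ d := by
  rw [totalDegree]
  apply Finset.sup_le
  intro γ hγ
  have := h γ hγ
  rwa [Finsupp.degree_apply] at this

lemma td_prodpow [Fintype κ] {L : κ → MvPolynomial ι ℝ} (hL : ∀ i, (L i).totalDegree ≤ 1)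
    (γ : κ →₀ ℕ) : (∏ i, L i ^ γ i).totalDegree ≤ γ.degree := by
  refine (totalDegree_finsetProd _ _).trans ?_
  rw [Finsupp.degree_eq_sum]
  apply Finset.sum_le_sum
  intro i _
  refine (totalDegree_pow _ _).trans ?_
  have := Nat.mul_le_mul_left (γ i) (hL i)
  simpa using this

lemma td_aeval [Fintype κ] {L : κ → MvPolynomial ι ℝ} (hL : ∀ i, (L i).totalDegree ≤ 1)
    (q : MvPolynomial κ ℝ) : (aeval L q).totalDegree ≤ q.totalDegree := by
  rw [aeval_eq_sum]
  apply totalDegree_finsetSum_le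
  intro γ hγ
  refine (totalDegree_mul _ _).trans ?_
  rw [totalDegree_C, zero_add]
  exact (td_prodpow hL γ).trans (degree_le_td hγ)

lemma td_affine [Fintype κ] (a : ℝ) (c : κ → ℝ) (M : κ → MvPolynomial ι ℝ)
    (hM : ∀ k, (M k).totalDegree ≤ 1) : (C a + ∑ k, C (c k) * M k).totalDegree ≤ 1 := by
  refine (totalDegree_add _ _).trans ?_
  rw [totalDegree_C]
  apply max_le (by simp)
  apply totalDegree_finsetSum_le
  intro k _
  refine (totalDegree_mul _ _).trans ?_
  rw [totalDegree_C, zero_add]; exact hM k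

lemma td_sh {n : ℕ} (z : Fin n → ℝ) (q : MvPolynomial (Fin n) ℝ) :
    (sh z q).totalDegree ≤ q.totalDegree := by
  apply td_aeval
  intro i
  refine (totalDegree_add _ _).trans ?_
  simp

lemma pn_le_pow {K : ℝ} (hK : 1 ≤ K) {q : MvPolynomial ι ℝ} {d : ℕ} (hd : q.totalDegree ≤ d) :
    pn K q ≤ K ^ d * pn 1 q := by
  unfold pn wn
  rw [Finset.mul_sum]
  apply Finset.sum_le_sum
  intro γ hγ
  have : K ^ γ.degree ≤ K ^ d := pow_le_pow_right₀ hK ((degree_le_td hγ).trans hd)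
  have h2 := mul_le_mul_of_nonneg_left this (abs_nonneg (coeff γ q))
  simp only [one_pow, mul_one]; linarith

/-- homogenization -/
noncomputable def homg [Fintype κ] (d : ℕ) (f : MvPolynomial κ ℝ) (L0 : MvPolynomial ι ℝ)
    (L : κ → MvPolynomial ι ℝ) : MvPolynomial ι ℝ :=
  ∑ γ ∈ f.support, C (coeff γ f) * ((∏ i, L i ^ γ i) * L0 ^ (d - γ.degree))

lemma eval_homg [Fintype κ] {d : ℕ} {f : MvPolynomial κ ℝ} (hf : f.totalDegree ≤ d)
    (L0 : MvPolynomial ι ℝ) (L : κ → MvPolynomial ι ℝ) (v : ι → ℝ) (h0 : eval v L0 ≠ 0) :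
    eval v (homg d f L0 L) = (eval v L0) ^ d * eval (fun i => eval v (L i) / eval v L0) f := by
  rw [eval_eq' _ f]
  unfold homg
  rw [map_sum, Finset.mul_sum]
  apply Finset.sum_congr rfl
  intro γ hγ
  have h1 := (degree_le_td hγ).trans hf
  simp only [map_mul, eval_C, map_prod, map_pow, div_pow, Finset.prod_div_distrib,
    Finset.prod_pow_eq_pow_sum, ← Finsupp.degree_eq_sum]
  have : (eval v L0) ^ d = (eval v L0) ^ (d - γ.degree) * (eval v L0) ^ γ.degree := by
    rw [← pow_add]; congr 1; omega
  rw [this]; field_simp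

lemma homg_sh {n : ℕ} {d : ℕ} {f : MvPolynomial (Fin n) ℝ} (hf : f.totalDegree ≤ d)
    {L0 : MvPolynomial ι ℝ} (h0 : L0 ≠ 0)
    (L : Fin n → MvPolynomial ι ℝ) (z : Fin n → ℝ) :
    homg d f L0 L = homg d (sh z f) L0 (fun i => L i - C (z i) * L0) := by
  have : L0 * (homg d f L0 L - homg d (sh z f) L0 (fun i => L i - C (z i) * L0)) = 0 := by
    apply MvPolynomial.funext
    intro v
    rw [map_mul, map_zero, map_sub]
    by_cases hv : eval v L0 = 0
    · rw [hv, zero_mul]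
    · rw [eval_homg hf _ _ _ hv, eval_homg ((td_sh z f).trans hf) _ _ _ hv, eval_sh]
      have : (fun i => eval v (L i - C (z i) * L0) / eval v L0) + z =
          fun i => eval v (L i) / eval v L0 := by
        funext i
        simp only [Pi.add_apply, map_sub, map_mul, eval_C]
        field_simp; ring
      rw [this]; ring
  rcases mul_eq_zero.mp this with h | h
  · exact absurd h h0
  · exact sub_eq_zero.mp h

lemma homg_homogeneous [Fintype κ] {d : ℕ} {f : MvPolynomial κ ℝ} (hf : f.totalDegree ≤ d)
    {L0 : MvPolynomial ι ℝ} {L : κ → MvPolynomial ι ℝ} (h0 : L0.IsHomogeneous 1)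
    (hL : ∀ i, (L i).IsHomogeneous 1) : (homg d f L0 L).IsHomogeneous d := by
  unfold homg
  apply IsHomogeneous.sum
  intro γ hγ
  have h1 := (degree_le_td hγ).trans hf
  have h2 : (∏ i, L i ^ γ i).IsHomogeneous γ.degree := by
    rw [Finsupp.degree_eq_sum]
    apply IsHomogeneous.prod
    intro i _
    simpa using (hL i).pow (γ i)
  have h3 := (h2.mul (h0.pow (d - γ.degree)))
  have h4 := (isHomogeneous_C κ (coeff γ f))
  have h5 := (isHomogeneous_C ι (coeff γ f)).mul h3
  convert h5 using 1
  omega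

/-- main combinatorial estimate -/
lemma homg_coeff {n d : ℕ} {p η b : ℝ} {f : MvPolynomial (Fin n) ℝ} (hf : f.totalDegree ≤ d)
    (z : Fin n → Fin n → ℝ) (hb : 1 ≤ b) (hz : ∀ k l i, |z k i - z l i| ≤ b)
    (hp : ((n : ℝ) - 1) * d < n * p) (hn : 0 < n)
    (low : ∀ k, wn (fun j => if (j:ℝ) < p then 1 else 0) (sh (z k) f) ≤ η) :
    pn 1 (homg d f (∑ k, X k) (fun i => ∑ k, C (z k i) * X k)) ≤ n * ((n * b) ^ d * η) := by
  classical
  set L0 : MvPolynomial (Fin n) ℝ := ∑ k, X k with hL0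
  set L : Fin n → MvPolynomial (Fin n) ℝ := fun i => ∑ k, C (z k i) * X k with hL
  have h0 : L0 ≠ 0 := by
    intro h
    have := congrArg (eval (fun _ => (1:ℝ))) h
    simp [hL0] at this
    omega
  set F := homg d f L0 L with hF
  have hFh : F.IsHomogeneous d := by
    apply homg_homogeneous hf
    · exact IsHomogeneous.sum _ _ _ fun i _ => isHomogeneous_X ℝ i
    · intro i
      apply IsHomogeneous.sum
      intro k _
      have := (isHomogeneous_C (Fin n) (z k i)).mul (isHomogeneous_X ℝ k)
      simpa using this
  set L' : Fin n → Fin n → MvPolynomial (Fin n) ℝ := fun k i => ∑ l, C (z l i - z k i) * X l with hL'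
  have hFk : ∀ k, F = homg d (sh (z k) f) L0 (L' k) := by
    intro k
    rw [hF, homg_sh hf h0 L (z k)]
    congr 1
    funext i
    simp only [hL, hL', hL0, Finset.mul_sum, ← Finset.sum_sub_distrib, map_sub, sub_mul]
  set T : Fin n → (Fin n →₀ ℕ) → MvPolynomial (Fin n) ℝ := fun k β =>
    C (coeff β (sh (z k) f)) * ((∏ i, L' k i ^ β i) * L0 ^ (d - β.degree)) with hT
  set lo : Fin n → MvPolynomial (Fin n) ℝ := fun k =>
    ∑ β ∈ (sh (z k) f).support.filter (fun β => (β.degree : ℝ) < p), T k β with hlo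
  have hsplit : ∀ k, F = lo k +
      ∑ β ∈ (sh (z k) f).support.filter (fun β => ¬ (β.degree : ℝ) < p), T k β := by
    intro k
    rw [hlo, hFk k]
    exact (Finset.sum_filter_add_sum_filter_not _ _ _).symm
  have hn1 : (1:ℝ) ≤ n := by exact_mod_cast hn
  have hnb : 1 ≤ n * b := by nlinarith
  have hpL0 : pn 1 L0 ≤ n * b := by
    have := pn_linform_le (r := 1) zero_le_one (fun _ : Fin n => (1:ℝ)) (fun k => X k)
      (b := b) (ρ := 1) zero_le_one (fun _ => by simpa using hb) (fun k => (pn_X _ _).le)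
    simpa [hL0] using this
  have hpL : ∀ k i, pn 1 (L' k i) ≤ n * b := by
    intro k i
    have := pn_linform_le (r := 1) zero_le_one (fun l : Fin n => z l i - z k i) (fun k => X k)
      (b := b) (ρ := 1) zero_le_one (fun l => hz l k i) (fun k => (pn_X _ _).le)
    simpa [hL'] using this
  have hlow : ∀ k, pn 1 (lo k) ≤ (n * b) ^ d * η := by
    intro k
    refine (wn_sum_le (by simp) _ _).trans ?_
    refine le_trans ?_ (mul_le_mul_of_nonneg_left (low k) (by positivity))
    rw [wn, Finset.mul_sum, Finset.sum_filter]
    apply Finset.sum_le_sum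
    intro β hβ
    split_ifs with h
    · rw [hT, wn_C_mul]
      have h1 := (degree_le_td hβ).trans ((td_sh (z k) f).trans hf)
      have : pn 1 ((∏ i, L' k i ^ β i) * L0 ^ (d - β.degree)) ≤ (n * b) ^ d := by
        refine (pn_mul_le zero_le_one _ _).trans ?_
        have e : ((n:ℝ) * b) ^ d = (n * b) ^ β.degree * (n * b) ^ (d - β.degree) := by
          rw [← pow_add]; congr 1; omega
        rw [e]
        apply mul_le_mul (pn_prodpow_le zero_le_one _ (hpL k) β) _ (pn_nonneg zero_le_one _) (by positivity)
        exact (pn_pow_le zero_le_one _ _).trans (pow_le_pow_left₀ (pn_nonneg zero_le_one _) hpL0 _)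
      have := mul_le_mul_of_nonneg_left this (abs_nonneg (coeff β (sh (z k) f)))
      unfold pn at this
      linarith
    · simp
  have hcoef : ∀ γ ∈ F.support, |coeff γ F| ≤ ∑ k, |coeff γ (lo k)| := by
    intro γ hγ
    have hdeg : γ.degree = d := by
      have := hFh (mem_support_iff.mp hγ)
      rw [← this, Finsupp.degree_eq_weight_one]; rfl
    obtain ⟨k, hk⟩ : ∃ k, (d : ℝ) - p < γ k := by
      by_contra hcon
      push Not at hcon
      have h1 : ((γ.degree : ℕ) : ℝ) ≤ ∑ k : Fin n, ((d:ℝ) - p) := by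
        rw [Finsupp.degree_eq_sum]; push_cast
        exact Finset.sum_le_sum fun k _ => hcon k
      rw [hdeg] at h1
      simp at h1
      nlinarith
    have : coeff γ F = coeff γ (lo k) := by
      conv_lhs => rw [hsplit k]
      rw [coeff_add, add_eq_left, coeff_sum]
      apply Finset.sum_eq_zero
      intro β hβ
      rw [Finset.mem_filter] at hβ
      by_contra hne
      have h1 := (degree_le_td hβ.1).trans ((td_sh (z k) f).trans hf)
      have h2 : degreeOf k (T k β) ≤ d - β.degree := by
        refine (degreeOf_mul_le _ _ _).trans ?_
        rw [degreeOf_C, zero_add]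
        refine (degreeOf_mul_le _ _ _).trans ?_
        have a1 : degreeOf k (∏ i, L' k i ^ β i) = 0 := by
          apply Nat.eq_zero_of_le_zero
          refine (degreeOf_prod_le _ _ _).trans ?_
          rw [Finset.sum_eq_zero]
          intro i _
          apply Nat.eq_zero_of_le_zero
          refine (degreeOf_pow_le _ _ _).trans ?_
          have : degreeOf k (L' k i) = 0 := by
            apply Nat.eq_zero_of_le_zero
            rw [hL']
            refine (degreeOf_sum_le _ _ _).trans ?_
            apply Finset.sup_le
            intro l _
            by_cases hl : l = k
            · subst hl; simp
            · refine (degreeOf_mul_le _ _ _).trans ?_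
              rw [degreeOf_C, zero_add, degreeOf_X, if_neg (Ne.symm hl)]
          rw [this]; simp
        have a2 : degreeOf k (L0 ^ (d - β.degree)) ≤ d - β.degree := by
          refine (degreeOf_pow_le _ _ _).trans ?_
          have : degreeOf k L0 ≤ 1 := by
            refine (degreeOf_sum_le _ _ _).trans ?_
            apply Finset.sup_le
            intro l _
            rw [degreeOf_X]; split_ifs <;> simp
          simpa using Nat.mul_le_mul_left (d - β.degree) this
        omega
      have h3 : γ k ≤ degreeOf k (T k β) := monomial_le_degreeOf k (mem_support_iff.mpr hne)
      have h4 : (γ k : ℝ) ≤ d - β.degree := by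
        rw [← Nat.cast_sub h1]; exact_mod_cast h3.trans h2
      have := hβ.2
      linarith
    rw [this]
    exact Finset.single_le_sum (f := fun k => |coeff γ (lo k)|) (fun _ _ => abs_nonneg _) (Finset.mem_univ k)
  calc pn 1 F = ∑ γ ∈ F.support, |coeff γ F| := by simp [pn, wn]
    _ ≤ ∑ γ ∈ F.support, ∑ k, |coeff γ (lo k)| := Finset.sum_le_sum hcoef
    _ = ∑ k, ∑ γ ∈ F.support, |coeff γ (lo k)| := Finset.sum_comm
    _ ≤ ∑ k : Fin n, (n * b) ^ d * η := by
        apply Finset.sum_le_sum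
        intro k _
        refine le_trans ?_ (hlow k)
        rw [pn, wn_eq_of_subset _ (lo k) (Finset.subset_union_right (s₁ := F.support))]
        simp only [one_pow, mul_one]
        exact Finset.sum_le_sum_of_subset_of_nonneg Finset.subset_union_left
          fun _ _ _ => abs_nonneg _
    _ = n * ((n * b) ^ d * η) := by simp

/-- dehomogenization -/
lemma dehomog {m d : ℕ} {f : MvPolynomial (Fin (m+1)) ℝ} (hf : f.totalDegree ≤ d)
    (z w : Fin (m+1) → Fin (m+1) → ℝ)
    (hw : ∀ (k : Fin m) i, w k.castSucc i = z k.succ i - z 0 i) :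
    pn 1 (aeval (fun i => C (z 0 i) + ∑ k : Fin m, C (w k.castSucc i) * X k.castSucc :
      Fin (m+1) → MvPolynomial (Fin (m+1)) ℝ) f) ≤
    ((m:ℝ)+1) ^ d * pn 1 (homg d f (∑ k, X k) (fun i => ∑ k, C (z k i) * X k)) := by
  set φ : Fin (m+1) → MvPolynomial (Fin (m+1)) ℝ :=
    Fin.cons (1 - ∑ k : Fin m, X k.castSucc) (fun k => X k.castSucc) with hφ
  have h1 : aeval φ (homg d f (∑ k, X k) (fun i => ∑ k, C (z k i) * X k)) =
    (aeval (fun i => C (z 0 i) + ∑ k : Fin m, C (w k.castSucc i) * X k.castSucc :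
      Fin (m+1) → MvPolynomial (Fin (m+1)) ℝ) f) := by
    rw [aeval_eq_sum _ f, homg, map_sum]
    apply Finset.sum_congr rfl
    intro γ _
    simp only [map_mul, map_prod, map_pow, map_sum, aeval_X, aeval_C, algebraMap_eq]
    have e0 : ∑ k, φ k = 1 := by
      rw [Fin.sum_univ_succ, hφ]; simp
    have e1 : ∀ i, ∑ k, C (z k i) * φ k = C (z 0 i) + ∑ k : Fin m, C (w k.castSucc i) * X k.castSucc := by
      intro i
      rw [Fin.sum_univ_succ, hφ]
      simp only [Fin.cons_zero, Fin.cons_succ, hw, map_sub, sub_mul, mul_sub, Finset.mul_sum,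
        Finset.sum_sub_distrib]
      ring
    simp only [e0, e1, one_pow, mul_one]
  rw [← h1]
  have hm : (1:ℝ) ≤ m + 1 := by linarith [(Nat.cast_nonneg m : (0:ℝ) ≤ m)]
  refine (pn_aeval_le zero_le_one φ (ρ := m + 1) ?_ _).trans ?_
  · intro i
    refine Fin.cases ?_ (fun k => ?_) i
    · rw [hφ]; simp only [Fin.cons_zero]
      rw [sub_eq_add_neg]
      refine (wn_add_le (by simp) _ _).trans ?_
      rw [wn_neg]
      have a1 := pn_one (ι := Fin (m+1)) 1
      have a2 : wn (fun j => (1:ℝ)^j) (∑ k : Fin m, (X k.castSucc : MvPolynomial (Fin (m+1)) ℝ)) ≤ m := by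
        refine (wn_sum_le (by simp) _ _).trans ?_
        have : ∀ k : Fin m, wn (fun j => (1:ℝ)^j) (X k.castSucc : MvPolynomial (Fin (m+1)) ℝ) = 1 :=
          fun k => pn_X 1 _
        simp only [this]; simp
      unfold pn at a1
      linarith
    · rw [hφ]; simp only [Fin.cons_succ, pn_X]; exact hm
  · apply pn_le_pow hm
    apply IsHomogeneous.totalDegree_le
    apply homg_homogeneous hf
    · exact IsHomogeneous.sum _ _ _ fun i _ => isHomogeneous_X ℝ i
    · intro i
      apply IsHomogeneous.sum
      intro k _
      have := (isHomogeneous_C (Fin (m+1)) (z k i)).mul (isHomogeneous_X ℝ k)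
      simpa using this

end alg
end PoS

namespace PoS
section tn
open MvPolynomial
variable {m : ℕ}

/-- slice norm in last variable -/
noncomputable def tn (b : ℕ) (q : MvPolynomial (Fin (m+1)) ℝ) : ℝ :=
  ∑ γ ∈ q.support, if γ (Fin.last m) = b then |coeff γ q| else 0

lemma tn_eq_of_subset (b : ℕ) (q : MvPolynomial (Fin (m+1)) ℝ) {s : Finset (Fin (m+1) →₀ ℕ)}
    (hs : q.support ⊆ s) : tn b q = ∑ γ ∈ s, if γ (Fin.last m) = b then |coeff γ q| else 0 := by
  unfold tn
  apply Finset.sum_subset hs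
  intro γ _ h
  rw [notMem_support_iff.mp h]; simp

lemma tn_nonneg (b : ℕ) (q : MvPolynomial (Fin (m+1)) ℝ) : 0 ≤ tn b q :=
  Finset.sum_nonneg fun _ _ => by split_ifs <;> positivity

lemma tn_add_le (b : ℕ) (p q : MvPolynomial (Fin (m+1)) ℝ) : tn b (p + q) ≤ tn b p + tn b q := by
  classical
  rw [tn_eq_of_subset b (p+q) (support_add (p := p) (q := q)),
    tn_eq_of_subset b p (Finset.subset_union_left (s₂ := q.support)),
    tn_eq_of_subset b q (Finset.subset_union_right (s₁ := p.support)), ← Finset.sum_add_distrib]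
  apply Finset.sum_le_sum
  intro γ _
  rw [coeff_add]
  split_ifs
  · exact abs_add_le _ _
  · simp

lemma tn_sum_le (b : ℕ) {α : Type*} (s : Finset α)
    (f : α → MvPolynomial (Fin (m+1)) ℝ) : tn b (∑ a ∈ s, f a) ≤ ∑ a ∈ s, tn b (f a) := by
  classical
  induction s using Finset.induction_on with
  | empty => simp [tn]
  | insert a s ha ih =>
    rw [Finset.sum_insert ha, Finset.sum_insert ha]
    exact (tn_add_le b _ _).trans (by linarith)

lemma tn_C_mul (b : ℕ) (a : ℝ) (q : MvPolynomial (Fin (m+1)) ℝ) :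
    tn b (C a * q) = |a| * tn b q := by
  rw [tn_eq_of_subset b (C a * q) (s := q.support)]
  · unfold tn
    rw [Finset.mul_sum]
    apply Finset.sum_congr rfl
    intro γ _
    rw [coeff_C_mul, abs_mul, mul_ite, mul_zero]
  · intro γ
    simp only [mem_support_iff, coeff_C_mul]
    exact right_ne_zero_of_mul

lemma tn_monomial (b : ℕ) (γ : Fin (m+1) →₀ ℕ) (a : ℝ) :
    tn b (monomial γ a) = if γ (Fin.last m) = b then |a| else 0 := by
  classical
  rw [tn_eq_of_subset b _ (support_monomial_subset)]
  simp

lemma tn_pderiv_le {d : ℕ} (b : ℕ) {q : MvPolynomial (Fin (m+1)) ℝ} (hd : q.totalDegree ≤ d)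
    {l : Fin (m+1)} (hl : l ≠ Fin.last m) : tn b (pderiv l q) ≤ d * tn b q := by
  classical
  conv_lhs => rw [q.as_sum, map_sum]
  refine (tn_sum_le b _ _).trans ?_
  rw [tn, Finset.mul_sum]
  apply Finset.sum_le_sum
  intro γ hγ
  rw [pderiv_monomial, tn_monomial]
  have h1 : (γ - Finsupp.single l 1 : Fin (m+1) →₀ ℕ) (Fin.last m) = γ (Fin.last m) := by
    simp [hl]
  rw [h1]
  split_ifs
  · rw [abs_mul, mul_comm]
    apply mul_le_mul_of_nonneg_right _ (abs_nonneg _)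
    rw [abs_of_nonneg (by positivity)]
    have : γ l ≤ γ.degree := Finsupp.le_degree l γ
    exact_mod_cast this.trans ((degree_le_td hγ).trans hd)
  · simp

lemma tn_pderiv_last (b : ℕ) (q : MvPolynomial (Fin (m+1)) ℝ) :
    (b + 1) * tn (b + 1) q ≤ tn b (pderiv (Fin.last m) q) := by
  classical
  set t := Fin.last m
  rw [tn, Finset.mul_sum, ← Finset.sum_filter_add_sum_filter_not q.support (fun γ => γ t = b + 1)]
  rw [Finset.sum_eq_zero (s := q.support.filter (fun γ => ¬ γ t = b + 1)), add_zero]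
  swap
  · intro γ hγ
    rw [if_neg (Finset.mem_filter.mp hγ).2, mul_zero]
  set s := q.support.filter (fun γ => γ t = b + 1)
  have hback : ∀ γ ∈ s, γ - Finsupp.single t 1 + Finsupp.single t 1 = γ := by
    intro γ hγ
    apply tsub_add_cancel_of_le
    rw [Finsupp.single_le_iff, (Finset.mem_filter.mp hγ).2]; omega
  have hinj : Set.InjOn (fun γ : Fin (m+1) →₀ ℕ => γ - Finsupp.single t 1) s := by
    intro γ hγ γ' hγ' h
    rw [← hback γ hγ, ← hback γ' hγ']
    simp only at h
    rw [h]
  rw [tn_eq_of_subset b _ (Finset.subset_union_right (s₁ := s.image (fun γ => γ - Finsupp.single t 1)))]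
  refine le_trans ?_ (Finset.sum_le_sum_of_subset_of_nonneg Finset.subset_union_left
    (fun _ _ _ => by split_ifs <;> positivity))
  rw [Finset.sum_image hinj]
  apply Finset.sum_le_sum
  intro γ hγ
  have h2 := (Finset.mem_filter.mp hγ).2
  have h3 : (γ - Finsupp.single t 1 : Fin (m+1) →₀ ℕ) t = b := by
    simp [h2]
  rw [if_pos h2, if_pos h3, coeff_pderiv, hback γ hγ, h3, abs_mul, mul_comm]
  rw [abs_of_nonneg (by positivity : (0:ℝ) ≤ (b:ℝ) + 1)]

lemma pn_eq_sum_tn {d : ℕ} {q : MvPolynomial (Fin (m+1)) ℝ} (hd : q.totalDegree ≤ d) :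
    pn 1 q = ∑ b ∈ Finset.range (d+1), tn b q := by
  unfold tn pn wn
  rw [Finset.sum_comm]
  apply Finset.sum_congr rfl
  intro γ hγ
  rw [Finset.sum_ite_eq, if_pos]; · simp
  rw [Finset.mem_range]
  have := Finsupp.le_degree (Fin.last m) γ
  have := (degree_le_td hγ).trans hd
  omega

lemma tn_zero_le (f : MvPolynomial (Fin (m+1)) ℝ) (z0 : Fin (m+1) → ℝ) (w : Fin (m+1) → Fin (m+1) → ℝ) :
    tn 0 (aeval (fun i => C (z0 i) + ∑ k, C (w k i) * X k : Fin (m+1) → MvPolynomial (Fin (m+1)) ℝ) f)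
    ≤ pn 1 (aeval (fun i => C (z0 i) + ∑ k : Fin m, C (w k.castSucc i) * X k.castSucc :
      Fin (m+1) → MvPolynomial (Fin (m+1)) ℝ) f) := by
  classical
  set ψ : Fin (m+1) → MvPolynomial (Fin (m+1)) ℝ := Fin.snoc (fun k : Fin m => X k.castSucc) 0 with hψ
  set g := aeval (fun i => C (z0 i) + ∑ k, C (w k i) * X k : Fin (m+1) → MvPolynomial (Fin (m+1)) ℝ) f with hg
  have h1 : aeval ψ g = aeval (fun i => C (z0 i) + ∑ k : Fin m, C (w k.castSucc i) * X k.castSucc :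
      Fin (m+1) → MvPolynomial (Fin (m+1)) ℝ) f := by
    have : (aeval ψ).comp (aeval (fun i => C (z0 i) + ∑ k, C (w k i) * X k : Fin (m+1) → MvPolynomial (Fin (m+1)) ℝ))
      = aeval (fun i => C (z0 i) + ∑ k : Fin m, C (w k.castSucc i) * X k.castSucc :
      Fin (m+1) → MvPolynomial (Fin (m+1)) ℝ) := by
      apply MvPolynomial.algHom_ext
      intro i
      simp only [AlgHom.comp_apply, aeval_X, map_add, map_sum, map_mul, aeval_C, algebraMap_eq]
      rw [Fin.sum_univ_castSucc]
      simp [hψ]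
    exact DFunLike.congr_fun this f
  rw [← h1]
  have h2 : ∀ γ : Fin (m+1) →₀ ℕ, C (coeff γ g) * ∏ i, ψ i ^ γ i =
      if γ (Fin.last m) = 0 then monomial γ (coeff γ g) else 0 := by
    intro γ
    rw [Fin.prod_univ_castSucc]
    simp only [hψ, Fin.snoc_castSucc, Fin.snoc_last]
    split_ifs with h
    · rw [h, pow_zero, mul_one, monomial_eq, Finsupp.prod_fintype _ _ (by simp), Fin.prod_univ_castSucc, h,
        pow_zero, mul_one]
    · rw [zero_pow h]; simp
  have h3 : ∀ γ, γ (Fin.last m) = 0 → coeff γ (aeval ψ g) = coeff γ g := by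
    intro γ hγ
    rw [aeval_eq_sum, coeff_sum]
    simp only [h2]
    by_cases hs : γ ∈ g.support
    · rw [Finset.sum_eq_single_of_mem γ hs]
      · rw [if_pos hγ, coeff_monomial, if_pos rfl]
      · intro β _ hb
        split_ifs
        · rw [coeff_monomial, if_neg hb]
        · simp
    · rw [notMem_support_iff.mp hs]
      apply Finset.sum_eq_zero
      intro β hb
      split_ifs
      · rw [coeff_monomial, if_neg]; rintro rfl; exact hs hb
      · simp
  rw [pn, wn_eq_of_subset _ _ (Finset.subset_union_right (s₁ := g.support)),
    tn_eq_of_subset _ _ (Finset.subset_union_left (s₂ := (aeval ψ g).support))]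
  apply Finset.sum_le_sum
  intro γ _
  split_ifs with h
  · rw [h3 γ h]; simp
  · positivity

/-- Cauchy-Kovalevskaya type estimate -/
lemma ck_est {d : ℕ} {α : ℝ} (hα : 0 ≤ α) (q : Fin (m+1) → MvPolynomial (Fin (m+1)) ℝ)
    (hd : ∀ k, (q k).totalDegree ≤ d)
    (hsym : ∀ k l, pderiv k (q l) = pderiv l (q k)) (a : Fin (m+1) → Fin (m+1) → ℝ)
    (ha : ∀ k l, |a k l| ≤ α) (hat : 1 ≤ a (Fin.last m) (Fin.last m))
    (hpde : ∑ k, ∑ l, C (a k l) * pderiv k (q l) = 0) :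
    ∑ k, pn 1 (q k) ≤ Real.exp ((m + 1 + (m+1)^2 * α) * d) * ∑ k, tn 0 (q k) := by
  classical
  set t := Fin.last m
  set N : ℕ → ℝ := fun b => ∑ k, tn b (q k) with hN
  have hN0 : ∀ b, 0 ≤ N b := fun b => Finset.sum_nonneg fun _ _ => tn_nonneg _ _
  have hle : ∀ b k, tn b (q k) ≤ N b := fun b k =>
    Finset.single_le_sum (f := fun k => tn b (q k)) (fun _ _ => tn_nonneg _ _) (Finset.mem_univ k)
  set K : ℝ := m + 1 + (m+1)^2 * α with hK
  have hK0 : 0 ≤ K := by positivity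
  have h1 : ∀ b k l, (k, l) ≠ (t, t) → tn b (pderiv k (q l)) ≤ d * N b := by
    intro b k l hkl
    by_cases hk : k = t
    · have hl : l ≠ t := by rintro rfl; exact hkl (by rw [hk])
      rw [hsym]
      exact (tn_pderiv_le b (hd k) hl).trans (mul_le_mul_of_nonneg_left (hle b k) (by positivity))
    · exact (tn_pderiv_le b (hd l) hk).trans (mul_le_mul_of_nonneg_left (hle b l) (by positivity))
  have h2 : ∀ b, tn b (pderiv t (q t)) ≤ (m+1)^2 * α * (d * N b) := by
    intro b
    have e : C (a t t) * pderiv t (q t) =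
        ∑ kl ∈ (Finset.univ : Finset (Fin (m+1) × Fin (m+1))).erase (t,t),
          C (- a kl.1 kl.2) * pderiv kl.1 (q kl.2) := by
      rw [← Fintype.sum_prod_type' (f := fun k l => C (a k l) * pderiv k (q l)),
        ← Finset.add_sum_erase _ _ (Finset.mem_univ (t,t))] at hpde
      simp only [map_neg, neg_mul, Finset.sum_neg_distrib]
      exact eq_neg_of_add_eq_zero_left hpde
    have e2 := congrArg (tn b) e
    rw [tn_C_mul] at e2
    have e3 : tn b (pderiv t (q t)) ≤ |a t t| * tn b (pderiv t (q t)) := by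
      have := le_abs_self (a t t)
      nlinarith [tn_nonneg b (pderiv t (q t))]
    rw [e2] at e3
    refine e3.trans ((tn_sum_le b _ _).trans ?_)
    have : ∀ kl ∈ (Finset.univ : Finset (Fin (m+1) × Fin (m+1))).erase (t,t),
        tn b (C (- a kl.1 kl.2) * pderiv kl.1 (q kl.2)) ≤ α * (d * N b) := by
      intro kl hkl
      rw [tn_C_mul, abs_neg]
      exact mul_le_mul (ha _ _) (h1 b _ _ (Finset.ne_of_mem_erase hkl)) (tn_nonneg _ _) hα
    refine (Finset.sum_le_sum this).trans ?_
    rw [Finset.sum_const, nsmul_eq_mul, mul_assoc]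
    apply mul_le_mul_of_nonneg_right
    · have : ((Finset.univ : Finset (Fin (m+1) × Fin (m+1))).erase (t,t)).card ≤ (m+1)*(m+1) := by
        refine (Finset.card_erase_le).trans ?_
        simp
      have h2 := this.trans (le_of_eq (sq (m+1)).symm)
      exact_mod_cast h2
    · exact mul_nonneg hα (mul_nonneg (Nat.cast_nonneg _) (hN0 b))
  have hstep : ∀ b : ℕ, (b + 1) * N (b + 1) ≤ K * d * N b := by
    intro b
    have : (b + 1) * N (b+1) ≤ ∑ k, tn b (pderiv t (q k)) := by
      rw [hN]; simp only; rw [Finset.mul_sum]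
      exact Finset.sum_le_sum fun k _ => tn_pderiv_last b (q k)
    refine this.trans ?_
    rw [← Finset.add_sum_erase _ _ (Finset.mem_univ t)]
    have h3 : ∑ k ∈ Finset.univ.erase t, tn b (pderiv t (q k)) ≤ (m + 1) * (d * N b) := by
      refine (Finset.sum_le_sum (g := fun _ => d * N b) fun k hk => ?_).trans ?_
      · apply h1
        intro h
        exact Finset.ne_of_mem_erase hk (Prod.ext_iff.mp h).2
      · rw [Finset.sum_const, nsmul_eq_mul]
        apply mul_le_mul_of_nonneg_right
        · have : (Finset.univ.erase t).card ≤ m + 1 := Finset.card_erase_le.trans (by simp)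
          exact_mod_cast this
        · exact mul_nonneg (Nat.cast_nonneg _) (hN0 b)
    have := h2 b
    rw [hK]; linarith
  have hb : ∀ b : ℕ, N b ≤ (K * d) ^ b / b.factorial * N 0 := by
    intro b
    induction b with
    | zero => simp
    | succ b ih =>
      have h4 := (hstep b).trans (mul_le_mul_of_nonneg_left ih (by positivity))
      have hb1 : (0:ℝ) < b + 1 := by positivity
      rw [Nat.factorial_succ]
      push_cast
      rw [pow_succ]
      have : (K * d) ^ b * (K * d) / ((b + 1) * b.factorial) * N 0 = K * d * ((K * d) ^ b / b.factorial * N 0) / (b+1) := by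
        have : (b.factorial : ℝ) ≠ 0 := by positivity
        field_simp
      rw [this, le_div_iff₀ hb1]
      linarith
  have hsum : ∑ k, pn 1 (q k) = ∑ b ∈ Finset.range (d+1), N b := by
    rw [hN]; simp only; rw [Finset.sum_comm]
    exact Finset.sum_congr rfl fun k _ => pn_eq_sum_tn (hd k)
  rw [hsum]
  refine (Finset.sum_le_sum fun b _ => hb b).trans ?_
  rw [← Finset.sum_mul]
  exact mul_le_mul_of_nonneg_right (Real.sum_le_exp_of_nonneg (by positivity) _) (hN0 0)

lemma pderiv_comm' {ι : Type*} (i j : ι) (P : MvPolynomial ι ℝ) :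
    pderiv i (pderiv j P) = pderiv j (pderiv i P) := by
  classical
  by_cases h : i = j
  · rw [h]
  ext γ
  simp only [coeff_pderiv]
  rw [add_right_comm]
  simp [h, Ne.symm h]
  ring

theorem alg_main (m : ℕ) {β : ℝ} (hβ : 1 ≤ β) : ∃ K : ℝ, 1 ≤ K ∧ ∀ (d : ℕ) (p η : ℝ)
    (P : MvPolynomial (Fin (m+1)) ℝ), HarmP P → (∀ i, (pderiv i P).totalDegree ≤ d) →
    (m : ℝ) * d < (m + 1) * p →
    ∀ (z w B : Fin (m+1) → Fin (m+1) → ℝ), (∀ k i, |z k i| ≤ 2) →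
    (∀ k i, wn (fun j => if (j:ℝ) < p then 1 else 0) (sh (z k) (pderiv i P)) ≤ η) →
    (∀ (k : Fin m) i, w k.castSucc i = z k.succ i - z 0 i) →
    (∑ i, (w (Fin.last m) i)^2 ≤ 1) →
    (∀ k j, |B k j| ≤ β) → (∀ k i, |w k i| ≤ 4) →
    (∀ i j, ∑ k, w k i * B k j = if i = j then 1 else 0) →
    (∑ j, w (Fin.last m) j * B (Fin.last m) j = 1) →
    ∀ i, pn 1 (pderiv i P) ≤ K ^ (d + 1) * η := by
  set n : ℝ := m + 1 with hn
  have hn1 : 1 ≤ n := by rw [hn]; linarith [(Nat.cast_nonneg m : (0:ℝ) ≤ m)]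
  set c := (n + n^2 * (n * β^2)) with hc
  have hc0 : 0 ≤ c := by positivity
  set K1 := n * β * 3 with hK1
  have hK11 : 1 ≤ K1 := by nlinarith
  set K0 := β * n * n * 4 * n * n with hK0
  have hK01 : 1 ≤ K0 := by
    have a1 : 1 ≤ β * n := by nlinarith
    have a2 : 1 ≤ β * n * n := by nlinarith
    have a3 : 1 ≤ β * n * n * 4 := by nlinarith
    have a4 : 1 ≤ β * n * n * 4 * n := by nlinarith
    nlinarith
  have hexp : 1 ≤ Real.exp c := Real.one_le_exp hc0
  set K2 := K1 * Real.exp c * n * (n * 4) with hK2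
  have hK21 : 1 ≤ K2 := by
    have a1 : 1 ≤ K1 * Real.exp c := by nlinarith
    have a2 : 1 ≤ K1 * Real.exp c * n := by nlinarith
    nlinarith
  refine ⟨K0 * K2, by nlinarith, ?_⟩
  intro d p η P hP hdeg hp z w B hz low hw hν hB hw4 hBw hBt i
  set t := Fin.last m with ht
  set A : Fin (m+1) → MvPolynomial (Fin (m+1)) ℝ := fun i => C (z 0 i) + ∑ k, C (w k i) * X k with hA
  have hη : 0 ≤ η := (wn_nonneg (fun j => by split_ifs <;> norm_num) _).trans (low 0 0)
  have hAtd : ∀ i, (A i).totalDegree ≤ 1 := fun i => td_affine _ _ _ fun k => by simp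
  set g : Fin (m+1) → MvPolynomial (Fin (m+1)) ℝ := fun j => aeval A (pderiv j P) with hg
  have hgtd : ∀ j, (g j).totalDegree ≤ d := fun j => (td_aeval hAtd _).trans (hdeg j)
  set q : Fin (m+1) → MvPolynomial (Fin (m+1)) ℝ := fun k => ∑ i, C (w k i) * g i with hq
  have hdA : ∀ k i, pderiv k (A i) = C (w k i) := by
    intro k i
    simp only [hA, map_add, pderiv_C, zero_add, map_sum, Derivation.leibniz, smul_zero, add_zero,
      smul_eq_mul, pderiv_X]
    rw [Finset.sum_eq_single k]
    · simp
    · intro b _ hb; simp [hb]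
    · simp
  have hqd : ∀ k, q k = pderiv k (aeval A P) := by
    intro k
    rw [chain_rule]
    simp only [hdA, hq, hg]
    exact Finset.sum_congr rfl fun _ _ => mul_comm _ _
  have hqtd : ∀ k, (q k).totalDegree ≤ d := by
    intro k
    apply totalDegree_finsetSum_le
    intro i _
    refine (totalDegree_mul _ _).trans ?_
    rw [totalDegree_C, zero_add]; exact hgtd i
  have hgq : ∀ j, g j = ∑ k, C (B k j) * q k := by
    intro j
    simp only [hq, Finset.mul_sum]
    rw [Finset.sum_comm]
    have : ∀ i, ∑ k, C (B k j) * (C (w k i) * g i) = C (if i = j then 1 else 0) * g i := by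
      intro i
      rw [← hBw i j, map_sum, Finset.sum_mul]
      exact Finset.sum_congr rfl fun k _ => by rw [map_mul]; ring
    simp only [this]
    simp
  -- slice bound
  have htn : ∀ j, tn 0 (g j) ≤ n ^ d * (n * ((n * 4) ^ d * η)) := by
    intro j
    refine (tn_zero_le _ _ _).trans ((dehomog (hdeg j) z w hw).trans ?_)
    apply mul_le_mul_of_nonneg_left _ (by positivity)
    have := homg_coeff (b := 4) (η := η) (p := p) (hdeg j) z (by norm_num)
      (fun k l i => by
        have := abs_sub (z k i) (z l i)
        linarith [hz k i, hz l i]) (by push_cast; linarith) (Nat.succ_pos m) (fun k => low k j)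
    push_cast at this
    exact this
  set a : Fin (m+1) → Fin (m+1) → ℝ := fun k l => ∑ j, B k j * B l j with ha
  have hck := ck_est (d := d) (α := n * β^2) (by positivity) q hqtd
    (fun k l => by rw [hqd, hqd, pderiv_comm']) a
    (by
      intro k l
      refine (Finset.abs_sum_le_sum_abs _ _).trans ?_
      refine (Finset.sum_le_sum (g := fun _ => β^2) fun j _ => ?_).trans ?_
      · rw [abs_mul, sq]; exact mul_le_mul (hB _ _) (hB _ _) (abs_nonneg _) (by linarith)
      · rw [Finset.sum_const]; simp [hn])
    (by
      have := Finset.sum_mul_sq_le_sq_mul_sq Finset.univ (w t) (B t)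
      rw [hBt] at this
      have h2 : a t t = ∑ j, B t j ^ 2 := by simp only [ha, sq]
      rw [h2]
      have h3 : 0 ≤ ∑ j, B t j ^ 2 := Finset.sum_nonneg fun _ _ => sq_nonneg _
      nlinarith)
    (by
      have h1 : ∑ j, aeval A (pderiv j (pderiv j P)) = 0 := by
        rw [← map_sum]; unfold HarmP at hP; rw [hP, map_zero]
      have h2 : ∀ j, ∑ k, C (B k j) * pderiv k (g j) = aeval A (pderiv j (pderiv j P)) := by
        intro j
        simp only [hg, chain_rule, hdA, Finset.mul_sum]
        rw [Finset.sum_comm]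
        have : ∀ i, ∑ k, C (B k j) * (aeval A (pderiv i (pderiv j P)) * C (w k i)) =
            C (if i = j then 1 else 0) * aeval A (pderiv i (pderiv j P)) := by
          intro i
          rw [← hBw i j, map_sum, Finset.sum_mul]
          exact Finset.sum_congr rfl fun k _ => by rw [map_mul]; ring
        simp only [this]
        simp
      rw [← h1]
      simp only [← h2]
      simp only [hgq, map_sum, Derivation.leibniz, pderiv_C, smul_zero, add_zero, smul_eq_mul, ha,
        Finset.mul_sum, Finset.sum_mul]
      rw [Finset.sum_congr rfl fun k _ => Finset.sum_comm, Finset.sum_comm]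
      refine Finset.sum_congr rfl fun j _ => Finset.sum_congr rfl fun k _ =>
        Finset.sum_congr rfl fun l _ => ?_
      rw [map_mul]; ring)
  have hN0 : ∑ k, tn 0 (q k) ≤ n * (n * (4 * (n ^ d * (n * ((n * 4) ^ d * η))))) := by
    refine (Finset.sum_le_sum (g := fun _ => n * (4 * (n ^ d * (n * ((n * 4) ^ d * η))))) fun k _ => ?_).trans ?_
    · refine (tn_sum_le _ _ _).trans ?_
      refine (Finset.sum_le_sum (g := fun _ => 4 * (n ^ d * (n * ((n * 4) ^ d * η)))) fun i _ => ?_).trans ?_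
      · rw [tn_C_mul]; exact mul_le_mul (hw4 k i) (htn i) (tn_nonneg _ _) (by norm_num)
      · rw [Finset.sum_const]; simp [hn]
    · rw [Finset.sum_const]; simp [hn]
  have hg1 : pn 1 (g i) ≤ β * (Real.exp (c * d) * (n * (n * (4 * (n ^ d * (n * ((n * 4) ^ d * η))))))) := by
    rw [hgq]
    refine (wn_sum_le (by simp) _ _).trans ?_
    refine (Finset.sum_le_sum (g := fun k => β * pn 1 (q k)) fun k _ => ?_).trans ?_
    · rw [wn_C_mul]; exact mul_le_mul_of_nonneg_right (hB k i) (pn_nonneg zero_le_one _)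
    · rw [← Finset.mul_sum]
      apply mul_le_mul_of_nonneg_left _ (by linarith)
      exact hck.trans (mul_le_mul_of_nonneg_left hN0 (Real.exp_pos _).le)
  set A' : Fin (m+1) → MvPolynomial (Fin (m+1)) ℝ := fun k => ∑ j, C (B k j) * (X j + C (- z 0 j)) with hA'
  have hinv : pderiv i P = aeval A' (g i) := by
    have : (aeval A').comp (aeval A) = AlgHom.id ℝ (MvPolynomial (Fin (m+1)) ℝ) := by
      apply MvPolynomial.algHom_ext
      intro i
      simp only [AlgHom.comp_apply, aeval_X, AlgHom.id_apply, hA, map_add, map_sum, map_mul, aeval_C,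
        algebraMap_eq, hA', Finset.mul_sum]
      rw [Finset.sum_comm]
      have : ∀ j, ∑ k, C (w k i) * (C (B k j) * (X j + C (- z 0 j))) =
          C (if i = j then 1 else 0) * (X j + C (- z 0 j) : MvPolynomial (Fin (m+1)) ℝ) := by
        intro j
        rw [← hBw i j, map_sum, Finset.sum_mul]
        exact Finset.sum_congr rfl fun k _ => by rw [map_mul]; ring
      simp only [this]
      simp
    exact (DFunLike.congr_fun this (pderiv i P)).symm
  have hf : pn 1 (pderiv i P) ≤ K1 ^ d * pn 1 (g i) := by
    rw [hinv]
    refine (pn_aeval_le zero_le_one A' (ρ := K1) ?_ _).trans (pn_le_pow hK11 (hgtd i))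
    intro k
    have := pn_linform_le (r := 1) zero_le_one (B k) (fun j => (X j + C (- z 0 j) : MvPolynomial (Fin (m+1)) ℝ))
      (b := β) (ρ := 3) (by norm_num) (hB k) (fun j => by
        refine (wn_add_le (by simp) _ _).trans ?_
        have a1 := pn_X (ι := Fin (m+1)) 1 j
        have a2 := pn_C (ι := Fin (m+1)) 1 (- z 0 j)
        unfold pn at a1 a2
        rw [a1, a2, abs_neg]; linarith [hz 0 j])
    refine this.trans (le_of_eq ?_)
    simp [hK1, hn]; ring
  have e1 : Real.exp (c * d) = Real.exp c ^ d := by rw [← Real.exp_nat_mul]; ring_nf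
  have e2 : K1 ^ d * (β * (Real.exp (c * d) * (n * (n * (4 * (n ^ d * (n * ((n * 4) ^ d * η)))))))) ≤
      K0 * K2 ^ d * η := by
    rw [e1, hK2, hK0]
    simp only [mul_pow]
    have : 0 ≤ K1 ^ d * Real.exp c ^ d * n ^ d * (n ^ d * 4 ^ d) * (β * n * n * 4 * n) * η := by positivity
    nlinarith
  calc pn 1 (pderiv i P) ≤ K1 ^ d * pn 1 (g i) := hf
    _ ≤ K0 * K2 ^ d * η := (mul_le_mul_of_nonneg_left hg1 (by positivity)).trans e2
    _ ≤ (K0 * K2) ^ (d+1) * η := by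
      apply mul_le_mul_of_nonneg_right _ hη
      rw [mul_pow K0 K2]
      apply mul_le_mul
      · exact le_self_pow₀ hK01 (by omega)
      · exact pow_le_pow_right₀ hK21 (by omega)
      · positivity
      · positivity

end tn
end PoS

namespace PoS
section key
open MvPolynomial

/-- truncation -/
noncomputable def tr {n : ℕ} (D : ℕ) (q : MvPolynomial (Fin n) ℝ) : MvPolynomial (Fin n) ℝ :=
  ∑ j ∈ Finset.range D, homogeneousComponent j q

lemma coeff_tr {n : ℕ} (D : ℕ) (q : MvPolynomial (Fin n) ℝ) (γ : Fin n →₀ ℕ) :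
    coeff γ (tr D q) = if γ.degree < D then coeff γ q else 0 := by
  unfold tr
  rw [coeff_sum]
  simp only [coeff_homogeneousComponent]
  rw [Finset.sum_ite_eq]; simp

lemma pderiv_tr {n : ℕ} (D : ℕ) (q : MvPolynomial (Fin n) ℝ) (i : Fin n) :
    pderiv i (tr D q) = tr (D - 1) (pderiv i q) := by
  ext γ
  rw [coeff_pderiv, coeff_tr, coeff_tr, coeff_pderiv, map_add, Finsupp.degree_single]
  have : γ.degree + 1 < D ↔ γ.degree < D - 1 := by omega
  simp only [this]
  split_ifs <;> simp

lemma HarmP.tr {n : ℕ} {P : MvPolynomial (Fin n) ℝ} (h : HarmP P) (D : ℕ) : HarmP (tr D P) := by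
  unfold HarmP at *
  simp only [pderiv_tr]
  have : ∑ i, PoS.tr (D - 1 - 1) (pderiv i (pderiv i P)) = PoS.tr (D - 1 - 1) (∑ i, pderiv i (pderiv i P)) := by
    unfold PoS.tr
    rw [Finset.sum_comm]
    simp only [map_sum]
  rw [this, h]
  simp [PoS.tr]

lemma td_tr {n : ℕ} (d : ℕ) (q : MvPolynomial (Fin n) ℝ) : (tr (d+1) q).totalDegree ≤ d := by
  apply td_le
  intro γ hγ
  rw [mem_support_iff, coeff_tr] at hγ
  by_contra h
  rw [if_neg (by omega)] at hγ
  exact hγ rfl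

lemma tail_le {n D : ℕ} {M R : ℝ} (hR : 3 ≤ R) (hM : M ≤ D) (q : MvPolynomial (Fin n) ℝ) :
    pn 3 (q - tr D q) ≤ (3 / R) ^ M * pn R q := by
  have hc : ∀ γ, coeff γ (q - tr D q) = if γ.degree < D then 0 else coeff γ q := by
    intro γ; rw [coeff_sub, coeff_tr]; split_ifs <;> simp
  rw [pn, wn_eq_of_subset _ _ (s := q.support)]
  · unfold pn wn
    rw [Finset.mul_sum]
    apply Finset.sum_le_sum
    intro γ _
    rw [hc]
    have hR0 : 0 < R := by linarith
    split_ifs with h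
    · rw [abs_zero, zero_mul]; positivity
    · have h1 : (3:ℝ) ^ γ.degree = R ^ γ.degree * (3 / R) ^ (γ.degree : ℝ) := by
        rw [Real.rpow_natCast, ← mul_pow]; congr 1; field_simp
      have h2 : (3 / R) ^ (γ.degree : ℝ) ≤ (3 / R) ^ M := by
        apply Real.rpow_le_rpow_of_exponent_ge (by positivity) (by rw [div_le_one hR0]; exact hR)
        push Not at h
        exact hM.trans (by exact_mod_cast h)
      rw [h1]
      have : 0 ≤ |coeff γ q| * R ^ γ.degree := by positivity
      nlinarith [mul_le_mul_of_nonneg_left h2 this]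
  · intro γ
    rw [mem_support_iff, mem_support_iff, hc]
    split_ifs <;> simp

lemma low_le {n : ℕ} {ρ p : ℝ} (hρ : 0 < ρ) (hρ1 : ρ ≤ 1) (q : MvPolynomial (Fin n) ℝ) :
    wn (fun j => if (j:ℝ) < p then 1 else 0) q ≤ ρ ^ (-p) * pn ρ q := by
  have : ∀ j : ℕ, (if (j:ℝ) < p then (1:ℝ) else 0) ≤ ρ ^ (-p) * ρ ^ j + 0 * 0 := by
    intro j
    split_ifs with h
    · rw [← Real.rpow_natCast, ← Real.rpow_add hρ, mul_zero, add_zero]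
      apply Real.one_le_rpow_of_pos_of_le_one_of_nonpos hρ hρ1
      linarith
    · positivity
  refine (wn_mono this q).trans ?_
  have := wn_lin (ρ ^ (-p)) 0 (fun j => ρ ^ j) (fun _ => 0) q
  rw [this]; simp [pn]

set_option maxHeartbeats 1000000 in
theorem key_unit (m : ℕ) {β τ : ℝ} (hβ : 1 ≤ β) (hτ : 0 < τ) : ∃ R ρ : ℝ, 3 ≤ R ∧ 0 < ρ ∧ ρ < 1 ∧ ρ ≤ τ ∧
    ∀ (N : ℝ), 1/2 ≤ N → ∀ (P : MvPolynomial (Fin (m+1)) ℝ), HarmP P → 0 < SS P 0 1 →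
    SS P 0 R ≤ R ^ N * SS P 0 1 → SS P 0 3 ≤ 3 ^ N * SS P 0 1 →
    ∀ (z w B : Fin (m+1) → Fin (m+1) → ℝ), (∀ k i, |z k i| ≤ 2) →
    (∀ k, SS P (z k) ρ ≤ ρ ^ ((1 - 1/(4*((m:ℝ)+1))) * N) * SS P (z k) 1) →
    (∀ (k : Fin m) i, w k.castSucc i = z k.succ i - z 0 i) →
    (∑ i, (w (Fin.last m) i)^2 ≤ 1) →
    (∀ k j, |B k j| ≤ β) → (∀ k i, |w k i| ≤ 4) →
    (∀ i j, ∑ k, w k i * B k j = if i = j then 1 else 0) →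
    (∑ j, w (Fin.last m) j * B (Fin.last m) j = 1) → False := by
  obtain ⟨K, hK1, hK⟩ := alg_main m hβ
  set n : ℝ := m + 1 with hn
  have hn1 : 1 ≤ n := by rw [hn]; linarith [(Nat.cast_nonneg m : (0:ℝ) ≤ m)]
  set κ : ℝ := 1 / (2 * n) with hκ
  have hκ0 : 0 < κ := by positivity
  have hκ1 : κ ≤ 1/2 := by rw [hκ, div_le_div_iff₀ (by positivity) (by norm_num)]; linarith
  have hκn : κ * (2 * n) = 1 := by rw [hκ]; field_simp
  set M : ℝ := K ^ 4 * 9 * (n+1)^2 * 16 with hM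
  have hK4 : 1 ≤ K ^ 4 := one_le_pow₀ hK1
  have hM9 : 9 ≤ M := by
    have h1 : 1 ≤ (n+1)^2 := by nlinarith
    have h2 : 1 ≤ K ^ 4 * (n+1)^2 := by nlinarith
    rw [hM]; nlinarith
  have hM0 : 0 < M := by linarith
  have hRρ : 3 ≤ M ^ (1/κ) := by
    have : M ^ (1:ℝ) ≤ M ^ (1/κ) := by
      apply Real.rpow_le_rpow_of_exponent_le (by linarith)
      rw [le_div_iff₀ hκ0]; linarith
    rw [Real.rpow_one] at this; linarith
  refine ⟨M ^ (1/κ), min (M ^ (-(2/κ))) τ, hRρ, by positivity, ?_, min_le_right _ _, ?_⟩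
  · refine (min_le_left _ _).trans_lt ?_
    apply Real.rpow_lt_one_of_one_lt_of_neg (by linarith)
    have : 0 < 2 / κ := by positivity
    linarith
  set R := M ^ (1/κ) with hR
  set ρ := min (M ^ (-(2/κ))) τ with hρ
  have hρ0 : 0 < ρ := by positivity
  have hρ1 : ρ < 1 := by
    refine (min_le_left _ _).trans_lt ?_
    apply Real.rpow_lt_one_of_one_lt_of_neg (by linarith)
    have : 0 < 2 / κ := by positivity
    linarith
  have hR0 : 0 < R := by linarith
  intro N hN P hP hσ hSR hS3 z w B hz hbad hw hν hB hw4 hBw hBt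
  set σ := SS P 0 1 with hσd
  have hN0 : 0 < N := by linarith
  set d : ℕ := ⌈(1 + κ) * N⌉₊ - 1 with hd
  have hpos : 0 < ⌈(1 + κ) * N⌉₊ := Nat.ceil_pos.mpr (by positivity)
  have hdc : ⌈(1 + κ) * N⌉₊ = d + 1 := by omega
  have hd1 : (1 + κ) * N ≤ ((d + 1 : ℕ) : ℝ) := by rw [← hdc]; exact Nat.le_ceil _
  have hd2 : (d : ℝ) < (1 + κ) * N := by
    have := Nat.ceil_lt_add_one (a := (1 + κ) * N) (by positivity)
    rw [hdc] at this; push_cast at this; linarith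
  set p := (1 - κ) * N with hp
  have hmp : (m : ℝ) * d < n * p := by
    have hm0 : (0:ℝ) ≤ m := Nat.cast_nonneg m
    have h1 : (m:ℝ) * d ≤ m * ((1 + κ) * N) := mul_le_mul_of_nonneg_left hd2.le hm0
    have h2 : (m:ℝ) * (1 + κ) < n * (1 - κ) := by
      have : (m:ℝ) = n - 1 := by rw [hn]; ring
      rw [this]; nlinarith
    rw [hp]; nlinarith
  set T : ℝ := (3 / R) ^ ((1 + κ) * N) * R ^ N * σ with hT
  have htail : ∀ i, pn 3 (pderiv i P - tr (d+1) (pderiv i P)) ≤ (3 / R) ^ ((1 + κ) * N) * pn R (pderiv i P) :=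
    fun i => tail_le hRρ hd1 _
  have htailsum : ∑ i, pn 3 (pderiv i P - tr (d+1) (pderiv i P)) ≤ T := by
    refine (Finset.sum_le_sum fun i _ => htail i).trans ?_
    rw [← Finset.mul_sum, hT, mul_assoc]
    apply mul_le_mul_of_nonneg_left _ (by positivity)
    have : SS P 0 R = ∑ i, pn R (pderiv i P) := by simp [SS, sh_zero]
    rw [← this]; exact hSR
  have htail1 : ∀ i, pn 3 (pderiv i P - tr (d+1) (pderiv i P)) ≤ T := fun i =>
    (Finset.single_le_sum (f := fun i => pn 3 (pderiv i P - tr (d+1) (pderiv i P)))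
      (fun _ _ => pn_nonneg (by norm_num) _) (Finset.mem_univ i)).trans htailsum
  set Lw : ℝ := 3 ^ N * ρ ^ (κ / 2 * N) * σ with hLw
  have hlow : ∀ k i, wn (fun j => if (j:ℝ) < p then 1 else 0) (sh (z k) (pderiv i P)) ≤ Lw := by
    intro k i
    refine (low_le hρ0 hρ1.le _).trans ?_
    have h1 : pn ρ (sh (z k) (pderiv i P)) ≤ SS P (z k) ρ :=
      Finset.single_le_sum (f := fun i => pn ρ (sh (z k) (pderiv i P)))
        (fun _ _ => pn_nonneg hρ0.le _) (Finset.mem_univ i)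
    have h2 : SS P (z k) 1 ≤ 3 ^ N * σ := by
      have := SS_shift (P := P) (r := 1) (h := 2) zero_le_one (x := 0) (y := z k) (fun i => by simpa using hz k i)
      norm_num at this
      exact this.trans hS3
    calc ρ ^ (-p) * pn ρ (sh (z k) (pderiv i P)) ≤ ρ ^ (-p) * (ρ ^ ((1 - 1/(4*n)) * N) * (3 ^ N * σ)) := by
          apply mul_le_mul_of_nonneg_left _ (by positivity)
          exact h1.trans ((hbad k).trans (mul_le_mul_of_nonneg_left h2 (by positivity)))
      _ = Lw := by
          rw [← mul_assoc, ← Real.rpow_add hρ0, hLw]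
          have : -p + (1 - 1/(4*n)) * N = κ / 2 * N := by
            rw [hp, hκ]; field_simp; ring
          rw [this]; ring
  have hlow' : ∀ k i, wn (fun j => if (j:ℝ) < p then 1 else 0) (sh (z k) (pderiv i (tr (d+2) P))) ≤ Lw + T := by
    intro k i
    have e : pderiv i (tr (d+2) P) = pderiv i P + -(pderiv i P - tr (d+1) (pderiv i P)) := by
      rw [pderiv_tr]; simp
    rw [e, map_add, map_neg]
    refine (wn_add_le (fun j => by split_ifs <;> norm_num) _ _).trans ?_
    rw [wn_neg]
    refine add_le_add (hlow k i) ?_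
    have h1 : wn (fun j => if (j:ℝ) < p then 1 else 0) (sh (z k) (pderiv i P - tr (d+1) (pderiv i P))) ≤
        pn 1 (sh (z k) (pderiv i P - tr (d+1) (pderiv i P))) :=
      wn_mono (fun j => by split_ifs <;> simp) _
    refine h1.trans ((pn_sh_le zero_le_one _ (hz k) _).trans ?_)
    norm_num
    exact htail1 i
  have hmain := hK d p (Lw + T) (tr (d+2) P) (hP.tr _)
    (fun i => by rw [pderiv_tr]; exact td_tr d _) hmp z w B hz hlow' hw hν hB hw4 hBw hBt
  have hLT : 0 ≤ Lw + T := by positivity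
  have hσle : σ ≤ n * (K ^ (d+1) * (Lw + T)) + T := by
    have : σ = ∑ i, pn 1 (pderiv i P) := by rw [hσd]; simp [SS, sh_zero]
    rw [this]
    have h1 : ∀ i, pn 1 (pderiv i P) ≤ K ^ (d+1) * (Lw + T) + pn 3 (pderiv i P - tr (d+1) (pderiv i P)) := by
      intro i
      have e : pderiv i P = pderiv i (tr (d+2) P) + (pderiv i P - tr (d+1) (pderiv i P)) := by
        rw [pderiv_tr]; simp
      conv_lhs => rw [e]
      refine (wn_add_le (by simp) _ _).trans (add_le_add (hmain i) ?_)
      exact pn_mono (by norm_num) (by norm_num) _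
    refine (Finset.sum_le_sum fun i _ => h1 i).trans ?_
    rw [Finset.sum_add_distrib, Finset.sum_const]
    refine add_le_add ?_ htailsum
    simp [hn]
  -- bound of constants
  have hKd : K ^ (d+1) ≤ (K ^ 4) ^ N := by
    have : (K ^ 4) ^ N = K ^ (4 * N) := by
      rw [Real.rpow_mul (by linarith)]; norm_cast
    rw [this, ← Real.rpow_natCast]
    apply Real.rpow_le_rpow_of_exponent_le hK1
    push_cast
    nlinarith
  have hnn : n + 1 ≤ ((n+1)^2) ^ N := by
    have h1 : ((n+1)^2) ^ (1/2 : ℝ) ≤ ((n+1)^2) ^ N :=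
      Real.rpow_le_rpow_of_exponent_le (by nlinarith) hN
    rw [← Real.sqrt_eq_rpow, Real.sqrt_sq (by linarith)] at h1
    exact h1
  have h16 : (4:ℝ) ≤ 16 ^ N := by
    have h1 : (16:ℝ) ^ (1/2 : ℝ) ≤ 16 ^ N :=
      Real.rpow_le_rpow_of_exponent_le (by norm_num) hN
    rw [← Real.sqrt_eq_rpow] at h1
    have : Real.sqrt 16 = 4 := by rw [show (16:ℝ) = 4^2 by norm_num]; exact Real.sqrt_sq (by norm_num)
    linarith
  have hMN : M ^ N = (K^4) ^ N * 9 ^ N * ((n+1)^2) ^ N * 16 ^ N := by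
    rw [hM, Real.mul_rpow (by positivity) (by norm_num), Real.mul_rpow (by positivity) (by positivity),
      Real.mul_rpow (by positivity) (by norm_num)]
  have hMN0 : 0 < M ^ N := by positivity
  have hLw' : Lw ≤ 9 ^ N * (M ^ N)⁻¹ * σ := by
    rw [hLw]
    apply mul_le_mul_of_nonneg_right _ hσ.le
    apply mul_le_mul
    · exact Real.rpow_le_rpow (by norm_num) (by norm_num) hN0.le
    · have h1 : ρ ^ (κ / 2 * N) ≤ (M ^ (-(2/κ))) ^ (κ / 2 * N) :=
        Real.rpow_le_rpow hρ0.le (min_le_left _ _) (by positivity)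
      rw [← Real.rpow_mul hM0.le] at h1
      have h2 : -(2/κ) * (κ / 2 * N) = -N := by field_simp
      rwa [h2, Real.rpow_neg hM0.le] at h1
    · positivity
    · positivity
  have hT' : T ≤ 9 ^ N * (M ^ N)⁻¹ * σ := by
    rw [hT]
    apply mul_le_mul_of_nonneg_right _ hσ.le
    have h1 : (3 / R) ^ ((1 + κ) * N) * R ^ N = 3 ^ ((1 + κ) * N) * (M ^ N)⁻¹ := by
      rw [Real.div_rpow (by norm_num) hR0.le, div_mul_eq_mul_div, mul_div_assoc, ← Real.rpow_sub hR0]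
      congr 1
      rw [hR, ← Real.rpow_mul hM0.le, ← Real.rpow_neg hM0.le]
      congr 1
      field_simp; ring
    rw [h1]
    apply mul_le_mul_of_nonneg_right _ (by positivity)
    have : (9:ℝ) ^ N = 3 ^ (2 * N) := by
      rw [Real.rpow_mul (by norm_num)]; norm_num
    rw [this]
    apply Real.rpow_le_rpow_of_exponent_le (by norm_num)
    nlinarith
  have hfin : σ ≤ (n + 1) * ((K^4) ^ N * (2 * (9 ^ N * (M ^ N)⁻¹ * σ))) := by
    have hKN1 : 1 ≤ (K^4) ^ N := Real.one_le_rpow hK4 hN0.le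
    have a1 : T ≤ (K^4) ^ N * (Lw + T) := by
      have : 0 ≤ Lw := by positivity
      nlinarith
    have a2 : K ^ (d+1) * (Lw + T) ≤ (K^4) ^ N * (Lw + T) := mul_le_mul_of_nonneg_right hKd hLT
    have a3 : σ ≤ (n + 1) * ((K^4) ^ N * (Lw + T)) := by nlinarith
    refine a3.trans ?_
    apply mul_le_mul_of_nonneg_left _ (by linarith)
    apply mul_le_mul_of_nonneg_left _ (by positivity)
    linarith
  have hq : (n + 1) * ((K^4) ^ N * (2 * (9 ^ N * (M ^ N)⁻¹ * σ))) ≤ σ / 2 := by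
    have b1 : (n + 1) * ((K^4) ^ N * 9 ^ N) * 4 ≤ M ^ N := by
      rw [hMN]
      have c1 : 0 ≤ (K^4) ^ N * (9:ℝ) ^ N := by positivity
      calc (n + 1) * ((K^4) ^ N * 9 ^ N) * 4 ≤ ((n+1)^2) ^ N * ((K^4) ^ N * 9 ^ N) * 16 ^ N := by gcongr
        _ = _ := by ring
    have : (n + 1) * ((K^4) ^ N * (2 * (9 ^ N * (M ^ N)⁻¹ * σ))) = ((n + 1) * ((K^4) ^ N * 9 ^ N) * 4) * ((M ^ N)⁻¹ * σ / 2) := by ring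
    rw [this]
    refine (mul_le_mul_of_nonneg_right b1 (by positivity)).trans (le_of_eq ?_)
    field_simp
  linarith

end key
end PoS

namespace PoS
section geom

lemma nd_step {E : Type*} [NormedAddCommGroup E] [NormedSpace ℝ E] {j : ℕ} {τ c : ℝ} (hτ : 0 < τ)
    (hc : 1 / τ ≤ c) (w : Fin j → E) (u : E) (hu : ‖u‖ ≤ 4)
    (hw : ∀ (a : Fin j → ℝ) k, |a k| ≤ c * ‖∑ k, a k • w k‖)
    (hd : ∀ v ∈ Submodule.span ℝ (Set.range w), τ ≤ ‖u - v‖) :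
    ∀ (a : Fin (j+1) → ℝ) k, |a k| ≤ (c * (1 + 4/τ)) *
      ‖∑ k, a k • (Fin.snoc w u : Fin (j+1) → E) k‖ := by
  intro a k
  have hc0 : 0 < c := lt_of_lt_of_le (by positivity) hc
  rw [Fin.sum_univ_castSucc]
  simp only [Fin.snoc_castSucc, Fin.snoc_last]
  set s := ∑ k : Fin j, a k.castSucc • w k with hs
  set b := a (Fin.last j) with hb
  have hsV : s ∈ Submodule.span ℝ (Set.range w) :=
    Submodule.sum_mem _ fun k _ => Submodule.smul_mem _ _ (Submodule.subset_span ⟨k, rfl⟩)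
  have hbτ : |b| * τ ≤ ‖s + b • u‖ := by
    by_cases h0 : b = 0
    · simp [h0]
    · have h1 := hd (-(b⁻¹ • s)) (Submodule.neg_mem _ (Submodule.smul_mem _ _ hsV))
      have h2 : s + b • u = b • (u - -(b⁻¹ • s)) := by
        rw [sub_neg_eq_add, smul_add, smul_smul, mul_inv_cancel₀ h0, one_smul, add_comm]
      rw [h2, norm_smul, Real.norm_eq_abs]
      exact mul_le_mul_of_nonneg_left h1 (abs_nonneg _)
  set T := ‖s + b • u‖ with hT
  have hT0 : 0 ≤ T := norm_nonneg _
  have hb1 : |b| ≤ (1/τ) * T := by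
    rw [div_mul_eq_mul_div, one_mul, le_div_iff₀ hτ]; exact hbτ
  refine Fin.lastCases ?_ (fun k => ?_) k
  · refine hb1.trans ?_
    apply mul_le_mul_of_nonneg_right _ hT0
    have : 0 < 4 / τ := by positivity
    nlinarith
  · refine (hw (fun k => a k.castSucc) k).trans ?_
    rw [mul_assoc]
    apply mul_le_mul_of_nonneg_left _ hc0.le
    have h3 : ‖s‖ ≤ T + ‖b • u‖ := by
      have := norm_sub_le (s + b • u) (b • u)
      simpa using this
    rw [norm_smul, Real.norm_eq_abs] at h3
    have h4 : |b| * ‖u‖ ≤ (1/τ) * T * 4 := mul_le_mul hb1 hu (norm_nonneg _) (by positivity)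
    have : (1 + 4/τ) * T = T + (1/τ) * T * 4 := by ring
    rw [this]; linarith

lemma dich_aux {E : Type*} [NormedAddCommGroup E] [NormedSpace ℝ E] {τ : ℝ} (hτ : 0 < τ)
    (Z : Set E) (z0 : E) (hz0 : z0 ∈ Z) (hZ : ∀ y ∈ Z, ‖y‖ ≤ 2) (M : ℕ)
    (hno : ¬ ∃ V : Submodule ℝ E, Module.Finite ℝ V ∧ Module.finrank ℝ V + 1 ≤ M ∧
      ∀ y ∈ Z, ∃ v ∈ V, ‖y - z0 - v‖ < τ) :
    ∀ j ≤ M, ∃ w : Fin j → E, (∀ k, z0 + w k ∈ Z) ∧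
      ∀ (a : Fin j → ℝ) k, |a k| ≤ (1/τ * (1 + 4/τ)^j) * ‖∑ k, a k • w k‖ := by
  intro j
  induction j with
  | zero => intro _; exact ⟨Fin.elim0, fun k => k.elim0, fun a k => k.elim0⟩
  | succ j ih =>
    intro hj
    obtain ⟨w, hw1, hw2⟩ := ih (by omega)
    have : ∃ y ∈ Z, ∀ v ∈ Submodule.span ℝ (Set.range w), τ ≤ ‖y - z0 - v‖ := by
      by_contra hcon
      push Not at hcon
      apply hno
      refine ⟨Submodule.span ℝ (Set.range w), Module.Finite.span_of_finite ℝ (Set.finite_range w), ?_, hcon⟩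
      have := finrank_range_le_card (R := ℝ) w
      rw [Set.finrank, Fintype.card_fin] at this
      omega
    obtain ⟨y, hy, hyv⟩ := this
    refine ⟨Fin.snoc w (y - z0), ?_, ?_⟩
    · intro k
      refine Fin.lastCases ?_ (fun k => ?_) k
      · simpa using hy
      · simpa using hw1 k
    · have h1 : 1 ≤ (1 + 4/τ)^j := by
        apply one_le_pow₀
        have : 0 < 4 / τ := by positivity
        linarith
      have h2 : 1/τ ≤ 1/τ * (1 + 4/τ)^j := by
        have : 0 < 1/τ := by positivity
        nlinarith
      have := nd_step hτ h2 w (y - z0) (by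
        have := norm_sub_le y z0
        linarith [hZ y hy, hZ z0 hz0]) hw2 hyv
      rw [pow_succ, ← mul_assoc]
      exact this

noncomputable def bet (m : ℕ) (τ : ℝ) : ℝ := 1/τ * (1 + 4/τ)^(m+1)

lemma bet_ge {m : ℕ} {τ : ℝ} (hτ : 0 < τ) (hτ1 : τ ≤ 1) : 1 ≤ bet m τ := by
  have h1 : 1 ≤ 1/τ := by rw [le_div_iff₀ hτ]; linarith
  have h2 : 1 ≤ (1 + 4/τ)^(m+1) := by
    apply one_le_pow₀
    have : 0 < 4 / τ := by positivity
    linarith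
  unfold bet; nlinarith

lemma coord_le {n : ℕ} (v : EuclideanSpace ℝ (Fin n)) (i : Fin n) : |v i| ≤ ‖v‖ := by
  have := PiLp.norm_apply_le v i
  simpa using this

theorem dichotomy (m : ℕ) {τ : ℝ} (hτ : 0 < τ) (hτ1 : τ ≤ 1)
    (Z : Set (EuclideanSpace ℝ (Fin (m+1)))) (z0 : EuclideanSpace ℝ (Fin (m+1))) (hz0 : z0 ∈ Z)
    (hZ : ∀ y ∈ Z, ‖y‖ ≤ 2)
    (hno : ¬ ∃ V : Submodule ℝ (EuclideanSpace ℝ (Fin (m+1))), Module.Finite ℝ V ∧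
      Module.finrank ℝ V + 1 ≤ m ∧ ∀ y ∈ Z, ∃ v ∈ V, ‖y - z0 - v‖ < τ) :
    ∃ (z : Fin (m+1) → EuclideanSpace ℝ (Fin (m+1))) (w B : Fin (m+1) → Fin (m+1) → ℝ),
      (∀ k, z k ∈ Z) ∧
      (∀ (k : Fin m) i, w k.castSucc i = z k.succ i - z 0 i) ∧
      (∑ i, (w (Fin.last m) i)^2 ≤ 1) ∧
      (∀ k j, |B k j| ≤ bet m τ) ∧ (∀ k i, |w k i| ≤ 4) ∧
      (∀ i j, ∑ k, w k i * B k j = if i = j then 1 else 0) ∧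
      (∑ j, w (Fin.last m) j * B (Fin.last m) j = 1) := by
  obtain ⟨w, hw1, hw2⟩ := dich_aux hτ Z z0 hz0 hZ m hno m le_rfl
  set V := Submodule.span ℝ (Set.range w) with hV
  have hVr : Module.finrank ℝ V ≤ m := by
    have := finrank_range_le_card (R := ℝ) w
    rwa [Set.finrank, Fintype.card_fin] at this
  obtain ⟨ν, hνV, hν1⟩ : ∃ ν ∈ Vᗮ, ‖ν‖ = 1 := by
    have hne : Vᗮ ≠ ⊥ := by
      intro h
      have := Submodule.finrank_add_finrank_orthogonal V
      rw [h, finrank_bot, finrank_euclideanSpace_fin] at this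
      omega
    obtain ⟨x, hx, hx0⟩ := Submodule.exists_mem_ne_zero_of_ne_bot hne
    refine ⟨‖x‖⁻¹ • x, Submodule.smul_mem _ _ hx, ?_⟩
    rw [norm_smul, norm_inv, norm_norm, inv_mul_cancel₀ (norm_ne_zero_iff.mpr hx0)]
  have hdist : ∀ v ∈ V, τ ≤ ‖ν - v‖ := by
    intro v hv
    have h1 : inner ℝ (ν) (v) = 0 := Submodule.inner_left_of_mem_orthogonal hv hνV
    have h2 := norm_sub_sq_real ν v
    rw [h1, hν1] at h2
    have : 1 ≤ ‖ν - v‖ := by nlinarith [norm_nonneg (ν - v), sq_nonneg ‖v‖]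
    linarith
  have hpow : 1 ≤ (1 + 4/τ)^m := by
    apply one_le_pow₀
    have : 0 < 4 / τ := by positivity
    linarith
  have h2 : 1/τ ≤ 1/τ * (1 + 4/τ)^m := by
    have : 0 < 1/τ := by positivity
    nlinarith
  have hnd := nd_step hτ h2 w ν (by rw [hν1]; norm_num) hw2 hdist
  rw [mul_assoc, ← pow_succ] at hnd
  set W : Fin (m+1) → EuclideanSpace ℝ (Fin (m+1)) := Fin.snoc w ν with hW
  set Wm : Matrix (Fin (m+1)) (Fin (m+1)) ℝ := Matrix.of fun k i => W k i with hWm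
  have hdet : IsUnit Wm := by
    rw [← Matrix.vecMul_injective_iff_isUnit]
    have hlin : Function.Injective (Wm.vecMulLinear) := by
      rw [← LinearMap.ker_eq_bot, LinearMap.ker_eq_bot']
      intro a ha
      have : ∑ k, a k • W k = 0 := by
        ext i
        have := congrFun ha i
        simp only [Matrix.vecMulLinear_apply, Matrix.vecMul, dotProduct, hWm, Matrix.of_apply] at this
        simpa using this
      funext k
      have h := hnd a k
      rw [this, norm_zero, mul_zero] at h
      exact abs_nonpos_iff.mp h
    exact hlin
  have hdet' : IsUnit (Wmᵀ).det := by
    rw [Matrix.det_transpose]; exact (Matrix.isUnit_iff_isUnit_det _).mp hdet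
  set B := (Wmᵀ)⁻¹ with hB
  have hB1 : Wmᵀ * B = 1 := Matrix.mul_nonsing_inv _ hdet'
  have hB2 : B * Wmᵀ = 1 := Matrix.nonsing_inv_mul _ hdet'
  have hBw : ∀ i j, ∑ k, W k i * B k j = if i = j then 1 else 0 := by
    intro i j
    have := congrFun (congrFun hB1 i) j
    rw [Matrix.mul_apply, Matrix.one_apply] at this
    simpa [hWm] using this
  have hWnorm : ∀ k, ‖W k‖ ≤ 4 := by
    intro k
    refine Fin.lastCases ?_ (fun k => ?_) k
    · simp only [hW, Fin.snoc_last, hν1]; norm_num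
    · simp only [hW, Fin.snoc_castSucc]
      have a1 := hZ _ (hw1 k)
      have a2 := hZ _ hz0
      have : w k = (z0 + w k) - z0 := by simp
      rw [this]
      exact (norm_sub_le _ _).trans (by linarith)
  refine ⟨Fin.cons z0 (fun k => z0 + w k), fun k i => W k i, fun k j => B k j, ?_, ?_, ?_, ?_, ?_, hBw, ?_⟩
  · intro k
    refine Fin.cases ?_ (fun k => ?_) k
    · simpa using hz0
    · simpa using hw1 k
  · intro k i
    simp [hW]
  · have : ∑ i, (W (Fin.last m) i)^2 = ‖ν‖^2 := by
      rw [EuclideanSpace.norm_sq_eq]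
      simp [hW]
    rw [this, hν1]; norm_num
  · intro k j
    have := hnd (fun k => B k j) k
    have e : ∑ k, B k j • W k = EuclideanSpace.single j 1 := by
      ext i
      have := hBw i j
      simp only [WithLp.ofLp_sum, WithLp.ofLp_smul, Finset.sum_apply, Pi.smul_apply, smul_eq_mul]
      rw [Finset.sum_congr rfl fun k _ => mul_comm (B k j) (W k i), this]
      simp [Pi.single_apply]
    rw [e] at this
    simpa [bet] using this
  · intro k i
    exact (coord_le _ _).trans (hWnorm k)
  · have := congrFun (congrFun hB2 (Fin.last m)) (Fin.last m)
    rw [Matrix.mul_apply, Matrix.one_apply, if_pos rfl] at this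
    rw [← this]
    exact Finset.sum_congr rfl fun j _ => by simp [hWm, mul_comm]

lemma cover_of_map {E α : Type*} [PseudoMetricSpace E] {r : ℝ} (G : Set E) (f : E → α) (S : Finset α)
    (hf : ∀ y ∈ G, f y ∈ S) (hcl : ∀ y ∈ G, ∀ y' ∈ G, f y = f y' → dist y y' ≤ r) :
    ∃ F : Finset E, (↑F ⊆ G) ∧ F.card ≤ S.card ∧ ∀ y ∈ G, ∃ x ∈ F, dist y x ≤ r := by
  classical
  rcases G.eq_empty_or_nonempty with rfl | ⟨y0, _⟩
  · exact ⟨∅, by simp, by simp, by simp⟩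
  have hne : Nonempty E := ⟨y0⟩
  choose! g hg using fun a (h : a ∈ f '' G) => h
  have hfin : (f '' G).Finite := S.finite_toSet.subset (by rintro _ ⟨y, hy, rfl⟩; exact hf y hy)
  refine ⟨hfin.toFinset.image g, ?_, ?_, ?_⟩
  · intro x hx
    simp only [Finset.coe_image, Set.Finite.coe_toFinset] at hx
    obtain ⟨a, ha, rfl⟩ := hx
    exact (hg a ha).1
  · refine Finset.card_image_le.trans (Finset.card_le_card ?_)
    intro a ha
    rw [Set.Finite.mem_toFinset] at ha
    obtain ⟨y, hy, rfl⟩ := ha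
    exact hf y hy
  · intro y hy
    have h := hg (f y) ⟨y, hy, rfl⟩
    refine ⟨g (f y), ?_, hcl y hy _ h.1 h.2.symm⟩
    rw [Finset.mem_image]
    exact ⟨f y, by rw [Set.Finite.mem_toFinset]; exact ⟨y, hy, rfl⟩, rfl⟩

theorem cover_plane {E : Type*} [NormedAddCommGroup E] [InnerProductSpace ℝ E] {τ : ℝ} (hτ : 0 < τ)
    (hτ1 : τ ≤ 1) (V : Submodule ℝ E) [Module.Finite ℝ V] (z0 : E) (hz0 : ‖z0‖ ≤ 2) (G : Set E)
    (hG : ∀ y ∈ G, ‖y‖ ≤ 1) (hGV : ∀ y ∈ G, ∃ v ∈ V, ‖y - z0 - v‖ ≤ 2 * τ) :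
    ∃ F : Finset E, (↑F ⊆ G) ∧ (F.card : ℝ) ≤ (13 / τ) ^ (Module.finrank ℝ V) ∧
      ∀ y ∈ G, ∃ x ∈ F, dist y x ≤ (Module.finrank ℝ V + 4) * τ := by
  classical
  set k := Module.finrank ℝ V with hk
  let e := stdOrthonormalBasis ℝ V
  choose! v hv using hGV
  set v' : E → V := fun y => if h : v y ∈ V then ⟨v y, h⟩ else 0 with hv'
  have hv'e : ∀ y ∈ G, (v' y : E) = v y := fun y hy => by simp [hv', (hv y hy).1]
  set M : ℤ := ⌈5/τ⌉ with hM
  set f : E → (Fin k → ℤ) := fun y i => ⌊inner ℝ (e i) (v' y) / τ⌋ with hf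
  have H1 : ∀ y ∈ G, f y ∈ (Fintype.piFinset fun _ : Fin k => Finset.Icc (-M) M) := by
    intro y hy
    rw [Fintype.mem_piFinset]
    intro i
    have hvn : ‖v y‖ ≤ 5 := by
      have : v y = y - z0 - (y - z0 - v y) := by abel
      rw [this]
      refine (norm_sub_le _ _).trans ?_
      have := norm_sub_le y z0
      linarith [(hv y hy).2, hG y hy]
    have h1 : |inner ℝ (e i) (v' y)| ≤ 5 := by
      refine (abs_real_inner_le_norm _ _).trans ?_
      rw [e.norm_eq_one, one_mul, Submodule.coe_norm, hv'e y hy]; exact hvn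
    rw [abs_le] at h1
    have hMle : 5/τ ≤ M := Int.le_ceil _
    rw [Finset.mem_Icc]
    constructor
    · rw [Int.le_floor]; push_cast
      have : -5/τ ≤ inner ℝ (e i) (v' y) / τ := by gcongr; exact h1.1
      have : -5/τ = -(5/τ) := by ring
      linarith
    · have : (⌊inner ℝ (e i) (v' y) / τ⌋ : ℝ) ≤ M := by
        refine (Int.floor_le _).trans ?_
        have : inner ℝ (e i) (v' y) / τ ≤ 5/τ := by gcongr; exact h1.2
        linarith
      exact_mod_cast this
  have H2 : ∀ y ∈ G, ∀ y' ∈ G, f y = f y' → dist y y' ≤ (k + 4) * τ := by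
    intro y hy y' hy' hyy
    have h1 : ∀ i, |inner ℝ (e i) (v' y - v' y')| ≤ τ := by
      intro i
      have h2 := congrFun hyy i
      have h3 := Int.abs_sub_lt_one_of_floor_eq_floor h2
      rw [← sub_div, abs_div, abs_of_pos hτ, div_lt_one hτ] at h3
      rw [inner_sub_right]; exact h3.le
    have h2 : ‖v' y - v' y'‖ ≤ k * τ := by
      rw [← e.sum_repr (v' y - v' y')]
      refine (norm_sum_le _ _).trans ?_
      refine (Finset.sum_le_sum (g := fun _ => τ) fun i _ => ?_).trans ?_
      · rw [norm_smul, e.norm_eq_one, mul_one, e.repr_apply_apply]; exact h1 i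
      · simp [hk]
    rw [Submodule.coe_norm, Submodule.coe_sub, hv'e y hy, hv'e y' hy'] at h2
    have h3 : y - y' = (y - z0 - v y) - (y' - z0 - v y') + (v y - v y') := by abel
    rw [dist_eq_norm, h3]
    refine (norm_add_le _ _).trans ?_
    have := norm_sub_le (y - z0 - v y) (y' - z0 - v y')
    linarith [(hv y hy).2, (hv y' hy').2]
  obtain ⟨F, hF1, hF2, hF3⟩ := cover_of_map (r := (k + 4) * τ) G f (Fintype.piFinset fun _ : Fin k => Finset.Icc (-M) M) H1 H2
  refine ⟨F, hF1, ?_, hF3⟩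
  have h1 : (F.card : ℝ) ≤ ((Fintype.piFinset fun _ : Fin k => Finset.Icc (-M) M).card : ℝ) := by exact_mod_cast hF2
  refine h1.trans ?_
  rw [Fintype.card_piFinset]
  simp only [Int.card_Icc, Finset.prod_const, Finset.card_univ, Fintype.card_fin]
  push_cast
  apply pow_le_pow_left₀ (by positivity)
  have hM0 : (0:ℤ) ≤ M := Int.ceil_nonneg (by positivity)
  have h2 : (((M + 1 - -M).toNat : ℕ) : ℝ) = 2 * M + 1 := by
    have : (((M + 1 - -M).toNat : ℕ) : ℤ) = 2 * M + 1 := by omega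
    exact_mod_cast this
  rw [h2]
  have h3 : (M : ℝ) < 5/τ + 1 := Int.ceil_lt_add_one _
  have h4 : 1 ≤ 1/τ := by rw [le_div_iff₀ hτ]; linarith
  have h5 : 13/τ = 2 * (5/τ) + 3 * (1/τ) := by ring
  rw [h5]; linarith

end geom
end PoS

namespace PoS
section content

variable {n : ℕ}

noncomputable def hcO (n : ℕ) (s : ℝ) (hs : 0 < s) : OuterMeasure (EuclideanSpace ℝ (Fin n)) :=
  OuterMeasure.ofFunction (fun U => EMetric.diam U ^ s) (by
    show Metric.ediam (∅ : Set (EuclideanSpace ℝ (Fin n))) ^ s = 0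
    simp [hs])

lemma hcO_apply (s : ℝ) (hs : 0 < s) (A : Set (EuclideanSpace ℝ (Fin n))) :
    hcO n s hs A = hausdorffContent s A := by
  unfold hcO hausdorffContent
  rw [OuterMeasure.ofFunction_apply]

lemma hc_mono {s : ℝ} (hs : 0 < s) {A B : Set (EuclideanSpace ℝ (Fin n))} (h : A ⊆ B) :
    hausdorffContent s A ≤ hausdorffContent s B := by
  rw [← hcO_apply s hs, ← hcO_apply s hs]; exact measure_mono h

lemma hc_empty {s : ℝ} (hs : 0 < s) :
    hausdorffContent s (∅ : Set (EuclideanSpace ℝ (Fin n))) = 0 := by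
  rw [← hcO_apply s hs]; exact measure_empty

lemma hc_union {s : ℝ} (hs : 0 < s) (A B : Set (EuclideanSpace ℝ (Fin n))) :
    hausdorffContent s (A ∪ B) ≤ hausdorffContent s A + hausdorffContent s B := by
  rw [← hcO_apply s hs, ← hcO_apply s hs, ← hcO_apply s hs]; exact measure_union_le _ _

lemma hc_cover {s : ℝ} (hs : 0 < s) {G : Set (EuclideanSpace ℝ (Fin n))}
    (F : Finset (EuclideanSpace ℝ (Fin n))) (r b K : ℝ) (hb : 0 ≤ b)
    (hF : ∀ y ∈ G, ∃ x ∈ F, dist y x ≤ r) (hK : (F.card : ℝ) ≤ K)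
    (h : ∀ x ∈ F, hausdorffContent s (G ∩ closedBall x r) ≤ ENNReal.ofReal b) :
    hausdorffContent s G ≤ ENNReal.ofReal (K * b) := by
  have h1 : G ⊆ ⋃ x ∈ F, (G ∩ closedBall x r) := by
    intro y hy
    obtain ⟨x, hx, hxy⟩ := hF y hy
    simp only [Set.mem_iUnion]
    exact ⟨x, hx, hy, hxy⟩
  have h2 : hausdorffContent s G ≤ ∑ x ∈ F, hausdorffContent s (G ∩ closedBall x r) := by
    refine (hc_mono hs h1).trans ?_
    simp only [← hcO_apply s hs]
    exact measure_biUnion_finset_le _ _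
  refine h2.trans ((Finset.sum_le_sum h).trans ?_)
  rw [Finset.sum_const, nsmul_eq_mul, ENNReal.ofReal_mul ((Nat.cast_nonneg _).trans hK)]
  gcongr
  rw [← ENNReal.ofReal_natCast]
  exact ENNReal.ofReal_le_ofReal hK

lemma hc_ball {s : ℝ} (hs : 0 < s) (x : EuclideanSpace ℝ (Fin n)) {t : ℝ} (ht : 0 ≤ t) :
    hausdorffContent s (closedBall x t) ≤ ENNReal.ofReal ((2*t)^s) := by
  rw [← hcO_apply s hs]
  refine (OuterMeasure.ofFunction_le _).trans ?_
  rw [← ENNReal.ofReal_rpow_of_nonneg (by positivity) hs.le]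
  apply ENNReal.rpow_le_rpow _ hs.le
  refine Metric.ediam_le_of_forall_dist_le ?_
  intro y hy z hz
  have := dist_triangle_right y z x
  rw [mem_closedBall] at hy hz
  linarith

end content

section bad

lemma badcover (m : ℕ) (hm : 1 ≤ m) {τ R ρ : ℝ} (hτ : 0 < τ) (hτ1 : τ ≤ 1) (hR : 3 ≤ R) (hρ : 0 < ρ)
    (hρ1 : ρ < 1)
    (key : ∀ N : ℝ, 1/2 ≤ N → ∀ P : MvPolynomial (Fin (m+1)) ℝ, HarmP P → 0 < SS P 0 1 →
      SS P 0 R ≤ R^N * SS P 0 1 → SS P 0 3 ≤ 3^N * SS P 0 1 →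
      ∀ z w B : Fin (m+1) → Fin (m+1) → ℝ, (∀ k i, |z k i| ≤ 2) →
      (∀ k, SS P (z k) ρ ≤ ρ^((1 - 1/(4*((m:ℝ)+1)))*N) * SS P (z k) 1) →
      (∀ (k : Fin m) i, w k.castSucc i = z k.succ i - z 0 i) →
      (∑ i, (w (Fin.last m) i)^2 ≤ 1) → (∀ k j, |B k j| ≤ bet m τ) → (∀ k i, |w k i| ≤ 4) →
      (∀ i j, ∑ k, w k i * B k j = if i = j then 1 else 0) →
      (∑ j, w (Fin.last m) j * B (Fin.last m) j = 1) → False)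
    {N : ℝ} (hN : 1/2 ≤ N) {P : MvPolynomial (Fin (m+1)) ℝ} (hP : HarmP P)
    (x : EuclideanSpace ℝ (Fin (m+1))) {t : ℝ} (ht : 0 < t) (hS : 0 < SS P x.ofLp t)
    (hSL : SL P x.ofLp (R*t) N) (G : Set (EuclideanSpace ℝ (Fin (m+1))))
    (hG : ∀ y ∈ G, dist y x ≤ t ∧ ∃ z : EuclideanSpace ℝ (Fin (m+1)), dist z y ≤ τ * t ∧
      dist z x ≤ 2 * t ∧ ¬ SL P z.ofLp (ρ*t) ((1 - 1/(4*((m:ℝ)+1)))*N)) :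
    ∃ F : Finset (EuclideanSpace ℝ (Fin (m+1))), (↑F ⊆ G) ∧ (F.card : ℝ) ≤ (13/τ)^(m-1) ∧
      ∀ y ∈ G, ∃ y' ∈ F, dist y y' ≤ ((m + 3) * τ) * t := by
  classical
  set ε : ℝ := 1/(4*((m:ℝ)+1)) with hε
  rcases G.eq_empty_or_nonempty with rfl | ⟨y0, hy0⟩
  · exact ⟨∅, by simp, by simp; positivity, by simp⟩
  set Z : Set (EuclideanSpace ℝ (Fin (m+1))) :=
    {ζ | ‖ζ‖ ≤ 2 ∧ ¬ SL P (x + t • ζ).ofLp (ρ*t) ((1 - ε)*N)} with hZ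
  have back : ∀ z : EuclideanSpace ℝ (Fin (m+1)), x + t • (t⁻¹ • (z - x)) = z := by
    intro z; rw [smul_smul, mul_inv_cancel₀ ht.ne', one_smul]; abel
  have nrm : ∀ z : EuclideanSpace ℝ (Fin (m+1)), ‖t⁻¹ • (z - x)‖ = dist z x / t := by
    intro z; rw [norm_smul, norm_inv, Real.norm_eq_abs, abs_of_pos ht, dist_eq_norm]; ring
  have hGZ : ∀ y ∈ G, ∃ ζ ∈ Z, ‖t⁻¹ • (y - x) - ζ‖ ≤ τ := by
    intro y hy
    obtain ⟨_, z, h1, h2, h3⟩ := hG y hy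
    refine ⟨t⁻¹ • (z - x), ⟨?_, ?_⟩, ?_⟩
    · rw [nrm, div_le_iff₀ ht]; exact h2
    · rw [back]; exact h3
    · rw [← smul_sub, sub_sub_sub_cancel_right, norm_smul, norm_inv, Real.norm_eq_abs, abs_of_pos ht,
        ← dist_eq_norm, dist_comm, inv_mul_le_iff₀ ht, mul_comm]
      exact h1
  obtain ⟨z0, hz0, _⟩ := hGZ y0 hy0
  by_cases hV : ∃ V : Submodule ℝ (EuclideanSpace ℝ (Fin (m+1))), Module.Finite ℝ V ∧
      Module.finrank ℝ V + 1 ≤ m ∧ ∀ y ∈ Z, ∃ v ∈ V, ‖y - z0 - v‖ < τ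
  · obtain ⟨V, hVf, hVr, hVd⟩ := hV
    obtain ⟨F, hF1, hF2, hF3⟩ := cover_plane hτ hτ1 V z0 hz0.1 ((fun y => t⁻¹ • (y - x)) '' G)
      (by
        rintro _ ⟨y, hy, rfl⟩
        simp only []
        rw [nrm, div_le_iff₀ ht, one_mul]; exact (hG y hy).1)
      (by
        rintro _ ⟨y, hy, rfl⟩
        obtain ⟨ζ, hζ, h1⟩ := hGZ y hy
        obtain ⟨v, hv, h2⟩ := hVd ζ hζ
        refine ⟨v, hv, ?_⟩
        have : t⁻¹ • (y - x) - z0 - v = (t⁻¹ • (y - x) - ζ) + (ζ - z0 - v) := by abel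
        simp only []
        rw [this]
        exact (norm_add_le _ _).trans (by linarith))
    have h13 : 1 ≤ 13/τ := by rw [le_div_iff₀ hτ]; linarith
    refine ⟨F.image (fun ζ => x + t • ζ), ?_, ?_, ?_⟩
    · intro y hy
      simp only [Finset.coe_image, Set.mem_image, Finset.mem_coe] at hy
      obtain ⟨ζ, hζ, rfl⟩ := hy
      obtain ⟨y, hy, rfl⟩ := hF1 hζ
      simp only [back]; exact hy
    · have : ((F.image (fun ζ => x + t • ζ)).card : ℝ) ≤ F.card := by exact_mod_cast Finset.card_image_le
      refine this.trans (hF2.trans ?_)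
      exact pow_le_pow_right₀ h13 (by omega)
    · intro y hy
      obtain ⟨ζ, hζ, h1⟩ := hF3 _ ⟨y, hy, rfl⟩
      refine ⟨x + t • ζ, Finset.mem_image_of_mem _ hζ, ?_⟩
      have e : y - (x + t • ζ) = t • (t⁻¹ • (y - x) - ζ) := by
        rw [smul_sub, smul_smul, mul_inv_cancel₀ ht.ne', one_smul]; abel
      rw [dist_eq_norm, e, norm_smul, Real.norm_eq_abs, abs_of_pos ht, mul_comm]
      apply mul_le_mul_of_nonneg_right _ ht.le
      rw [dist_eq_norm] at h1
      refine h1.trans (mul_le_mul_of_nonneg_right ?_ hτ.le)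
      have : (Module.finrank ℝ V : ℝ) + 1 ≤ m := by exact_mod_cast hVr
      linarith
  · exfalso
    obtain ⟨z, w, B, h1, h2, h3, h4, h5, h6, h7⟩ := dichotomy m hτ hτ1 Z z0 hz0 (fun y hy => hy.1) hV
    have hSS0 : ∀ r, SS (rsc x.ofLp t P) 0 r = t * SS P x.ofLp (t*r) := by
      intro r; rw [SS_rsc ht]; simp
    refine key N hN (rsc x.ofLp t P) (hP.rsc _ _) ?_ ?_ ?_ (fun k => (z k).ofLp) w B ?_ ?_ h2 h3 h4 h5 h6 h7
    · rw [hSS0, mul_one]; positivity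
    · rw [hSS0, hSS0, mul_one]
      have := hSL.growth ht (by linarith)
      rw [mul_comm t R]
      nlinarith
    · rw [hSS0, hSS0, mul_one]
      have := (hSL.mono (ρ := 3 * t) (by positivity) (by gcongr)).growth ht (by norm_num)
      rw [mul_comm t 3]
      nlinarith
    · intro k i
      exact (coord_le _ _).trans (h1 k).1
    · intro k
      rw [SS_rsc ht, SS_rsc ht, mul_one]
      have := SL.not_growth (by positivity) (l := 1/ρ) (by rw [le_div_iff₀ hρ]; linarith) (h1 k).2
      rw [show 1/ρ * (ρ * t) = t by field_simp, one_div, Real.inv_rpow hρ.le,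
        inv_mul_le_iff₀ (by positivity)] at this
      simp only [WithLp.ofLp_add, WithLp.ofLp_smul] at this
      rw [mul_comm t ρ]
      nlinarith

end bad
end PoS

namespace PoS
section loc

lemma ballcover (n : ℕ) {r : ℝ} (hr : 0 < r) (hr1 : r ≤ 1) : ∃ K : ℝ, 0 < K ∧
    ∀ (x : EuclideanSpace ℝ (Fin n)) (t : ℝ), 0 < t → ∀ G : Set (EuclideanSpace ℝ (Fin n)),
    (∀ y ∈ G, dist y x ≤ t) → ∃ F : Finset (EuclideanSpace ℝ (Fin n)), (↑F ⊆ G) ∧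
      (F.card : ℝ) ≤ K ∧ ∀ y ∈ G, ∃ y' ∈ F, dist y y' ≤ r * t := by
  classical
  set V : Submodule ℝ (EuclideanSpace ℝ (Fin n)) := ⊤ with hV
  set τ : ℝ := r / (Module.finrank ℝ V + 4) with hτ
  have hτ0 : 0 < τ := by positivity
  have hτ1 : τ ≤ 1 := by
    rw [hτ, div_le_one (by positivity)]
    have : (0:ℝ) ≤ Module.finrank ℝ V := by positivity
    linarith
  refine ⟨(13/τ)^(Module.finrank ℝ V), by positivity, ?_⟩
  intro x t ht G hG
  have nrm : ∀ z : EuclideanSpace ℝ (Fin n), ‖t⁻¹ • (z - x)‖ = dist z x / t := by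
    intro z; rw [norm_smul, norm_inv, Real.norm_eq_abs, abs_of_pos ht, dist_eq_norm]; ring
  have back : ∀ z : EuclideanSpace ℝ (Fin n), x + t • (t⁻¹ • (z - x)) = z := by
    intro z; rw [smul_smul, mul_inv_cancel₀ ht.ne', one_smul]; abel
  obtain ⟨F, hF1, hF2, hF3⟩ := cover_plane hτ0 hτ1 V 0 (by simp) ((fun y => t⁻¹ • (y - x)) '' G)
      (by
        rintro _ ⟨y, hy, rfl⟩
        simp only []
        rw [nrm, div_le_iff₀ ht, one_mul]; exact hG y hy)
      (by
        rintro _ ⟨y, hy, rfl⟩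
        refine ⟨t⁻¹ • (y - x), trivial, ?_⟩
        simp only [sub_zero, sub_self, norm_zero]; positivity)
  refine ⟨F.image (fun ζ => x + t • ζ), ?_, ?_, ?_⟩
  · intro y hy
    simp only [Finset.coe_image, Set.mem_image, Finset.mem_coe] at hy
    obtain ⟨ζ, hζ, rfl⟩ := hy
    obtain ⟨y, hy, rfl⟩ := hF1 hζ
    simp only [back]; exact hy
  · have : ((F.image (fun ζ => x + t • ζ)).card : ℝ) ≤ F.card := by exact_mod_cast Finset.card_image_le
    exact this.trans hF2
  · intro y hy
    obtain ⟨ζ, hζ, h1⟩ := hF3 _ ⟨y, hy, rfl⟩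
    refine ⟨x + t • ζ, Finset.mem_image_of_mem _ hζ, ?_⟩
    have e : y - (x + t • ζ) = t • (t⁻¹ • (y - x) - ζ) := by
      rw [smul_sub, smul_smul, mul_inv_cancel₀ ht.ne', one_smul]; abel
    rw [dist_eq_norm, e, norm_smul, Real.norm_eq_abs, abs_of_pos ht, mul_comm]
    apply mul_le_mul_of_nonneg_right _ ht.le
    rw [dist_eq_norm] at h1
    refine h1.trans (le_of_eq ?_)
    rw [hτ]; field_simp

lemma coord_dist {n : ℕ} {x y : EuclideanSpace ℝ (Fin n)} {t : ℝ} (h : dist y x ≤ t) (i : Fin n) :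
    |y.ofLp i - x.ofLp i| ≤ t := by
  rw [dist_eq_norm] at h
  exact (coord_le (y - x) i).trans h

lemma ss_shift {n : ℕ} {P : MvPolynomial (Fin n) ℝ} {x y : EuclideanSpace ℝ (Fin n)} {r h : ℝ}
    (hr : 0 ≤ r) (hxy : dist y x ≤ h) : SS P y.ofLp r ≤ SS P x.ofLp (r+h) :=
  SS_shift hr (coord_dist hxy)

lemma ss_trans {n : ℕ} {P : MvPolynomial (Fin n) ℝ} {x y : EuclideanSpace ℝ (Fin n)} {t l R N : ℝ}
    (ht : 0 < t) (hl : 0 < l) (hl1 : l ≤ 1) (hR : 2 ≤ R) (hyx : dist y x ≤ t)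
    (hSL : SL P y.ofLp (R*t) N) : SS P x.ofLp t ≤ (2/l)^N * SS P y.ofLp (l*t) := by
  rw [dist_comm] at hyx
  have h1 := ss_shift (P := P) ht.le hyx
  have h2 : (2/l) * (l * t) = t + t := by field_simp; ring
  have h3 := SL.growth (P := P) (z := y.ofLp) (N := N) (ρ := l*t) (l := 2/l) (by positivity)
    (by rw [le_div_iff₀ hl]; linarith) (by
      rw [h2]; exact hSL.mono (by positivity) (by nlinarith))
  rw [h2] at h3
  exact h1.trans h3

lemma ss_trans_exp {n : ℕ} {P : MvPolynomial (Fin n) ℝ} {x y : EuclideanSpace ℝ (Fin n)} {t l R N : ℝ}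
    (ht : 0 < t) (hl : 0 < l) (hl1 : l ≤ 1) (hR : 2 ≤ R) (hyx : dist y x ≤ t)
    (hSL : SL P y.ofLp (R*t) N) (A : ℝ) :
    Real.exp (-A*N) * SS P x.ofLp t ≤ Real.exp (-(A - Real.log (2/l)) * N) * SS P y.ofLp (l*t) := by
  have h := ss_trans ht hl hl1 hR hyx hSL
  rw [Real.rpow_def_of_pos (by positivity)] at h
  have : Real.exp (-(A - Real.log (2/l)) * N) = Real.exp (-A*N) * Real.exp (Real.log (2/l) * N) := by
    rw [← Real.exp_add]; ring_nf
  rw [this, mul_assoc]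
  exact mul_le_mul_of_nonneg_left h (Real.exp_nonneg _)

def LocAt (m : ℕ) (s R C0 β N A : ℝ) : Prop :=
  ∀ P : MvPolynomial (Fin (m+1)) ℝ, HarmP P → ∀ (x : EuclideanSpace ℝ (Fin (m+1))) (t : ℝ), 0 < t →
    0 < SS P x.ofLp t → (∀ z : EuclideanSpace ℝ (Fin (m+1)), dist z x ≤ 2*t → SL P z.ofLp (R*t) N) →
    hausdorffContent s {y : EuclideanSpace ℝ (Fin (m+1)) | dist y x ≤ t ∧
      gr P y.ofLp ≤ Real.exp (-A*N) * SS P x.ofLp t} ≤ ENNReal.ofReal (C0 * Real.exp (-β*A) * t^s)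

lemma tau_exists (m : ℕ) (hm : 1 ≤ m) {δ : ℝ} (hδ : 0 < δ) : ∃ τ : ℝ, 0 < τ ∧ τ ≤ 1 ∧
    ((m:ℝ)+3)*τ ≤ 1/2 ∧ (13/τ)^(m-1) * (((m:ℝ)+3)*τ)^((m:ℝ)-1+δ) ≤ 1/4 := by
  have e : ∀ τ : ℝ, 0 < τ → (13/τ)^(m-1) * (((m:ℝ)+3)*τ)^((m:ℝ)-1+δ) =
      (13^(m-1) * ((m:ℝ)+3)^((m:ℝ)-1+δ)) * τ^δ := by
    intro τ hτ
    rw [Real.mul_rpow (by positivity) hτ.le, div_pow, Real.rpow_add hτ, ← Nat.cast_pred hm, Real.rpow_natCast]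
    field_simp
  have h1 : Filter.Tendsto (fun τ : ℝ => (13^(m-1) * ((m:ℝ)+3)^((m:ℝ)-1+δ)) * τ^δ)
      (nhdsWithin 0 (Set.Ioi 0)) (nhds 0) := by
    have : Filter.Tendsto (fun τ : ℝ => (13^(m-1) * ((m:ℝ)+3)^((m:ℝ)-1+δ)) * τ^δ)
      (nhds 0) (nhds ((13^(m-1) * ((m:ℝ)+3)^((m:ℝ)-1+δ)) * (0:ℝ)^δ)) :=
      ((Real.continuousAt_rpow_const 0 δ (Or.inr hδ.le)).tendsto).const_mul _
    rw [Real.zero_rpow hδ.ne', mul_zero] at this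
    exact this.mono_left nhdsWithin_le_nhds
  have h2 := h1.eventually (gt_mem_nhds (show (0:ℝ) < 1/4 by norm_num))
  have h3 : ∀ᶠ τ : ℝ in nhdsWithin 0 (Set.Ioi 0), τ < 1/(2*((m:ℝ)+3)) :=
    nhdsWithin_le_nhds (gt_mem_nhds (by positivity))
  obtain ⟨τ, ⟨h4, h5⟩, h6⟩ := ((h2.and h3).and self_mem_nhdsWithin).exists
  have h6 : 0 < τ := h6
  rw [lt_div_iff₀ (by positivity)] at h5
  have hm0 : (0:ℝ) ≤ m := by positivity
  refine ⟨τ, h6, ?_, ?_, ?_⟩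
  · nlinarith
  · nlinarith
  · rw [e τ h6]; exact h4.le

set_option maxHeartbeats 4000000 in
theorem loc (m : ℕ) (hm : 1 ≤ m) {δ : ℝ} (hδ : 0 < δ) : ∃ R C0 β : ℝ, 3 ≤ R ∧ 0 < C0 ∧ 0 < β ∧
    ∀ (k : ℕ) (A : ℝ), LocAt m ((m:ℝ)-1+δ) R C0 β ((1/2) * ((1 - 1/(4*((m:ℝ)+1)))⁻¹)^k) A := by
  obtain ⟨τ, hτ, hτ1, hτ2, hτ3⟩ := tau_exists m hm hδ
  obtain ⟨R, ρ, hR, hρ, hρ1, hρτ, key⟩ := key_unit m (bet_ge hτ hτ1 (m := m)) hτ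
  set s : ℝ := (m:ℝ)-1+δ with hs
  have hs0 : 0 < s := by
    have : (1:ℝ) ≤ m := by exact_mod_cast hm
    rw [hs]; linarith
  set ε : ℝ := 1/(4*((m:ℝ)+1)) with hε
  have hε0 : 0 < ε := by positivity
  have hε1 : ε ≤ 1/4 := by
    rw [hε, div_le_div_iff₀ (by positivity) (by norm_num)]
    have : (0:ℝ) ≤ m := by positivity
    linarith
  set τ' : ℝ := (m+3)*τ with hτ'
  have hτ'0 : 0 < τ' := by positivity
  set c : ℝ := Real.log (2/τ') with hc
  have hc0 : 0 < c := Real.log_pos (by rw [lt_div_iff₀ hτ'0]; linarith)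
  set β : ℝ := Real.log 2 / c with hβ
  have hlog2 : 0 < Real.log 2 := Real.log_pos (by norm_num)
  have hβ0 : 0 < β := by positivity
  have hβc : β * c = Real.log 2 := by rw [hβ]; field_simp
  set r : ℝ := ρ / R with hr
  have hR0 : 0 < R := by linarith
  have hr0 : 0 < r := by positivity
  have hRr : R * r = ρ := by rw [hr]; field_simp
  have hr2 : 2 * r ≤ τ := by
    have := mul_le_mul_of_nonneg_right hR hr0.le
    linarith
  have hr1 : r ≤ 1 := by linarith
  obtain ⟨K, hK, hcov⟩ := ballcover (m+1) hr0 hr1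
  obtain ⟨a, ha0, ha⟩ : ∃ a : ℝ, 0 ≤ a ∧ K * r^s * Real.exp (-β*a) ≤ 1/2 := by
    refine ⟨|Real.log (2*(K*r^s))| / β, by positivity, ?_⟩
    have h1 : -β * (|Real.log (2*(K*r^s))| / β) = -|Real.log (2*(K*r^s))| := by field_simp
    have h2 : Real.exp (-|Real.log (2*(K*r^s))|) ≤ (2*(K*r^s))⁻¹ := by
      rw [Real.exp_neg]
      apply inv_anti₀ (by positivity)
      calc 2*(K*r^s) = Real.exp (Real.log (2*(K*r^s))) := (Real.exp_log (by positivity)).symm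
        _ ≤ _ := Real.exp_le_exp.mpr (le_abs_self _)
    rw [h1]
    calc _ ≤ K * r^s * (2*(K*r^s))⁻¹ := by gcongr
      _ = 1/2 := by field_simp
  set L : ℝ := Real.log (2/r) with hL
  have hL0 : 0 < L := Real.log_pos (by rw [lt_div_iff₀ hr0]; linarith)
  set A0 : ℝ := (2 + L + a)/ε with hA0
  have hA02 : 2 ≤ A0 := by rw [hA0, le_div_iff₀ hε0]; linarith
  have hA0ε : A0 * ε = 2 + L + a := by rw [hA0]; field_simp
  set C0 : ℝ := 2^s * Real.exp (β*A0) with hC0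
  have hC00 : 0 < C0 := by positivity
  have triv : ∀ N A, A ≤ A0 → LocAt m s R C0 β N A := by
    intro N A hA P hP x t ht hS hSL
    refine (hc_mono hs0 (B := closedBall x t) (fun y hy => hy.1)).trans ((hc_ball hs0 x ht.le).trans ?_)
    apply ENNReal.ofReal_le_ofReal
    rw [Real.mul_rpow (by norm_num) ht.le]
    apply mul_le_mul_of_nonneg_right _ (by positivity)
    rw [hC0, mul_assoc, ← Real.exp_add]
    have : 1 ≤ Real.exp (β * A0 + -β * A) := Real.one_le_exp (by
      have := mul_le_mul_of_nonneg_left hA hβ0.le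
      linarith)
    exact le_mul_of_one_le_right (by positivity) this
  refine ⟨R, C0, β, hR, hC00, hβ0, ?_⟩
  intro k
  induction k with
  | zero =>
    intro A
    rcases le_or_gt A A0 with hA | hA
    · exact triv _ A hA
    intro P hP x t ht hS hSL
    have : {y : EuclideanSpace ℝ (Fin (m+1)) | dist y x ≤ t ∧
      gr P y.ofLp ≤ Real.exp (-A*((1/2) * ((1 - ε)⁻¹)^0)) * SS P x.ofLp t} = ∅ := by
      rw [Set.eq_empty_iff_forall_notMem]
      rintro y ⟨hy1, hy2⟩
      have h1 : SL P y.ofLp (t+t) (1/2) := by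
        have := hSL y (by linarith)
        rw [pow_zero, mul_one] at this
        exact this.mono (by positivity) (by
          have := mul_le_mul_of_nonneg_right hR ht.le
          linarith)
      have h2 := h1.base (by positivity)
      have h3 := ss_shift (P := P) ht.le (dist_comm y x ▸ hy1)
      have h4 : Real.exp (-A*((1/2) * ((1 - ε)⁻¹)^0)) < 1/2 := by
        have : -A*((1/2) * ((1 - ε)⁻¹)^0) ≤ -1 := by rw [pow_zero]; linarith
        refine (Real.exp_le_exp.mpr this).trans_lt ?_
        have := Real.exp_one_gt_d9
        rw [Real.exp_neg, one_div]
        exact inv_strictAnti₀ (by norm_num) (by linarith)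
      have h5 := mul_lt_mul_of_pos_right h4 hS
      linarith
    rw [this, hc_empty hs0]; simp
  | succ k ih =>
    set N : ℝ := (1/2) * ((1 - ε)⁻¹)^(k+1) with hN
    have hN' : (1/2) * ((1 - ε)⁻¹)^k = (1 - ε) * N := by
      rw [hN, pow_succ]; field_simp [show (1:ℝ) - ε ≠ 0 by linarith]
    rw [hN'] at ih
    have hN2 : 1/2 ≤ N := by
      have : 1 ≤ ((1 - ε)⁻¹)^(k+1) := one_le_pow₀ ((one_le_inv₀ (by linarith)).mpr (by linarith))
      rw [hN]; linarith
    have inner : ∀ (j : ℕ) A, A ≤ A0 + j * c → LocAt m s R C0 β N A := by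
      intro j
      induction j with
      | zero => intro A hA; exact triv N A (by simpa using hA)
      | succ j ihj =>
        intro A hA
        rcases le_or_gt A A0 with hA' | hA'
        · exact triv _ A hA'
        intro P hP x t ht hS hSL
        set T : Set (EuclideanSpace ℝ (Fin (m+1))) := {y | dist y x ≤ t ∧
          gr P y.ofLp ≤ Real.exp (-A*N) * SS P x.ofLp t} with hT
        set Gd : Set (EuclideanSpace ℝ (Fin (m+1))) := {y | y ∈ T ∧ ∀ z : EuclideanSpace ℝ (Fin (m+1)),
          dist z y ≤ 2*(r*t) → SL P z.ofLp (ρ*t) ((1-ε)*N)} with hGd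
        have hSLy : ∀ y : EuclideanSpace ℝ (Fin (m+1)), dist y x ≤ t → SL P y.ofLp (R*t) N :=
          fun y hy => hSL y (by linarith)
        have bGood : hausdorffContent s Gd ≤ ENNReal.ofReal (K * (C0 * Real.exp (-β*(A+a)) * (r*t)^s)) := by
          obtain ⟨F, hF1, hF2, hF3⟩ := hcov x t ht Gd (fun y hy => hy.1.1)
          refine hc_cover hs0 F (r*t) _ K (by positivity) hF3 hF2 ?_
          intro y hy
          have hyG := hF1 hy
          have hSy : 0 < SS P y.ofLp (r*t) := by
            have := ss_trans ht hr0 hr1 (by linarith) hyG.1.1 (hSLy y hyG.1.1)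
            exact (pos_iff_pos_of_mul_pos (hS.trans_le this)).mp (by positivity)
          have h1 := ih ((A - L)/(1-ε)) P hP y (r*t) (by positivity) hSy (by
            intro z hz
            rw [← mul_assoc, hRr]
            exact hyG.2 z hz)
          refine (hc_mono hs0 ?_).trans (h1.trans (ENNReal.ofReal_le_ofReal ?_))
          · rintro y' ⟨hy'1, hy'2⟩
            refine ⟨hy'2, hy'1.1.2.trans ?_⟩
            have h2 := ss_trans_exp ht hr0 hr1 (by linarith) hyG.1.1 (hSLy y hyG.1.1) A
            rw [← hL] at h2
            have h3 : -((A - L)/(1-ε)) * ((1-ε)*N) = -(A-L)*N := by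
              field_simp [show (1:ℝ) - ε ≠ 0 by linarith]
            rw [h3]; exact h2
          · have h2 : A + a ≤ (A-L)/(1-ε) := by
              rw [le_div_iff₀ (by linarith)]
              have h3 := mul_le_mul_of_nonneg_right hA'.le hε0.le
              have h4 := mul_nonneg ha0 hε0.le
              linarith
            exact mul_le_mul_of_nonneg_right (mul_le_mul_of_nonneg_left
              (Real.exp_le_exp.mpr (by
                have := mul_le_mul_of_nonneg_left h2 hβ0.le
                linarith)) hC00.le) (by positivity)
        have bBad : hausdorffContent s (T \ Gd) ≤ ENNReal.ofReal ((13/τ)^(m-1) *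
            (C0 * Real.exp (-β*(A-c)) * (τ'*t)^s)) := by
          obtain ⟨F, hF1, hF2, hF3⟩ := badcover m hm hτ hτ1 hR hρ hρ1 key hN2 hP x ht hS
            (hSLy x (by rw [dist_self]; exact ht.le)) (T \ Gd) (by
              rintro y ⟨hy1, hy2⟩
              refine ⟨hy1.1, ?_⟩
              have : ∃ z : EuclideanSpace ℝ (Fin (m+1)),
                dist z y ≤ 2*(r*t) ∧ ¬ SL P z.ofLp (ρ*t) ((1-ε)*N) := by
                by_contra hcon
                push Not at hcon
                exact hy2 ⟨hy1, hcon⟩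
              obtain ⟨z, hz1, hz2⟩ := this
              have h5 := mul_le_mul_of_nonneg_right hr2 ht.le
              have h6 := mul_le_mul_of_nonneg_right hτ1 ht.le
              refine ⟨z, by linarith, ?_, hz2⟩
              have := dist_triangle z y x
              have := hy1.1
              linarith)
          refine hc_cover hs0 F (τ'*t) _ _ (by positivity) hF3 hF2 ?_
          intro y hy
          have hyG := (hF1 hy).1
          have hτ'1 : τ' ≤ 1 := by linarith
          have h6 := mul_le_mul_of_nonneg_right hτ2 ht.le
          have hSy : 0 < SS P y.ofLp (τ'*t) := by
            have := ss_trans ht hτ'0 hτ'1 (by linarith) hyG.1 (hSLy y hyG.1)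
            exact (pos_iff_pos_of_mul_pos (hS.trans_le this)).mp (by positivity)
          have h1 := ihj (A - c) (by push_cast at hA; linarith) P hP y (τ'*t) (by positivity) hSy (by
            intro z hz
            have h0 : dist z x ≤ 2*t := by
              have := dist_triangle z y x
              have := hyG.1
              linarith
            exact (hSL z h0).mono (by positivity) (by
              apply mul_le_mul_of_nonneg_left _ hR0.le
              linarith))
          refine (hc_mono hs0 ?_).trans h1
          rintro y' ⟨hy'1, hy'2⟩
          exact ⟨hy'2, hy'1.1.2.trans
            (ss_trans_exp ht hτ'0 hτ'1 (by linarith) hyG.1 (hSLy y hyG.1) A)⟩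
        have hTe : T ⊆ Gd ∪ (T \ Gd) := by
          intro y hy
          by_cases h : y ∈ Gd
          · exact Or.inl h
          · exact Or.inr ⟨hy, h⟩
        refine (hc_mono hs0 hTe).trans ((hc_union hs0 _ _).trans ((add_le_add bGood bBad).trans ?_))
        rw [← ENNReal.ofReal_add (by positivity) (by positivity)]
        apply ENNReal.ofReal_le_ofReal
        have e1 : K * (C0 * Real.exp (-β*(A+a)) * (r*t)^s) =
            (K * r^s * Real.exp (-β*a)) * (C0 * Real.exp (-β*A) * t^s) := by
          rw [Real.mul_rpow hr0.le ht.le, show -β*(A+a) = -β*a + -β*A by ring, Real.exp_add]; ring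
        have e2 : (13/τ)^(m-1) * (C0 * Real.exp (-β*(A-c)) * (τ'*t)^s) =
            ((13/τ)^(m-1) * τ'^s) * (2 * (C0 * Real.exp (-β*A) * t^s)) := by
          rw [Real.mul_rpow hτ'0.le ht.le, show -β*(A-c) = β*c + -β*A by ring, Real.exp_add, hβc,
            Real.exp_log (by norm_num)]; ring
        rw [e1, e2]
        have hX : 0 < C0 * Real.exp (-β*A) * t^s := by positivity
        have h5 := mul_le_mul_of_nonneg_right ha hX.le
        have h6 := mul_le_mul_of_nonneg_right hτ3 (mul_nonneg zero_le_two hX.le)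
        linarith
    intro A
    obtain ⟨j, hj⟩ := exists_nat_ge ((A - A0)/c)
    exact inner j A (by rw [div_le_iff₀ hc0] at hj; linarith)

end loc
end PoS

namespace PoS
section harm

open Filter Topology

lemma snd_max {φ φ1 : ℝ → ℝ} {c : ℝ} (h1 : ∀ᶠ s in 𝓝 0, HasDerivAt φ (φ1 s) s)
    (h2 : HasDerivAt φ1 c 0) (hmax : IsLocalMax φ 0) : c ≤ 0 := by
  by_contra hc
  push Not at hc
  have e1 : deriv φ =ᶠ[𝓝 0] φ1 := h1.mono fun s hs => hs.deriv
  have e2 : deriv (deriv φ) 0 = c := by rw [e1.deriv_eq]; exact h2.deriv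
  have hmin : IsLocalMin φ 0 := isLocalMin_of_deriv_deriv_pos (by rw [e2]; exact hc)
    hmax.deriv_eq_zero h1.self_of_nhds.continuousAt
  have e3 : φ =ᶠ[𝓝 0] fun _ => φ 0 := by
    filter_upwards [hmin, hmax] with s a b using le_antisymm b a
  have e4 : deriv (deriv φ) 0 = 0 := by
    rw [(e3.deriv).deriv_eq]; simp
  linarith

lemma snd_test {g g1 v v1 : ℝ → ℝ} {g2 v2 p q l : ℝ}
    (hg : ∀ᶠ s in 𝓝 0, HasDerivAt g (g1 s) s) (hv : ∀ᶠ s in 𝓝 0, HasDerivAt v (v1 s) s)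
    (hg1 : HasDerivAt g1 g2 0) (hv1 : HasDerivAt v1 v2 0)
    (hmax : IsLocalMax (fun s => (p - 2*q*s - s^2)^2 * (g s)^2 + l * (v s)^2) 0) :
    8*q^2*(g 0)^2 - 4*p*(g 0)^2 - 16*p*q*(g 0)*(g1 0) + 2*p^2*(g1 0)^2 + 2*p^2*(g 0)*g2
      + 2*l*(v1 0)^2 + 2*l*(v 0)*v2 ≤ 0 := by
  have hη : ∀ s : ℝ, HasDerivAt (fun s => p - 2*q*s - s^2) (-2*q - 2*s) s := by
    intro s
    have := ((hasDerivAt_id s).const_mul (2*q)).const_sub p |>.sub ((hasDerivAt_id s).pow 2)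
    refine HasDerivAt.congr_deriv this ?_
    simp; try ring
  have hη1 : HasDerivAt (fun s : ℝ => -2*q - 2*s) (-2) 0 := by
    have := ((hasDerivAt_id (0:ℝ)).const_mul 2).const_sub (-2*q)
    simpa using this
  refine snd_max (φ1 := fun s => 2*(p - 2*q*s - s^2)*(-2*q-2*s)*(g s)^2 +
    (p - 2*q*s - s^2)^2*(2*g s*g1 s) + l*(2*v s*v1 s)) ?_ ?_ hmax
  · filter_upwards [hg, hv] with s a b
    have := (((hη s).pow 2).mul (a.pow 2)).add ((b.pow 2).const_mul l)
    refine HasDerivAt.congr_deriv this ?_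
    simp; try ring
  · have a := hg.self_of_nhds
    have b := hv.self_of_nhds
    have := (((((hη 0).const_mul 2).mul hη1).mul (a.pow 2)).add
      (((hη 0).pow 2).mul ((a.const_mul 2).mul hg1))).add (((b.const_mul 2).mul hv1).const_mul l)
    refine HasDerivAt.congr_deriv this ?_
    simp; try ring

variable {n : ℕ}

noncomputable def pd (i : Fin n) (v : EuclideanSpace ℝ (Fin n) → ℝ) : EuclideanSpace ℝ (Fin n) → ℝ :=
  fun y => fderiv ℝ v y (EuclideanSpace.single i 1)

abbrev Sm (v : EuclideanSpace ℝ (Fin n) → ℝ) (U : Set (EuclideanSpace ℝ (Fin n))) : Prop :=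
  ContDiffOn ℝ (⊤ : ℕ∞) v U

lemma Sm.pd {v : EuclideanSpace ℝ (Fin n) → ℝ} {U : Set (EuclideanSpace ℝ (Fin n))} (hU : IsOpen U)
    (h : Sm v U) (i : Fin n) : Sm (pd i v) U := by
  have h1 : ContDiffOn ℝ (⊤ : ℕ∞) (fderiv ℝ v) U := h.fderiv_of_isOpen hU (by simp)
  exact h1.clm_apply contDiffOn_const

lemma Sm.diff {v : EuclideanSpace ℝ (Fin n) → ℝ} {U : Set (EuclideanSpace ℝ (Fin n))} (hU : IsOpen U)
    (h : Sm v U) {x : EuclideanSpace ℝ (Fin n)} (hx : x ∈ U) : DifferentiableAt ℝ v x :=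
  (h.contDiffAt (hU.mem_nhds hx)).differentiableAt (by simp)

lemma pd_congr {v w : EuclideanSpace ℝ (Fin n) → ℝ} {x : EuclideanSpace ℝ (Fin n)} (i : Fin n)
    (h : v =ᶠ[𝓝 x] w) : pd i v =ᶠ[𝓝 x] pd i w :=
  (Filter.EventuallyEq.fderiv (𝕜 := ℝ) h).mono fun y hy => by simp only [pd, hy]

lemma pd_comm {v : EuclideanSpace ℝ (Fin n) → ℝ} {U : Set (EuclideanSpace ℝ (Fin n))} (hU : IsOpen U)
    (h : Sm v U) (i j : Fin n) {x : EuclideanSpace ℝ (Fin n)} (hx : x ∈ U) :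
    pd i (pd j v) x = pd j (pd i v) x := by
  have h1 : ContDiffOn ℝ (⊤ : ℕ∞) (fderiv ℝ v) U := h.fderiv_of_isOpen hU (by simp)
  have h2 : DifferentiableAt ℝ (fderiv ℝ v) x :=
    (h1.contDiffAt (hU.mem_nhds hx)).differentiableAt (by simp)
  have h3 : ∀ i j, pd i (pd j v) x =
      fderiv ℝ (fderiv ℝ v) x (EuclideanSpace.single i 1) (EuclideanSpace.single j 1) := by
    intro i j
    unfold pd
    rw [fderiv_clm_apply h2 (differentiableAt_const _)]
    simp
  rw [h3, h3]
  have h4 : IsSymmSndFDerivAt ℝ v x := (h.contDiffAt (hU.mem_nhds hx)).isSymmSndFDerivAt (by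
    rw [minSmoothness_of_isRCLikeNormedField]; exact WithTop.coe_le_coe.mpr (le_top : (2:ℕ∞) ≤ ⊤))
  exact h4 _ _

lemma pd_sum {ι : Type*} (s : Finset ι) {f : ι → EuclideanSpace ℝ (Fin n) → ℝ}
    {x : EuclideanSpace ℝ (Fin n)} (j : Fin n)
    (h : ∀ i ∈ s, DifferentiableAt ℝ (f i) x) :
    pd j (fun y => ∑ i ∈ s, f i y) x = ∑ i ∈ s, pd j (f i) x := by
  unfold pd
  rw [fderiv_fun_sum h]; simp

lemma harm_pd {v : EuclideanSpace ℝ (Fin n) → ℝ} {U : Set (EuclideanSpace ℝ (Fin n))} (hU : IsOpen U)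
    (h : IsHarmonicOn v U) (j : Fin n) : IsHarmonicOn (pd j v) U := by
  refine ⟨Sm.pd hU h.1 j, ?_⟩
  intro x hx
  have hne : ∀ᶠ y in 𝓝 x, y ∈ U := hU.mem_nhds hx
  have e1 : ∀ i, pd i (pd i (pd j v)) x = pd j (pd i (pd i v)) x := by
    intro i
    have : pd i (pd j v) =ᶠ[𝓝 x] pd j (pd i v) := hne.mono fun y hy => pd_comm hU h.1 i j hy
    rw [(pd_congr i this).self_of_nhds]
    exact pd_comm hU (Sm.pd hU h.1 i) i j hx
  change ∑ i, pd i (pd i (pd j v)) x = 0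
  rw [Finset.sum_congr rfl fun i _ => e1 i,
    ← pd_sum Finset.univ j fun i _ => Sm.diff hU (Sm.pd hU (Sm.pd hU h.1 i) i) hx]
  have : (fun y => ∑ i, pd i (pd i v) y) =ᶠ[𝓝 x] fun _ => 0 := hne.mono fun y hy => h.2 y hy
  rw [(pd_congr j this).self_of_nhds]
  simp [pd]

lemma line_deriv {v : EuclideanSpace ℝ (Fin n) → ℝ} {U : Set (EuclideanSpace ℝ (Fin n))} (hU : IsOpen U)
    (h : Sm v U) (k : Fin n) (y : EuclideanSpace ℝ (Fin n)) {s : ℝ}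
    (hy : y + s • EuclideanSpace.single k (1:ℝ) ∈ U) :
    HasDerivAt (fun s : ℝ => v (y + s • EuclideanSpace.single k (1:ℝ)))
      (pd k v (y + s • EuclideanSpace.single k (1:ℝ))) s := by
  have h1 := (Sm.diff hU h hy).hasFDerivAt
  have h2 : HasDerivAt (fun s : ℝ => y + s • EuclideanSpace.single k (1:ℝ)) (EuclideanSpace.single k (1:ℝ)) s := by
    have := ((hasDerivAt_id s).smul_const (EuclideanSpace.single k (1:ℝ))).const_add y
    simpa using this
  exact h1.comp_hasDerivAt s h2

lemma bernstein {v : EuclideanSpace ℝ (Fin n) → ℝ} {U : Set (EuclideanSpace ℝ (Fin n))} (hU : IsOpen U)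
    (h : IsHarmonicOn v U) {x : EuclideanSpace ℝ (Fin n)} {r M : ℝ} (hr : 0 < r)
    (hxU : closedBall x r ⊆ U) (hM : ∀ y ∈ closedBall x r, |v y| ≤ M) (i : Fin n) :
    |pd i v x| ≤ (2*n+13) * M / r := by
  set g := pd i v with hg
  have hgh : IsHarmonicOn g U := harm_pd hU h i
  set l : ℝ := (2*n+13)*r^2 with hl
  have hl0 : 0 < l := by positivity
  set w : EuclideanSpace ℝ (Fin n) → ℝ := fun y => (r^2 - ‖y - x‖^2)^2 * (g y)^2 + l * (v y)^2 with hw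
  have hM0 : 0 ≤ M := (abs_nonneg _).trans (hM x (mem_closedBall_self hr.le))
  have hvM : ∀ y ∈ closedBall x r, (v y)^2 ≤ M^2 := fun y hy => by
    rw [← sq_abs]; exact pow_le_pow_left₀ (abs_nonneg _) (hM y hy) 2
  have hcont : ContinuousOn w (closedBall x r) := by
    have c1 : ContinuousOn g (closedBall x r) := (hgh.1.mono hxU).continuousOn
    have c2 : ContinuousOn v (closedBall x r) := (h.1.mono hxU).continuousOn
    have c3 : ContinuousOn (fun y => (r^2 - ‖y - x‖^2)^2) (closedBall x r) := by fun_prop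
    exact (c3.mul (c1.pow 2)).add ((c2.pow 2).const_smul l)
  obtain ⟨y, hy, hymax⟩ := (isCompact_closedBall x r).exists_isMaxOn ⟨x, mem_closedBall_self hr.le⟩ hcont
  have hwy : w y ≤ l * M^2 := by
    by_cases hg0 : (r^2 - ‖y - x‖^2)^2 * (g y)^2 = 0
    · simp only [hw, hg0, zero_add]
      exact mul_le_mul_of_nonneg_left (hvM y hy) hl0.le
    exfalso
    have hgy : g y ≠ 0 := by intro h0; exact hg0 (by rw [h0]; simp)
    have hyr : ‖y - x‖ < r := by
      rcases lt_or_eq_of_le (mem_closedBall_iff_norm.mp hy) with h1 | h1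
      · exact h1
      · exact absurd (by rw [h1]; simp) hg0
    have hyU : y ∈ U := hxU hy
    have hloc : IsLocalMax w y := hymax.isLocalMax
      (Filter.mem_of_superset (isOpen_ball.mem_nhds (mem_ball_iff_norm.mpr hyr)) ball_subset_closedBall)
    set p := r^2 - ‖y - x‖^2 with hp
    have hp0 : 0 < p := by
      have := norm_nonneg (y - x)
      rw [hp]; nlinarith
    have key : ∀ k : Fin n, 8*((y - x) k)^2*(g y)^2 - 4*p*(g y)^2 - 16*p*((y - x) k)*(g y)*(pd k g y)
        + 2*p^2*(pd k g y)^2 + 2*p^2*(g y)*(pd k (pd k g) y)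
        + 2*l*(pd k v y)^2 + 2*l*(v y)*(pd k (pd k v) y) ≤ 0 := by
      intro k
      have hc : Continuous (fun s : ℝ => y + s • EuclideanSpace.single k (1:ℝ)) := by fun_prop
      have hc0 : Tendsto (fun s : ℝ => y + s • EuclideanSpace.single k (1:ℝ)) (𝓝 0) (𝓝 y) := by
        have := hc.tendsto 0; simpa using this
      have hev : ∀ᶠ s : ℝ in 𝓝 0, y + s • EuclideanSpace.single k (1:ℝ) ∈ U :=
        hc0.eventually (hU.mem_nhds hyU)
      have hy0 : y + (0:ℝ) • EuclideanSpace.single k (1:ℝ) ∈ U := by simpa using hyU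
      have := snd_test (g := fun s => g (y + s • EuclideanSpace.single k (1:ℝ)))
        (g1 := fun s => pd k g (y + s • EuclideanSpace.single k (1:ℝ)))
        (v := fun s => v (y + s • EuclideanSpace.single k (1:ℝ)))
        (v1 := fun s => pd k v (y + s • EuclideanSpace.single k (1:ℝ))) (p := p) (q := (y - x) k) (l := l)
        (hev.mono fun s hs => line_deriv hU hgh.1 k y hs)
        (hev.mono fun s hs => line_deriv hU h.1 k y hs)
        (line_deriv hU (Sm.pd hU hgh.1 k) k y hy0)
        (line_deriv hU (Sm.pd hU h.1 k) k y hy0) (by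
          have h1 : ∀ s : ℝ, (p - 2*((y - x) k)*s - s^2) =
              r^2 - ‖y + s • EuclideanSpace.single k (1:ℝ) - x‖^2 := by
            intro s
            have e : y + s • EuclideanSpace.single k (1:ℝ) - x = (y - x) + s • EuclideanSpace.single k (1:ℝ) := by abel
            rw [e, norm_add_sq_real, norm_smul, inner_smul_right, EuclideanSpace.inner_single_right, hp]
            simp; ring
          have h2 := hc0.eventually hloc
          have h3 : ∀ᶠ s : ℝ in 𝓝 0, w (y + s • EuclideanSpace.single k (1:ℝ)) ≤
            w (y + (0:ℝ) • EuclideanSpace.single k (1:ℝ)) := by simpa using h2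
          simp only [h1]
          exact h3)
      simpa using this
    have hsum := Finset.sum_nonpos fun k (_ : k ∈ Finset.univ) => key k
    have hb : ∀ k : Fin n, -24*((y - x) k)^2*(g y)^2 - 4*p*(g y)^2 + 2*p^2*(g y)*(pd k (pd k g) y)
        + 2*l*(pd k v y)^2 + 2*l*(v y)*(pd k (pd k v) y) ≤ 8*((y - x) k)^2*(g y)^2 - 4*p*(g y)^2 - 16*p*((y - x) k)*(g y)*(pd k g y)
        + 2*p^2*(pd k g y)^2 + 2*p^2*(g y)*(pd k (pd k g) y)
        + 2*l*(pd k v y)^2 + 2*l*(v y)*(pd k (pd k v) y) := by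
      intro k
      have := sq_nonneg (p * pd k g y - 4 * (y - x) k * g y)
      linarith
    have hsum2 := (Finset.sum_le_sum fun k (_ : k ∈ Finset.univ) => hb k).trans hsum
    have s1 : ∑ k, pd k (pd k g) y = 0 := hgh.2 y hyU
    have s2 : ∑ k, pd k (pd k v) y = 0 := h.2 y hyU
    have s3 : ∑ k, ((y - x) k)^2 = ‖y - x‖^2 := by
      rw [EuclideanSpace.norm_sq_eq]; simp
    simp only [Finset.sum_add_distrib, Finset.sum_sub_distrib, ← Finset.mul_sum, ← Finset.sum_mul,
      s1, s2, s3, Finset.sum_const, Finset.card_univ, Fintype.card_fin, nsmul_eq_mul] at hsum2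
    have s4 : (g y)^2 ≤ ∑ k, (pd k v y)^2 :=
      Finset.single_le_sum (f := fun k => (pd k v y)^2) (fun k _ => sq_nonneg _) (Finset.mem_univ i)
    have s5 : 0 < (g y)^2 := by positivity
    have s6 : ‖y - x‖^2 ≤ r^2 := pow_le_pow_left₀ (norm_nonneg _) hyr.le 2
    have s7 : p ≤ r^2 := by rw [hp]; nlinarith [sq_nonneg ‖y - x‖]
    have t1 := mul_le_mul_of_nonneg_left s4 hl0.le
    have t2 := mul_le_mul_of_nonneg_right s6 s5.le
    have t3 := mul_le_mul_of_nonneg_right s7 s5.le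
    have t4 := mul_le_mul_of_nonneg_left t3 (Nat.cast_nonneg (α := ℝ) n)
    have t5 : 0 < r^2 * (g y)^2 := by positivity
    have t6 : l * (g y)^2 = (2*n+13)*(r^2*(g y)^2) := by rw [hl]; ring
    linarith
  have h1 : w x ≤ l * M^2 := (hymax (mem_closedBall_self hr.le)).trans hwy
  have h2 : r^4 * (g x)^2 ≤ l * M^2 := by
    have : w x = r^4 * (g x)^2 + l * (v x)^2 := by
      simp only [hw, sub_self, norm_zero]; ring
    have h3 : 0 ≤ l * (v x)^2 := by positivity
    linarith
  rw [le_div_iff₀ hr]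
  rw [← abs_of_pos hr, ← abs_mul]
  refine abs_le_of_sq_le_sq ?_ (by positivity)
  have h3 : (pd i v x * r)^2 * r^2 ≤ ((2*n+13)*M^2) * r^2 := by
    calc _ = r^4 * (g x)^2 := by rw [hg]; ring
      _ ≤ _ := h2.trans (le_of_eq (by rw [hl]; ring))
  have h4 := le_of_mul_le_mul_right h3 (by positivity)
  have h5 : (0:ℝ) ≤ n := by positivity
  have h6 : 0 ≤ M^2 := by positivity
  nlinarith [mul_nonneg h5 h6, mul_nonneg (mul_nonneg h5 h5) h6]

def DB : ℕ → (EuclideanSpace ℝ (Fin n) → ℝ) → Set (EuclideanSpace ℝ (Fin n)) → ℝ → Prop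
  | 0, v, S, B => ∀ y ∈ S, |v y| ≤ B
  | k+1, v, S, B => ∀ j, DB k (pd j v) S B

lemma DB_bound {U : Set (EuclideanSpace ℝ (Fin n))} (hU : IsOpen U) {x : EuclideanSpace ℝ (Fin n)}
    {ρ h : ℝ} (hh : 0 < h) : ∀ (k : ℕ) (v : EuclideanSpace ℝ (Fin n) → ℝ) (M : ℝ), IsHarmonicOn v U →
    ball x (ρ + k*h) ⊆ U → (∀ y ∈ ball x (ρ + k*h), |v y| ≤ M) →
    DB k v (ball x ρ) (((2*n+13)/h)^k * M) := by
  intro k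
  induction k with
  | zero => intro v M _ _ hM; simpa [DB] using hM
  | succ k ih =>
    intro v M hv hb hM j
    have hsub : ∀ y ∈ ball x (ρ + k*h), closedBall y h ⊆ ball x (ρ + (k+1:ℕ)*h) := by
      intro y hy z hz
      rw [mem_ball] at *
      rw [mem_closedBall] at hz
      push_cast
      have := dist_triangle z y x
      linarith
    have := ih (pd j v) ((2*n+13)/h * M) (harm_pd hU hv j)
      ((ball_subset_ball (by push_cast; linarith)).trans hb) (by
        intro y hy
        have := bernstein hU hv hh ((hsub y hy).trans hb) (fun z hz => hM z (hsub y hy hz)) j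
        refine this.trans (le_of_eq (by ring)))
    rw [pow_succ, mul_assoc]; exact this

noncomputable def KK (n : ℕ) : ℝ := (2*n+13) * Real.exp 1

lemma KK_pos (n : ℕ) : 0 < KK n := by unfold KK; positivity

lemma DB.mono {k : ℕ} {v : EuclideanSpace ℝ (Fin n) → ℝ} {S S' : Set (EuclideanSpace ℝ (Fin n))}
    {B B' : ℝ} (h : DB k v S B) (hS : S' ⊆ S) (hB : B ≤ B') : DB k v S' B' := by
  induction k generalizing v with
  | zero => intro y hy; exact (h y (hS hy)).trans hB
  | succ k ih => intro j; exact ih (h j)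

lemma DB_fact {U : Set (EuclideanSpace ℝ (Fin n))} (hU : IsOpen U) {x : EuclideanSpace ℝ (Fin n)}
    {ρ : ℝ} (hρ : 0 < ρ) (k : ℕ) (v : EuclideanSpace ℝ (Fin n) → ℝ) (M : ℝ) (hv : IsHarmonicOn v U)
    (hb : ball x (2*ρ) ⊆ U) (hM : ∀ y ∈ ball x (2*ρ), |v y| ≤ M) :
    DB k v (ball x ρ) ((KK n/ρ)^k * k.factorial * M) := by
  have hM0 : 0 ≤ M := (abs_nonneg _).trans (hM x (mem_ball_self (by positivity)))
  rcases Nat.eq_zero_or_pos k with rfl | hk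
  · intro y hy
    simpa using hM y (ball_subset_ball (by linarith) hy)
  have hk' : (0:ℝ) < k := by exact_mod_cast hk
  have e : ρ + k * (ρ/k) = 2*ρ := by field_simp; ring
  have h1 := DB_bound hU (x := x) (ρ := ρ) (h := ρ/k) (by positivity) k v M hv (by rw [e]; exact hb)
    (by rw [e]; exact hM)
  refine h1.mono le_rfl ?_
  apply mul_le_mul_of_nonneg_right _ hM0
  have h2 : (k:ℝ)^k / k.factorial ≤ Real.exp k := Real.pow_div_factorial_le_exp _ (by positivity) k
  rw [div_le_iff₀ (by positivity)] at h2
  have h3 : ((2*(n:ℝ)+13)/(ρ/k))^k = ((2*n+13)/ρ)^k * (k:ℝ)^k := by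
    rw [← mul_pow]; congr 1; field_simp
  have h4 : (KK n/ρ)^k = ((2*n+13)/ρ)^k * Real.exp k := by
    rw [← Real.exp_one_pow k, ← mul_pow]; unfold KK; congr 1; ring
  rw [h3, h4, mul_assoc]
  exact mul_le_mul_of_nonneg_left h2 (by positivity)

end harm
end PoS

namespace PoS
section taylor

open Filter Topology MvPolynomial

variable {n : ℕ}

noncomputable def TT : ℕ → (EuclideanSpace ℝ (Fin n) → ℝ) → EuclideanSpace ℝ (Fin n) →
    MvPolynomial (Fin n) ℝ
  | 0, v, x => C (v x)
  | k+1, v, x => C (1/((k:ℝ)+1)) * ∑ j, X j * TT k (pd j v) x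

lemma TT_congr (k : ℕ) : ∀ {v w : EuclideanSpace ℝ (Fin n) → ℝ} {x : EuclideanSpace ℝ (Fin n)},
    v =ᶠ[𝓝 x] w → TT k v x = TT k w x := by
  induction k with
  | zero => intro v w x h; simp only [TT, h.self_of_nhds]
  | succ k ih =>
    intro v w x h
    simp only [TT]
    congr 1
    exact Finset.sum_congr rfl fun j _ => by rw [ih (pd_congr j h)]

lemma TT_sum {U : Set (EuclideanSpace ℝ (Fin n))} (hU : IsOpen U) {ι : Type*} (s : Finset ι)
    {x : EuclideanSpace ℝ (Fin n)} (hx : x ∈ U) (k : ℕ) :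
    ∀ {f : ι → EuclideanSpace ℝ (Fin n) → ℝ}, (∀ i ∈ s, Sm (f i) U) →
    TT k (fun y => ∑ i ∈ s, f i y) x = ∑ i ∈ s, TT k (f i) x := by
  induction k with
  | zero => intro f h; simp [TT]
  | succ k ih =>
    intro f h
    simp only [TT]
    rw [← Finset.mul_sum, Finset.sum_comm]
    congr 1
    refine Finset.sum_congr rfl fun j _ => ?_
    rw [← Finset.mul_sum, ← ih (fun i hi => Sm.pd hU (h i hi) j)]
    congr 1
    apply TT_congr
    filter_upwards [hU.mem_nhds hx] with y hy
    exact pd_sum s j fun i hi => Sm.diff hU (h i hi) hy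

lemma pderiv_TT {U : Set (EuclideanSpace ℝ (Fin n))} (hU : IsOpen U)
    {x : EuclideanSpace ℝ (Fin n)} (hx : x ∈ U) (i : Fin n) (k : ℕ) :
    ∀ {v : EuclideanSpace ℝ (Fin n) → ℝ}, Sm v U →
    pderiv i (TT (k+1) v x) = TT k (pd i v) x := by
  induction k with
  | zero =>
    intro v h
    simp only [TT, Derivation.leibniz, map_sum, pderiv_C, pderiv_X, smul_eq_mul]
    simp [Pi.single_apply]
  | succ k ih =>
    intro v h
    rw [TT]
    have e1 : ∀ j, pderiv i (TT (k+1) (pd j v) x) = TT k (pd j (pd i v)) x := by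
      intro j
      rw [ih (Sm.pd hU h j)]
      apply TT_congr
      filter_upwards [hU.mem_nhds hx] with y hy using pd_comm hU h i j hy
    have e2 : ∑ j, X j * TT k (pd j (pd i v)) x = C ((k:ℝ)+1) * TT (k+1) (pd i v) x := by
      rw [TT, ← mul_assoc, ← C_mul, mul_one_div_cancel (by positivity), C_1, one_mul]
    have e3 : pderiv i (∑ j, X j * TT (k+1) (pd j v) x) =
        C ((k:ℝ)+1) * TT (k+1) (pd i v) x + TT (k+1) (pd i v) x := by
      rw [← e2, map_sum]
      simp only [Derivation.leibniz, e1, smul_eq_mul, pderiv_X, Finset.sum_add_distrib]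
      congr 1
      simp [Pi.single_apply]
    rw [Derivation.leibniz, e3, pderiv_C]
    simp only [smul_eq_mul, mul_zero, add_zero]
    have e4 : C ((k:ℝ)+1) * TT (k+1) (pd i v) x + TT (k+1) (pd i v) x =
      C ((k:ℝ)+1+1) * TT (k+1) (pd i v) x := by simp only [C_add, C_1]; ring
    rw [e4, ← mul_assoc, ← C_mul]
    push_cast
    rw [one_div_mul_cancel (by positivity), C_1, one_mul]

noncomputable def TP (D : ℕ) (u : EuclideanSpace ℝ (Fin n) → ℝ) (x : EuclideanSpace ℝ (Fin n)) :
    MvPolynomial (Fin n) ℝ := ∑ k ∈ Finset.range (D+1), TT k u x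

lemma pderiv_TP {U : Set (EuclideanSpace ℝ (Fin n))} (hU : IsOpen U)
    {x : EuclideanSpace ℝ (Fin n)} (hx : x ∈ U) (i : Fin n) (D : ℕ)
    {v : EuclideanSpace ℝ (Fin n) → ℝ} (h : Sm v U) :
    pderiv i (TP D v x) = ∑ k ∈ Finset.range D, TT k (pd i v) x := by
  rw [TP, map_sum, Finset.sum_range_succ']
  rw [Finset.sum_congr rfl fun k _ => pderiv_TT hU hx i k h]
  simp [TT]

lemma HarmP_TP {U : Set (EuclideanSpace ℝ (Fin n))} (hU : IsOpen U)
    {x : EuclideanSpace ℝ (Fin n)} (hx : x ∈ U) (D : ℕ)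
    {u : EuclideanSpace ℝ (Fin n) → ℝ} (h : IsHarmonicOn u U) : HarmP (TP D u x) := by
  unfold HarmP
  have e0 : ∀ k, ∑ i, TT k (pd i (pd i u)) x = 0 := by
    intro k
    rw [← TT_sum hU Finset.univ hx k (fun i _ => Sm.pd hU (Sm.pd hU h.1 i) i)]
    rw [← Finset.sum_empty (f := fun i : Fin n => TT k (pd i (pd i u)) x),
      ← TT_sum hU ∅ hx k (fun i _ => Sm.pd hU (Sm.pd hU h.1 i) i)]
    apply TT_congr
    filter_upwards [hU.mem_nhds hx] with y hy
    rw [Finset.sum_empty]; exact h.2 y hy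
  rcases D with _ | D
  · simp [pderiv_TP hU hx _ 0 h.1]
  · have e1 : ∀ i, pderiv i (pderiv i (TP (D+1) u x)) = ∑ k ∈ Finset.range D, TT k (pd i (pd i u)) x := by
      intro i
      rw [pderiv_TP hU hx i _ h.1]
      exact pderiv_TP hU hx i D (Sm.pd hU h.1 i)
    simp only [e1]
    rw [Finset.sum_comm]
    exact Finset.sum_eq_zero fun k _ => e0 k

lemma pn_TT {S : Set (EuclideanSpace ℝ (Fin n))} {x : EuclideanSpace ℝ (Fin n)} (hx : x ∈ S)
    {r B : ℝ} (hr : 0 ≤ r) (k : ℕ) : ∀ {v : EuclideanSpace ℝ (Fin n) → ℝ}, DB k v S B →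
    pn r (TT k v x) ≤ (n*r)^k/k.factorial * B := by
  induction k with
  | zero => intro v h; simpa [TT, pn_C] using h x hx
  | succ k ih =>
    intro v h
    have h1 : pn r (∑ j, X j * TT k (pd j v) x) ≤ n * (r * ((n*r)^k/k.factorial * B)) := by
      refine (wn_sum_le (fun j => by positivity) _ _).trans ?_
      refine (Finset.sum_le_card_nsmul _ _ (r * ((n*r)^k/k.factorial * B)) ?_).trans ?_
      · intro j _
        refine (pn_mul_le hr _ _).trans ?_
        rw [pn_X]
        exact mul_le_mul_of_nonneg_left (ih (h j)) hr
      · simp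
    unfold pn at h1 ⊢
    rw [TT, wn_C_mul, abs_of_nonneg (by positivity)]
    refine (mul_le_mul_of_nonneg_left h1 (by positivity)).trans (le_of_eq ?_)
    rw [Nat.factorial_succ]; push_cast
    field_simp
    try ring

lemma eval_TT_smul (s : ℝ) (h : Fin n → ℝ) {x : EuclideanSpace ℝ (Fin n)} (k : ℕ) :
    ∀ {v : EuclideanSpace ℝ (Fin n) → ℝ}, eval (s • h) (TT k v x) = s^k * eval h (TT k v x) := by
  induction k with
  | zero => intro v; simp [TT]
  | succ k ih =>
    intro v
    simp only [TT, map_mul, map_sum, eval_C, eval_X, ih, Pi.smul_apply, smul_eq_mul]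
    simp only [Finset.mul_sum]
    refine Finset.sum_congr rfl fun j _ => ?_
    ring

lemma fderiv_coord {v : EuclideanSpace ℝ (Fin n) → ℝ} (y h : EuclideanSpace ℝ (Fin n)) :
    fderiv ℝ v y h = ∑ j, h.ofLp j * pd j v y := by
  have e : h = ∑ j, h.ofLp j • EuclideanSpace.single j (1:ℝ) := by
    ext i
    simp [Pi.single_apply]
  conv_lhs => rw [e]
  simp [pd]

lemma remainder {U : Set (EuclideanSpace ℝ (Fin n))} (hU : IsOpen U) {x h : EuclideanSpace ℝ (Fin n)}
    {ρ : ℝ} (hb : ball x ρ ⊆ U) (k : ℕ) : ∀ {v : EuclideanSpace ℝ (Fin n) → ℝ} {B : ℝ}, Sm v U →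
    DB k v (ball x ρ) B → ∀ s ∈ Icc (0:ℝ) 1, ‖h‖ < ρ →
    |v (x + s • h) - ∑ i ∈ Finset.range k, s^i * eval h.ofLp (TT i v x)| ≤
      B * (s * ∑ j, |h.ofLp j|)^k / k.factorial := by
  have hin : ∀ s ∈ Icc (0:ℝ) 1, ‖h‖ < ρ → x + s • h ∈ ball x ρ := by
    intro s hs hh
    rw [mem_ball, dist_eq_norm, add_sub_cancel_left, norm_smul, Real.norm_of_nonneg hs.1]
    nlinarith [hs.1, hs.2, norm_nonneg h]
  induction k with
  | zero =>
    intro v B hv hD s hs hh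
    simpa using hD _ (hin s hs hh)
  | succ k ih =>
    intro v B hv hD s hs hh
    set H := ∑ j, |h.ofLp j| with hH
    set φ : ℝ → ℝ := fun s => v (x + s • h) - ∑ i ∈ Finset.range (k+1), s^i * eval h.ofLp (TT i v x) with hφ
    set φ' : ℝ → ℝ := fun s => ∑ j, h.ofLp j * (pd j v (x + s • h) -
      ∑ i ∈ Finset.range k, s^i * eval h.ofLp (TT i (pd j v) x)) with hφ'
    have hder : ∀ s ∈ Icc (0:ℝ) 1, HasDerivAt φ (φ' s) s := by
      intro s hs
      have h1 := (Sm.diff hU hv (hb (hin s hs hh))).hasFDerivAt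
      have h2 : HasDerivAt (fun s : ℝ => x + s • h) h s := by
        have := ((hasDerivAt_id s).smul_const h).const_add x
        simpa using this
      have h3 := h1.comp_hasDerivAt s h2
      have h4 : HasDerivAt (fun s : ℝ => ∑ i ∈ Finset.range (k+1), s^i * eval h.ofLp (TT i v x))
          (∑ i ∈ Finset.range (k+1), ((i:ℝ) * s^(i-1)) * eval h.ofLp (TT i v x)) s :=
        HasDerivAt.fun_sum fun i _ => (hasDerivAt_pow i s).mul_const _
      refine (h3.sub h4).congr_deriv ?_
      rw [fderiv_coord, hφ', Finset.sum_range_succ']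
      simp only [mul_sub, Finset.sum_sub_distrib, Finset.mul_sum]
      rw [Finset.sum_comm]
      simp only [Nat.cast_zero, zero_mul, add_zero]
      congr 1
      refine Finset.sum_congr rfl fun i _ => ?_
      simp only [TT, map_mul, map_sum, eval_C, eval_X, Finset.mul_sum]
      refine Finset.sum_congr rfl fun j _ => ?_
      have : ((i:ℝ)+1) ≠ 0 := by positivity
      push_cast
      field_simp
    have hbd : ∀ s ∈ Icc (0:ℝ) 1, |φ' s| ≤ B * H * (s*H)^k / k.factorial := by
      intro s hs
      refine (Finset.abs_sum_le_sum_abs _ _).trans ?_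
      have : ∀ j ∈ (Finset.univ : Finset (Fin n)), |h.ofLp j * (pd j v (x + s • h) -
        ∑ i ∈ Finset.range k, s^i * eval h.ofLp (TT i (pd j v) x))| ≤
          |h.ofLp j| * (B * (s*H)^k / k.factorial) := by
        intro j _
        rw [abs_mul]
        exact mul_le_mul_of_nonneg_left (ih (Sm.pd hU hv j) (hD j) s hs hh) (abs_nonneg _)
      refine (Finset.sum_le_sum this).trans (le_of_eq ?_)
      rw [← Finset.sum_mul, ← hH]; ring
    have key := image_norm_le_of_norm_deriv_right_le_deriv_boundary (f := φ) (f' := φ') (a := 0) (b := 1)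
      (B := fun s => B * (s*H)^(k+1) / (k+1).factorial) (B' := fun s => B * H * (s*H)^k / k.factorial)
      (fun s hs => (hder s hs).continuousAt.continuousWithinAt)
      (fun s hs => (hder s ⟨hs.1, hs.2.le⟩).hasDerivWithinAt)
      (by
        simp only [hφ]
        rw [Finset.sum_range_succ']
        simp [TT])
      (by
        intro s
        have := ((((hasDerivAt_id s).mul_const H).pow (k+1)).const_mul B).div_const ((k+1).factorial : ℝ)
        refine this.congr_deriv ?_
        rw [Nat.factorial_succ]; push_cast
        simp only [id]
        field_simp)
      (fun s hs => hbd s ⟨hs.1, hs.2.le⟩)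
    exact key hs

noncomputable def kap (n : ℕ) : ℝ := 1 / (2 * n * KK n)

lemma kap_pos (hn : 0 < n) : 0 < kap n := by
  have := KK_pos n
  have : (0:ℝ) < n := by exact_mod_cast hn
  unfold kap; positivity

lemma kap_le (hn : 0 < n) : kap n ≤ 1/2 := by
  have h1 : (1:ℝ) ≤ n := by exact_mod_cast hn
  have h2 : 1 ≤ KK n := by
    unfold KK
    have := Real.add_one_le_exp (1:ℝ)
    nlinarith
  unfold kap
  exact one_div_le_one_div_of_le (by norm_num) (by nlinarith)

lemma TP_bound (hn : 0 < n) {U : Set (EuclideanSpace ℝ (Fin n))} (hU : IsOpen U)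
    {x : EuclideanSpace ℝ (Fin n)} {ρ M : ℝ} (hρ : 0 < ρ) {u : EuclideanSpace ℝ (Fin n) → ℝ}
    (hu : IsHarmonicOn u U) (hb : ball x (2*ρ) ⊆ U)
    (hM : ∀ j, ∀ y ∈ ball x (2*ρ), |pd j u y| ≤ M) (D : ℕ) :
    SS (TP D u x) 0 (kap n * ρ) ≤ 2*n*M := by
  have hxU : x ∈ U := hb (mem_ball_self (by positivity))
  have hk := kap_pos hn
  have hK := KK_pos n
  have hn' : (0:ℝ) < n := by exact_mod_cast hn
  have hM0 : 0 ≤ M := (abs_nonneg _).trans (hM ⟨0, hn⟩ x (mem_ball_self (by positivity)))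
  have e : (n:ℝ) * (kap n * ρ) * (KK n / ρ) = 1/2 := by
    unfold kap; field_simp
  have h1 : ∀ j k, pn (kap n * ρ) (TT k (pd j u) x) ≤ (1/2:ℝ)^k * M := by
    intro j k
    refine (pn_TT (mem_ball_self hρ) (by positivity) k
      (DB_fact hU hρ k (pd j u) M (harm_pd hU hu j) hb (hM j))).trans (le_of_eq ?_)
    have hf : ((k.factorial : ℕ) : ℝ) ≠ 0 := by positivity
    rw [← e, mul_pow _ (KK n / ρ)]
    field_simp
  have h2 : ∀ j, pn (kap n * ρ) (sh 0 (pderiv j (TP D u x))) ≤ 2 * M := by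
    intro j
    rw [sh_zero, pderiv_TP hU hxU j D hu.1]
    refine (wn_sum_le (fun j => by positivity) _ _).trans ?_
    refine (Finset.sum_le_sum fun k _ => h1 j k).trans ?_
    rw [← Finset.sum_mul]
    refine mul_le_mul_of_nonneg_right ?_ hM0
    have := Summable.sum_le_tsum (f := fun k : ℕ => (1/2:ℝ)^k) (Finset.range D)
      (fun i _ => by positivity) summable_geometric_two
    rwa [tsum_geometric_two] at this
  unfold SS
  refine (Finset.sum_le_sum fun j _ => h2 j).trans (le_of_eq ?_)
  simp; ring

lemma TP_approx (hn : 0 < n) {U : Set (EuclideanSpace ℝ (Fin n))} (hU : IsOpen U)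
    {x : EuclideanSpace ℝ (Fin n)} {ρ M : ℝ} (hρ : 0 < ρ) {u : EuclideanSpace ℝ (Fin n) → ℝ}
    (hu : IsHarmonicOn u U) (hb : ball x (2*ρ) ⊆ U)
    (hM : ∀ j, ∀ y ∈ ball x (2*ρ), |pd j u y| ≤ M) (D : ℕ) (j : Fin n)
    {h : EuclideanSpace ℝ (Fin n)} (hh : ‖h‖ ≤ kap n * ρ) :
    |pd j u (x + h) - eval h.ofLp (pderiv j (TP D u x))| ≤ (1/2)^D * M := by
  have hxU : x ∈ U := hb (mem_ball_self (by positivity))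
  have hk := kap_pos hn
  have hk2 := kap_le hn
  have hK := KK_pos n
  have hn' : (0:ℝ) < n := by exact_mod_cast hn
  have hM0 : 0 ≤ M := (abs_nonneg _).trans (hM ⟨0, hn⟩ x (mem_ball_self (by positivity)))
  have e : (n:ℝ) * (kap n * ρ) * (KK n / ρ) = 1/2 := by
    unfold kap; field_simp
  have h1 := remainder hU (x := x) (h := h) (ρ := ρ) ((ball_subset_ball (by linarith)).trans hb) D
    (Sm.pd hU hu.1 j)
    (DB_fact hU hρ D (pd j u) M (harm_pd hU hu j) hb (hM j)) 1 ⟨by norm_num, le_refl _⟩ (by nlinarith)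
  rw [pderiv_TP hU hxU j D hu.1, map_sum]
  simp only [one_smul, one_pow, one_mul] at h1
  refine h1.trans ?_
  have h2 : ∑ j, |h.ofLp j| ≤ n * (kap n * ρ) := by
    refine (Finset.sum_le_sum fun j _ => (coord_le h j).trans hh).trans (le_of_eq ?_)
    simp
  have h3 : (∑ j, |h.ofLp j|)^D ≤ (n * (kap n * ρ))^D :=
    pow_le_pow_left₀ (Finset.sum_nonneg fun _ _ => abs_nonneg _) h2 D
  have hf : ((D.factorial : ℕ) : ℝ) ≠ 0 := by positivity
  calc _ = (KK n / ρ)^D * M * (∑ j, |h.ofLp j|)^D := by field_simp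
    _ ≤ (KK n / ρ)^D * M * (n * (kap n * ρ))^D := mul_le_mul_of_nonneg_left h3 (by positivity)
    _ = _ := by rw [← e, mul_pow _ (KK n / ρ)]; ring

end taylor
end PoS

namespace PoS
section assembly

open Filter Topology MvPolynomial

variable {n : ℕ}

lemma SS_logconv (P : MvPolynomial (Fin n) ℝ) (z : Fin n → ℝ) {a b c : ℝ} (ha : 0 ≤ a) (hb : 0 ≤ b)
    (hc : c^2 = a*b) : (SS P z c)^2 ≤ SS P z a * SS P z b := by
  unfold SS
  refine Finset.sum_sq_le_sum_mul_sum_of_sq_le_mul _ (fun i _ => pn_nonneg ha _)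
    (fun i _ => pn_nonneg hb _) (fun i _ => ?_)
  unfold pn wn
  refine Finset.sum_sq_le_sum_mul_sum_of_sq_le_mul _ (fun i _ => by positivity)
    (fun i _ => by positivity) (fun γ _ => le_of_eq ?_)
  rw [mul_pow, ← pow_mul, mul_comm _ 2, pow_mul, hc, mul_pow]; ring

lemma eval_le_SS (P : MvPolynomial (Fin n) ℝ) {h : EuclideanSpace ℝ (Fin n)} {r : ℝ} (hh : ‖h‖ ≤ r)
    (j : Fin n) : |eval h.ofLp (pderiv j P)| ≤ SS P 0 r := by
  have h1 : |eval h.ofLp (pderiv j P)| ≤ gr P h.ofLp :=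
    Finset.single_le_sum (f := fun j => |eval h.ofLp (pderiv j P)|) (fun _ _ => abs_nonneg _)
      (Finset.mem_univ j)
  have h2 := SS_shift (P := P) (x := 0) (y := h.ofLp) (r := 0) (h := r) le_rfl
    (fun i => by simpa using (coord_le h i).trans hh)
  rw [zero_add] at h2
  exact h1.trans ((gr_le_SS le_rfl).trans h2)

def Bd (u : EuclideanSpace ℝ (Fin n) → ℝ) (y : EuclideanSpace ℝ (Fin n)) (t q : ℝ) : Prop :=
  ∀ j, ∀ z ∈ ball y t, |pd j u z| ≤ q

lemma ball_half {y : EuclideanSpace ℝ (Fin n)} (hy : ‖y‖ < 1/2) : ball y (1/2) ⊆ ball 0 1 := by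
  apply ball_subset_ball'
  rw [dist_zero_right]; linarith

lemma Bd_double (hn : 0 < n) {u : EuclideanSpace ℝ (Fin n) → ℝ} (hu : IsHarmonicOn u (ball 0 1))
    (h1 : ∀ j, ∀ z ∈ ball (0 : EuclideanSpace ℝ (Fin n)) 1, |pd j u z| ≤ 1)
    {y : EuclideanSpace ℝ (Fin n)} (hy : ‖y‖ < 1/2) {t q : ℝ} (ht : 0 < t) (ht1 : 32*t ≤ (kap n)^2)
    (h : Bd u y t q) : Bd u y (2*t) (2*n*√q) := by
  have hk := kap_pos hn
  have hk2 := kap_le hn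
  have hkk : (kap n)^2 ≤ kap n * (1/2) := by
    rw [sq]; exact mul_le_mul_of_nonneg_left hk2 hk.le
  have hq0 : 0 ≤ q := (abs_nonneg _).trans (h ⟨0, hn⟩ y (mem_ball_self ht))
  have hb := ball_half hy
  have hb2 : ball y (2*(t/2)) ⊆ ball 0 1 := (ball_subset_ball (by linarith)).trans hb
  have hb4 : ball y (2*(1/4)) ⊆ ball 0 1 := (ball_subset_ball (by norm_num)).trans hb
  intro j z hz
  have hS : ∀ D, SS (TP D u y) 0 (2*t) ≤ 2*n*√q := by
    intro D
    have e1 := TP_bound hn isOpen_ball (x := y) (ρ := t/2) (M := q) (by positivity) hu hb2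
      (fun j y' hy' => h j y' (by rwa [mul_div_cancel₀ t two_ne_zero] at hy')) D
    have e2 := TP_bound hn isOpen_ball (x := y) (ρ := 1/4) (M := 1) (by norm_num) hu hb4
      (fun j y' hy' => h1 j y' (hb4 hy')) D
    have e3 := SS_logconv (TP D u y) 0 (a := kap n * (t/2)) (b := kap n * (1/4))
      (c := √(kap n * (t/2) * (kap n * (1/4)))) (by positivity) (by positivity)
      (Real.sq_sqrt (by positivity))
    have e4 : 2*t ≤ √(kap n * (t/2) * (kap n * (1/4))) := by
      apply Real.le_sqrt_of_sq_le
      nlinarith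
    have e5 := SS_mono (P := TP D u y) (z := 0) (by positivity : (0:ℝ) ≤ 2*t) e4
    refine e5.trans (abs_le_of_sq_le_sq' ?_ (by positivity)).2
    refine e3.trans ((mul_le_mul e1 e2 (SS_nonneg (by positivity)) (by positivity)).trans (le_of_eq ?_))
    rw [mul_pow, Real.sq_sqrt hq0]; ring
  have hd : ∀ D, |pd j u z| ≤ 2*n*√q + (1/2)^D := by
    intro D
    have hzn : ‖z - y‖ ≤ 2*t := by rw [mem_ball, dist_eq_norm] at hz; exact hz.le
    have e1 := TP_approx hn isOpen_ball (x := y) (ρ := 1/4) (M := 1) (by norm_num) hu hb4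
      (fun j y' hy' => h1 j y' (hb4 hy')) D j (h := z - y) (by linarith)
    have e2 := eval_le_SS (TP D u y) hzn j
    rw [add_sub_cancel] at e1
    have e3 := abs_sub_abs_le_abs_sub (pd j u z) (eval (z-y).ofLp (pderiv j (TP D u y)))
    have := hS D
    linarith
  have hlim : Tendsto (fun D : ℕ => 2*n*√q + (1/2:ℝ)^D) atTop (𝓝 (2*n*√q + 0)) :=
    (_root_.tendsto_pow_atTop_nhds_zero_of_lt_one (by norm_num) (by norm_num)).const_add _
  rw [add_zero] at hlim
  exact ge_of_tendsto' hlim hd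

lemma Bd_chain (hn : 0 < n) {u : EuclideanSpace ℝ (Fin n) → ℝ} (hu : IsHarmonicOn u (ball 0 1))
    (h1 : ∀ j, ∀ z ∈ ball (0 : EuclideanSpace ℝ (Fin n)) 1, |pd j u z| ≤ 1)
    {y : EuclideanSpace ℝ (Fin n)} (hy : ‖y‖ < 1/2) {t q : ℝ} (ht : 0 < t) (ht1 : 32*t ≤ (kap n)^2)
    (h : Bd u y t q) (i : ℕ) : ∀ x : EuclideanSpace ℝ (Fin n), ‖x‖ < 1/2 → dist x y ≤ i*t →
    Bd u x t ((2*n)^2 * q^((1/2:ℝ)^i)) := by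
  have hq0 : 0 ≤ q := (abs_nonneg _).trans (h ⟨0, hn⟩ y (mem_ball_self ht))
  have hn1 : (1:ℝ) ≤ n := by exact_mod_cast hn
  induction i with
  | zero =>
    intro x hx hd
    have : x = y := by
      rw [← dist_le_zero]; simpa using hd
    subst this
    intro j z hz
    refine (h j z hz).trans ?_
    simp only [pow_zero, Real.rpow_one]
    have : (1:ℝ) ≤ (2*n)^2 := one_le_pow₀ (by linarith)
    exact le_mul_of_one_le_left hq0 this
  | succ i ih =>
    intro x hx hd
    set c : ℝ := (i:ℝ)/(i+1) with hc
    have hc0 : 0 ≤ c := by positivity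
    have hi : (0:ℝ) < i + 1 := by positivity
    have hc1 : c ≤ 1 := by rw [hc, div_le_one hi]; linarith
    have hcc : 1 - c = 1/(i+1) := by rw [hc]; field_simp; ring
    push_cast at hd
    rw [dist_eq_norm] at hd
    set x' := (1-c) • y + c • x with hx'
    have hx'n : ‖x'‖ < 1/2 := by
      have : x' ∈ ball (0:EuclideanSpace ℝ (Fin n)) (1/2) :=
        convex_ball 0 (1/2) (by simpa using hy) (by simpa using hx) (by linarith) hc0 (by ring)
      simpa using this
    have hd1 : dist x' y ≤ i*t := by
      have : x' - y = c • (x - y) := by rw [hx']; module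
      rw [dist_eq_norm, this, norm_smul, Real.norm_of_nonneg hc0]
      refine (mul_le_mul_of_nonneg_left hd hc0).trans (le_of_eq ?_)
      rw [hc]; field_simp
    have hd2 : dist x x' ≤ t := by
      have : x - x' = (1-c) • (x - y) := by rw [hx']; module
      rw [dist_eq_norm, this, norm_smul, Real.norm_of_nonneg (by linarith)]
      refine (mul_le_mul_of_nonneg_left hd (by linarith)).trans (le_of_eq ?_)
      rw [hcc]; field_simp
    have := Bd_double hn hu h1 hx'n ht ht1 (ih x' hx'n hd1)
    intro j z hz
    refine (this j z ?_).trans (le_of_eq ?_)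
    · rw [mem_ball] at hz ⊢
      linarith [dist_triangle z x x']
    · rw [Real.sqrt_mul (by positivity), Real.sqrt_sq (by positivity), Real.sqrt_eq_rpow,
        ← Real.rpow_mul hq0, pow_succ]; ring_nf

lemma eval_rsc (x : Fin n → ℝ) (e : Fin n → ℝ) (q : MvPolynomial (Fin n) ℝ) :
    eval e (rsc x 1 q) = eval (x + e) q := by
  unfold rsc
  induction q using MvPolynomial.induction_on with
  | C a => simp
  | add p q hp hq => simp only [map_add, hp, hq]
  | mul_X p i hp => simp only [map_mul, hp, aeval_X, eval_X, map_add, eval_C, Pi.add_apply]; ring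

lemma pd_le {u : EuclideanSpace ℝ (Fin n) → ℝ} (j : Fin n) (y : EuclideanSpace ℝ (Fin n)) :
    |pd j u y| ≤ ‖fderiv ℝ u y‖ := by
  have := (fderiv ℝ u y).le_opNorm (EuclideanSpace.single j 1)
  simpa [pd] using this

lemma fderiv_le {u : EuclideanSpace ℝ (Fin n) → ℝ} {y : EuclideanSpace ℝ (Fin n)} {q : ℝ} (hq : 0 ≤ q)
    (h : ∀ j, |pd j u y| ≤ q) : ‖fderiv ℝ u y‖ ≤ n * q := by
  refine ContinuousLinearMap.opNorm_le_bound _ (by positivity) fun v => ?_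
  rw [fderiv_coord]
  refine (norm_sum_le _ _).trans ?_
  refine (Finset.sum_le_sum (g := fun _ => q * ‖v‖) fun j _ => ?_).trans (le_of_eq ?_)
  · rw [norm_mul, mul_comm]
    exact mul_le_mul (h j) (coord_le v j) (norm_nonneg _) hq
  · simp; ring

end assembly
end PoS

namespace PoS
section final

open Filter Topology MvPolynomial

lemma pick_k (m : ℕ) {N : ℝ} (hN : 1/2 ≤ N) : ∃ k : ℕ,
    N ≤ (1/2) * ((1 - 1/(4*((m:ℝ)+1)))⁻¹)^k ∧ (1/2) * ((1 - 1/(4*((m:ℝ)+1)))⁻¹)^k ≤ 2*N := by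
  set a : ℝ := 1/(4*((m:ℝ)+1)) with ha
  have ha0 : 0 < a := by positivity
  have ha1 : a ≤ 1/2 := by
    rw [ha]
    exact one_div_le_one_div_of_le (by norm_num) (by have : (0:ℝ) ≤ m := by positivity
                                                     linarith)
  set q : ℝ := (1-a)⁻¹ with hq
  have hq1 : 1 < q := by rw [hq, one_lt_inv₀ (by linarith)]; linarith
  have hq2 : q ≤ 2 := by
    rw [hq, inv_le_comm₀ (by linarith) (by norm_num)]; linarith
  obtain ⟨k, h1, h2⟩ := exists_nat_pow_near (by linarith : 1 ≤ 2*N) hq1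
  refine ⟨k+1, by linarith, ?_⟩
  rw [pow_succ]
  have := mul_le_mul h1 hq2 (by linarith) (by linarith)
  linarith

lemma local_step (m : ℕ) (hm : 1 ≤ m) {δ μ : ℝ} (hδ : 0 < δ) (hμ : 0 < μ) :
    ∃ t α : ℝ, 0 < t ∧ 32*t ≤ (kap (m+1))^2 ∧ 0 < α ∧
    ∀ (u : EuclideanSpace ℝ (Fin (m+1)) → ℝ) (E : Set (EuclideanSpace ℝ (Fin (m+1)))) (ε : ℝ),
      IsHarmonicOn u (ball 0 1) →
      (∀ j, ∀ z ∈ ball (0 : EuclideanSpace ℝ (Fin (m+1))) 1, |pd j u z| ≤ 1) →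
      E ⊆ ball 0 (1/2) → ENNReal.ofReal μ < hausdorffContent ((m:ℝ)-1+δ) E →
      0 ≤ ε → (∀ j, ∀ z ∈ E, |pd j u z| ≤ ε) →
      ∃ y ∈ E, Bd u y t (4*((m:ℝ)+1)*ε^α) := by
  obtain ⟨R, C0, β, hR, hC0, hβ, hloc⟩ := loc m hm hδ
  set s : ℝ := (m:ℝ)-1+δ with hs
  have hs0 : 0 < s := by
    have : (1:ℝ) ≤ m := by exact_mod_cast hm
    linarith
  have hn : 0 < m+1 := by omega
  set κ := kap (m+1) with hκ
  have hk : 0 < κ := kap_pos hn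
  have hk2 : κ ≤ 1/2 := kap_le hn
  have hkk : κ^2 ≤ κ * (1/2) := by
    rw [sq]; exact mul_le_mul_of_nonneg_left hk2 hk.le
  have he := Real.exp_pos 1
  have heR : 0 < Real.exp 1 * R + 2 := by positivity
  set t : ℝ := κ^2/(32*(Real.exp 1 * R + 2)) with ht
  have ht0 : 0 < t := by positivity
  have htR : (Real.exp 1 * R + 2)*t = κ^2/32 := by rw [ht]; field_simp
  have htR' : 0 < Real.exp 1 * R * t := by positivity
  have ht1 : 32*t ≤ κ^2 := by linarith
  have htk : t ≤ κ*(1/4) := by linarith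
  obtain ⟨K, hK, hcov⟩ := ballcover (m+1) (r := 2*t) (by positivity) (by linarith)
  have hA : ∃ A : ℝ, 0 ≤ A ∧ C0 * Real.exp (-β*A) * t^s ≤ μ/K := by
    have h1 : Tendsto (fun A : ℝ => C0 * Real.exp (-β*A) * t^s) atTop (𝓝 (C0 * 0 * t^s)) := by
      refine ((Real.tendsto_exp_atBot.comp ?_).const_mul C0).mul_const _
      exact tendsto_id.const_mul_atTop_of_neg (by linarith)
    rw [mul_zero, zero_mul] at h1
    have h2 := (h1.eventually (gt_mem_nhds (by positivity : 0 < μ/K))).and (eventually_ge_atTop 0)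
    obtain ⟨A, hA1, hA2⟩ := h2.exists
    exact ⟨A, hA2, hA1.le⟩
  obtain ⟨A, hA0, hA1⟩ := hA
  refine ⟨t, 1/(2*A+1), ht0, ht1, by positivity, ?_⟩
  intro u E ε hu h1 hE hEc hε hεE
  set nn : ℝ := (m:ℝ)+1 with hnn
  have hnn0 : 0 < nn := by positivity
  have hcast : ((m+1 : ℕ) : ℝ) = nn := by push_cast; rfl
  obtain ⟨F, hF1, hF2, hF3⟩ := hcov 0 (1/2) (by norm_num) E (fun y hy => (mem_ball.1 (hE hy)).le)
  have hy : ∃ y ∈ E, ENNReal.ofReal (μ/K) < hausdorffContent s (E ∩ closedBall y t) := by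
    by_contra! hcon
    have := hc_cover hs0 (G := E) F t (μ/K) K (by positivity)
      (fun y hy => by
        obtain ⟨y', h, h'⟩ := hF3 y hy
        exact ⟨y', h, by linarith⟩) hF2 (fun x hx => hcon x (hF1 hx))
    rw [mul_div_cancel₀ _ hK.ne'] at this
    exact absurd hEc (not_lt.2 this)
  obtain ⟨y, hyE, hyc⟩ := hy
  refine ⟨y, hyE, ?_⟩
  have hyn : ‖y‖ < 1/2 := by simpa using hE hyE
  have hb4 : ball y (2*(1/4)) ⊆ ball 0 1 := (ball_subset_ball (by norm_num)).trans (ball_half hyn)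
  have happ : ∀ (D : ℕ) (j : Fin (m+1)) (z : EuclideanSpace ℝ (Fin (m+1))), dist z y ≤ t →
      |pd j u z - eval (z - y).ofLp (pderiv j (TP D u y))| ≤ (1/2)^D := by
    intro D j z hz
    have e1 := TP_approx hn isOpen_ball (x := y) (ρ := 1/4) (M := 1) (by norm_num) hu hb4
      (fun j y' hy' => h1 j y' (hb4 hy')) D j (h := z - y) (by rw [← dist_eq_norm]; linarith)
    rwa [add_sub_cancel, mul_one] at e1
  have hbig : ∀ D : ℕ, SS (TP D u y) 0 (Real.exp 1 * R * t + 2*t) ≤ 2*nn := by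
    intro D
    have e1 := TP_bound hn isOpen_ball (x := y) (ρ := 1/4) (M := 1) (by norm_num) hu hb4
      (fun j y' hy' => h1 j y' (hb4 hy')) D
    rw [hcast, mul_one] at e1
    refine (SS_mono (by positivity) ?_).trans e1
    linarith
  have hS : ∀ D : ℕ, SS (TP D u y) 0 t ≤ 4*nn*(ε + (1/2)^D)^(1/(2*A+1)) := by
    intro D
    set P := TP D u y with hP
    set η : ℝ := (1/2)^D with hη
    have hη0 : 0 < η := by positivity
    set S := SS P 0 t with hSdef
    rcases (SS_nonneg (P := P) (z := 0) ht0.le).eq_or_lt with h0 | h0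
    · rw [hSdef, ← h0]; positivity
    change 0 < S at h0
    have hSle : S ≤ 2*nn := (SS_mono ht0.le (by linarith)).trans (hbig D)
    set Q := rsc (-y.ofLp) 1 P with hQ
    have hQS : ∀ (z : EuclideanSpace ℝ (Fin (m+1))) r, SS Q z.ofLp r = SS P (z - y).ofLp r := by
      intro z r
      rw [hQ, SS_rsc one_pos]
      simp only [one_mul, one_smul]
      congr 1
      rw [WithLp.ofLp_sub]; abel
    have hQy : ∀ r, SS Q y.ofLp r = SS P 0 r := by
      intro r; rw [hQS]; simp
    set N := Real.log (4*nn/S) with hN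
    have hdiv : 2 ≤ 4*nn/S := by rw [le_div_iff₀ h0]; linarith
    have hexpN : Real.exp N = 4*nn/S := Real.exp_log (by linarith)
    have hN12 : 1/2 ≤ N := by
      have h2 := Real.log_le_log (by norm_num) hdiv
      have := Real.log_two_gt_d9
      linarith
    obtain ⟨k, hk1, hk2'⟩ := pick_k m hN12
    have hSL : ∀ z : EuclideanSpace ℝ (Fin (m+1)), dist z y ≤ 2*t →
        SL Q z.ofLp (R*t) ((1/2) * ((1 - 1/(4*((m:ℝ)+1)))⁻¹)^k) := by
      intro z hz
      refine SL.mono_N (by positivity) (SL_of_growth (by positivity) ?_) hk1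
      have e1 := ss_shift (P := Q) (x := y) (y := z) (r := Real.exp 1 * (R*t)) (h := 2*t)
        (by positivity) hz
      rw [hQy, ← mul_assoc] at e1
      have e2 := ss_shift (P := Q) (x := z) (y := y) (r := t) (h := 2*t) ht0.le (by rwa [dist_comm])
      rw [hQy] at e2
      have e3 : SS Q z.ofLp (t + 2*t) ≤ SS Q z.ofLp (R*t) := SS_mono (by positivity) (by
        have := mul_le_mul_of_nonneg_right hR ht0.le
        linarith)
      have e4 : 4*nn ≤ Real.exp N * SS Q z.ofLp (R*t) := by
        rw [hexpN, div_mul_eq_mul_div, le_div_iff₀ h0]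
        exact mul_le_mul_of_nonneg_left (e2.trans e3) (by positivity)
      have e5 := hbig D
      rw [← mul_assoc]
      linarith
    have hL := hloc k A Q (HarmP.rsc _ _ (HarmP_TP isOpen_ball
      (mem_ball_zero_iff.2 (by linarith)) D hu)) y t ht0 (by rw [hQy]; exact h0) hSL
    rw [hQy] at hL
    set Nk : ℝ := (1/2) * ((1 - 1/(4*((m:ℝ)+1)))⁻¹)^k with hNk
    have hex : ∃ e ∈ E, dist e y ≤ t ∧ Real.exp (-A*Nk) * S < gr Q e.ofLp := by
      by_contra! hcon
      have hsub : E ∩ closedBall y t ⊆ {z : EuclideanSpace ℝ (Fin (m+1)) | dist z y ≤ t ∧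
          gr Q z.ofLp ≤ Real.exp (-A*Nk) * SS P 0 t} :=
        fun z hz => ⟨hz.2, hcon z hz.1 hz.2⟩
      have := (hyc.trans_le (hc_mono hs0 hsub)).trans_le (hL.trans (ENNReal.ofReal_le_ofReal hA1))
      exact lt_irrefl _ this
    obtain ⟨e, heE, hed, hegr⟩ := hex
    have hgr : gr Q e.ofLp ≤ nn * (ε + η) := by
      unfold gr
      have : ∀ j ∈ (Finset.univ : Finset (Fin (m+1))), |eval e.ofLp (pderiv j Q)| ≤ ε + η := by
        intro j _
        rw [hQ, pderiv_rsc, map_mul, eval_C, one_mul, eval_rsc]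
        have e1 := happ D j e hed
        have e2 := hεE j e heE
        have e3 : -y.ofLp + e.ofLp = (e - y).ofLp := by rw [WithLp.ofLp_sub]; abel
        rw [e3]
        have e4 := abs_sub_abs_le_abs_sub (eval (e-y).ofLp (pderiv j P)) (pd j u e)
        rw [abs_sub_comm] at e4
        linarith
      refine (Finset.sum_le_sum this).trans (le_of_eq ?_)
      simp [hnn]; ring
    have hSn : 0 < S/(4*nn) := by positivity
    have hexp2 : (S/(4*nn))^(2*A) ≤ Real.exp (-A*Nk) := by
      rw [Real.rpow_def_of_pos hSn]
      apply Real.exp_le_exp.2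
      have : Real.log (S/(4*nn)) = -N := by rw [hN, ← Real.log_inv, inv_div]
      rw [this]
      have := mul_le_mul_of_nonneg_left hk2' hA0
      linarith
    have hpow : (S/(4*nn))^(2*A+1) ≤ ε + η := by
      rw [Real.rpow_add hSn, Real.rpow_one]
      have e1 := mul_le_mul_of_nonneg_right hexp2 h0.le
      have e2 : (S/(4*nn))^(2*A) * S ≤ nn*(ε+η) := e1.trans (hegr.le.trans hgr)
      rw [← mul_div_assoc, div_le_iff₀ (by positivity)]
      have : 0 ≤ nn*(ε+η) := by positivity
      linarith
    have hfin : S/(4*nn) ≤ (ε+η)^(1/(2*A+1)) := by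
      have h2 := Real.rpow_le_rpow (by positivity) hpow (by positivity : 0 ≤ 1/(2*A+1))
      rwa [← Real.rpow_mul hSn.le, mul_one_div_cancel (by positivity), Real.rpow_one] at h2
    rw [div_le_iff₀ (by positivity)] at hfin
    linarith
  intro j z hz
  have hzd : dist z y ≤ t := (mem_ball.1 hz).le
  have hd : ∀ D : ℕ, |pd j u z| ≤ 4*nn*(ε + (1/2:ℝ)^D)^(1/(2*A+1)) + (1/2:ℝ)^D := by
    intro D
    have e1 := happ D j z hzd
    have e2 := eval_le_SS (TP D u y) (h := z - y) (r := t) (by rwa [← dist_eq_norm]) j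
    have e3 := abs_sub_abs_le_abs_sub (pd j u z) (eval (z-y).ofLp (pderiv j (TP D u y)))
    have := hS D
    linarith
  have hp : Tendsto (fun D : ℕ => (1/2:ℝ)^D) atTop (𝓝 0) :=
    _root_.tendsto_pow_atTop_nhds_zero_of_lt_one (by norm_num) (by norm_num)
  have hlim : Tendsto (fun D : ℕ => 4*nn*(ε + (1/2:ℝ)^D)^(1/(2*A+1)) + (1/2:ℝ)^D) atTop
      (𝓝 (4*nn*(ε + 0)^(1/(2*A+1)) + 0)) :=
    (((hp.const_add ε).rpow_const (Or.inr (by positivity))).const_mul _).add hp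
  rw [add_zero, add_zero] at hlim
  exact ge_of_tendsto' hlim hd

lemma supGrad_ge {n : ℕ} {u : EuclideanSpace ℝ (Fin n) → ℝ} (h : supGrad u (ball 0 1) = 1)
    {S : Set (EuclideanSpace ℝ (Fin n))} (hS : S ⊆ ball 0 1) {z : EuclideanSpace ℝ (Fin n)} (hz : z ∈ S) :
    ‖fderiv ℝ u z‖ ≤ supGrad u S := by
  have hb : BddAbove ((fun x => ‖fderiv ℝ u x‖) '' ball 0 1) := by
    by_contra hc
    have := Real.sSup_of_not_bddAbove hc
    unfold supGrad at h
    linarith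
  exact le_csSup (hb.mono (image_mono hS)) ⟨z, hz, rfl⟩

end final
end PoS

/-- **Theorem 1 (propagation of smallness for gradients of harmonic functions).**
If `u` is harmonic in the unit ball with `sup_B |∇u| = 1` and `E ⊆ B(0,1/2)` has
`(n-2+δ)`-Hausdorff content greater than `m`, then
`sup_{B(0,1/2)} |∇u| ≤ C (sup_E |∇u|)^α` with `C, α > 0` depending only on `m, δ, n`. -/
theorem propagation_of_smallness {n : ℕ} (hn : 2 ≤ n) (m δ : ℝ) (hm : 0 < m) (hδ : 0 < δ) :
    ∃ C α : ℝ, 0 < C ∧ 0 < α ∧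
      ∀ (u : EuclideanSpace ℝ (Fin n) → ℝ) (E : Set (EuclideanSpace ℝ (Fin n))),
        IsHarmonicOn u (ball 0 1) →
        supGrad u (ball 0 1) = 1 →
        E ⊆ ball 0 (1 / 2) →
        ENNReal.ofReal m < hausdorffContent ((n : ℝ) - 2 + δ) E →
        supGrad u (ball 0 (1 / 2)) ≤ C * supGrad u E ^ α := by
  obtain ⟨k, rfl⟩ : ∃ k, n = k + 1 := ⟨n - 1, by omega⟩
  have hk : 1 ≤ k := by omega
  obtain ⟨t, α, ht, ht1, hα, hloc⟩ := PoS.local_step k hk hδ hm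
  obtain ⟨L, hL⟩ := exists_nat_ge (1/t)
  have hLt : 1 ≤ L*t := by rwa [div_le_iff₀ ht] at hL
  set γ : ℝ := (1/2:ℝ)^L with hγ
  have hγ0 : 0 < γ := by positivity
  refine ⟨((k:ℝ)+1) * ((2*((k:ℝ)+1))^2 * (4*((k:ℝ)+1))^γ), α*γ, by positivity, by positivity, ?_⟩
  intro u E hu h1 hE hEc
  have hsub : ball (0 : EuclideanSpace ℝ (Fin (k+1))) (1/2) ⊆ ball 0 1 := ball_subset_ball (by norm_num)
  have hpd : ∀ j, ∀ z ∈ ball (0 : EuclideanSpace ℝ (Fin (k+1))) 1, |PoS.pd j u z| ≤ 1 := fun j z hz =>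
    (PoS.pd_le j z).trans ((PoS.supGrad_ge h1 subset_rfl hz).trans h1.le)
  have hε : 0 ≤ supGrad u E := Real.sSup_nonneg (by
    rintro _ ⟨z, _, rfl⟩
    exact norm_nonneg _)
  have hexp : (((k+1:ℕ):ℝ) - 2 + δ) = (k:ℝ) - 1 + δ := by push_cast; ring
  rw [hexp] at hEc
  obtain ⟨y, hyE, hy⟩ := hloc u E (supGrad u E) hu hpd hE hEc hε
    (fun j z hz => (PoS.pd_le j z).trans (PoS.supGrad_ge h1 (hE.trans hsub) hz))
  have hyn : ‖y‖ < 1/2 := by simpa using hE hyE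
  refine csSup_le ⟨_, 0, mem_ball_self (by norm_num), rfl⟩ ?_
  rintro _ ⟨x, hx, rfl⟩
  have hxn : ‖x‖ < 1/2 := by simpa using hx
  have hB := PoS.Bd_chain (Nat.succ_pos k) hu hpd hyn ht ht1 hy L x hxn (by
    rw [dist_eq_norm]
    linarith [norm_sub_le x y])
  have := PoS.fderiv_le (by positivity) (fun j => hB j x (mem_ball_self ht))
  refine this.trans (le_of_eq ?_)
  rw [Real.mul_rpow (by positivity) (by positivity), ← Real.rpow_mul hε]
  push_cast
  ring
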